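/- Let r := √2 − 1. For every FM-tetrahedron T of type 11rr (radii r_A = r_B = 1 and r_C = r_D = r) and every weighted tetrahedron T₀ with radii (1,1,r,r) and edge lengths dist(A,B) = 2, dist(C,D) = 2r, and dist(A,C) = dist(A,D) = dist(B,C) = dist(B,D) = 1 + r (the tight tetrahedron of type 11rr), one has δ(T) ≤ δ(T₀). -/

import Mathlib

open MeasureTheory Metric

noncomputable def tetra (A B C D : EuclideanSpace ℝ (Fin 3)) :
    Set (EuclideanSpace ℝ (Fin 3)) :=
  convexHull ℝ {A, B, C, D}

noncomputable def density (A B C D : EuclideanSpace ℝ (Fin 3)) (rA rB rC rD : ℝ) : ℝ :=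
  (volume (tetra A B C D ∩
    (closedBall A rA ∪ closedBall B rB ∪ closedBall C rC ∪ closedBall D rD))).toReal /
  (volume (tetra A B C D)).toReal

section


/-! ### Bounds on arctan -/
lemma arctan_le_tangent (x q : ℝ) (hx : 0 ≤ x) (hq : 0 ≤ q) :
    Real.arctan x ≤ Real.arctan q + (x - q) / (1 + q ^ 2) := by
  have hd : ∀ s : Set ℝ, DifferentiableOn ℝ Real.arctan s :=
    fun s => Real.differentiable_arctan.differentiableOn
  rcases le_total q x with h | h
  · have := (convex_Ici q).image_sub_le_mul_sub_of_deriv_le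
      (f := Real.arctan) (C := 1 / (1 + q ^ 2)) Real.continuous_arctan.continuousOn (hd _)
      (by
        intro y hy
        rw [interior_Ici] at hy
        have hy' : q < y := hy
        rw [Real.deriv_arctan]
        apply one_div_le_one_div_of_le (by positivity)
        nlinarith) q (by simp) x (by simpa using h) h
    have e : 1 / (1 + q ^ 2) * (x - q) = (x - q) / (1 + q ^ 2) := by ring
    linarith
  · have := (convex_Icc 0 q).mul_sub_le_image_sub_of_le_deriv
      (f := Real.arctan) (C := 1 / (1 + q ^ 2)) Real.continuous_arctan.continuousOn (hd _)
      (by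
        intro y hy
        rw [interior_Icc] at hy
        rw [Real.deriv_arctan]
        apply one_div_le_one_div_of_le (by positivity)
        nlinarith [hy.1, hy.2]) x ⟨hx, h⟩ q ⟨hq, le_refl _⟩ h
    have e : 1 / (1 + q ^ 2) * (q - x) = -((x - q) / (1 + q ^ 2)) := by ring
    linarith

lemma arctan_upper (y : ℝ) (h0 : 0 ≤ y) (h1 : y ≤ 1 / 64) :
    Real.arctan y ≤ y - 333 / 1000 * y ^ 3 := by
  have hm : MonotoneOn (fun t : ℝ => t - 333 / 1000 * t ^ 3 - Real.arctan t) (Set.Icc 0 (1 / 64)) := by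
    have hdd : ∀ t : ℝ, HasDerivAt (fun t : ℝ => t - 333 / 1000 * t ^ 3 - Real.arctan t)
        (1 - 333 / 1000 * (3 * t ^ 2) - 1 / (1 + t ^ 2)) t := by
      intro t
      have := ((hasDerivAt_id t).sub ((hasDerivAt_pow 3 t).const_mul (333 / 1000))).sub
        (Real.hasDerivAt_arctan t)
      exact this.congr_deriv (by simp)
    apply monotoneOn_of_deriv_nonneg (convex_Icc _ _)
    · exact fun t _ => (hdd t).continuousAt.continuousWithinAt
    · exact fun t _ => (hdd t).differentiableAt.differentiableWithinAt
    · intro t ht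
      rw [interior_Icc] at ht
      rw [(hdd t).deriv]
      have h2 : t ^ 2 ≤ 1 / 4096 := by nlinarith [ht.1, ht.2]
      have h3 : (0 : ℝ) < 1 + t ^ 2 := by positivity
      rw [sub_nonneg, div_le_iff₀ h3]
      nlinarith [sq_nonneg t]
  have := hm (⟨le_refl _, by norm_num⟩ : (0 : ℝ) ∈ Set.Icc (0 : ℝ) (1 / 64)) ⟨h0, h1⟩ h0
  simp at this
  linarith

lemma arctan_lower (y : ℝ) (h0 : 0 ≤ y) : y - 1 / 3 * y ^ 3 ≤ Real.arctan y := by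
  have hm : MonotoneOn (fun t : ℝ => Real.arctan t - (t - 1 / 3 * t ^ 3)) (Set.Ici 0) := by
    have hdd : ∀ t : ℝ, HasDerivAt (fun t : ℝ => Real.arctan t - (t - 1 / 3 * t ^ 3))
        (1 / (1 + t ^ 2) - (1 - 1 / 3 * (3 * t ^ 2))) t := by
      intro t
      have := (Real.hasDerivAt_arctan t).sub ((hasDerivAt_id t).sub
        ((hasDerivAt_pow 3 t).const_mul (1 / 3)))
      exact this.congr_deriv (by simp)
    apply monotoneOn_of_deriv_nonneg (convex_Ici _)
    · exact fun t _ => (hdd t).continuousAt.continuousWithinAt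
    · exact fun t _ => (hdd t).differentiableAt.differentiableWithinAt
    · intro t ht
      rw [(hdd t).deriv]
      have h3 : (0 : ℝ) < 1 + t ^ 2 := by positivity
      rw [sub_nonneg, le_div_iff₀ h3]
      nlinarith [sq_nonneg t, sq_nonneg (t ^ 2)]
  have := hm (show (0 : ℝ) ∈ Set.Ici 0 by simp) h0 h0
  simp at this
  linarith

lemma arctan_step (k : ℕ) : Real.arctan (((k : ℝ) + 1) / 64) =
    Real.arctan ((k : ℝ) / 64) + Real.arctan (64 / (4096 + k * (k + 1))) := by
  have hk : (0 : ℝ) ≤ k := Nat.cast_nonneg k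
  have hm : (0 : ℝ) < 4096 + k * (k + 1) := by positivity
  rw [Real.arctan_add]
  · congr 1
    have : (1 : ℝ) - k / 64 * (64 / (4096 + k * (k + 1))) ≠ 0 := by
      have : (1 : ℝ) - k / 64 * (64 / (4096 + k * (k + 1))) = (4096 + k ^ 2) / (4096 + k * (k + 1)) := by
        field_simp; ring
      rw [this]; positivity
    rw [eq_div_iff this]
    field_simp
    ring
  · rw [div_mul_div_comm, div_lt_one (by positivity)]
    nlinarith [sq_nonneg ((k : ℝ) - 64)]

/-- integer upper bound of `10^12 * arctan (k/64)` -/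
def atU (k : ℕ) : ℕ :=
  Nat.rec 0 (fun k ih => ih + (64000000000000 / (4096 + k * (k + 1)) + 1 -
    87293952000000000 / (4096 + k * (k + 1)) ^ 3)) k

/-- integer lower bound of `10^12 * arctan (k/64)` -/
def atL (k : ℕ) : ℕ :=
  Nat.rec 0 (fun k ih => ih + (64000000000000 / (4096 + k * (k + 1)) -
    (87381333333333334 / (4096 + k * (k + 1)) ^ 3 + 1))) k

lemma natdiv_le (a b : ℕ) : ((a / b : ℕ) : ℝ) ≤ (a : ℝ) / b := Nat.cast_div_le
lemma le_natdiv (a b : ℕ) (hb : 0 < b) : (a : ℝ) / b ≤ ((a / b : ℕ) : ℝ) + 1 := by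
  have := Nat.lt_div_mul_add (a := a) hb
  have h2 : a ≤ (a / b + 1) * b := by
    have := Nat.div_add_mod a b
    have := Nat.mod_lt a hb
    nlinarith
  rw [div_le_iff₀ (by exact_mod_cast hb)]
  exact_mod_cast h2
lemma natsub_ge (a b : ℕ) : (a : ℝ) - b ≤ ((a - b : ℕ) : ℝ) := by
  have : a ≤ (a - b) + b := by omega
  have : (a : ℝ) ≤ ((a - b : ℕ) : ℝ) + b := by exact_mod_cast this
  linarith

lemma atU_spec (k : ℕ) : 10 ^ 12 * Real.arctan ((k : ℝ) / 64) ≤ atU k := by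
  induction k with
  | zero => simp [atU]
  | succ k ih =>
    have hk : (0 : ℝ) ≤ k := Nat.cast_nonneg k
    have e : atU (k + 1) = atU k + (64000000000000 / (4096 + k * (k + 1)) + 1 -
      87293952000000000 / (4096 + k * (k + 1)) ^ 3) := rfl
    rw [e]
    push_cast
    rw [arctan_step]
    have hm : (0 : ℝ) < 4096 + k * (k + 1) := by positivity
    have h1 := arctan_upper (64 / (4096 + k * (k + 1))) (by positivity) (by
      rw [div_le_div_iff₀ hm (by norm_num)]; nlinarith)
    have h2 := natsub_ge (64000000000000 / (4096 + k * (k + 1)) + 1)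
      (87293952000000000 / (4096 + k * (k + 1)) ^ 3)
    have h3 := le_natdiv 64000000000000 (4096 + k * (k + 1)) (by positivity)
    have h4 := natdiv_le 87293952000000000 ((4096 + k * (k + 1)) ^ 3)
    push_cast at h1 h2 h3 h4 ⊢
    have e1 : (64 : ℝ) / (4096 + k * (k + 1)) - 333 / 1000 * (64 / (4096 + k * (k + 1))) ^ 3
      = (64000000000000 / (4096 + k * (k + 1)) - 87293952000000000 / (4096 + k * (k + 1)) ^ 3) / 10 ^ 12 := by
      field_simp; ring
    rw [e1] at h1
    rw [le_div_iff₀ (by norm_num)] at h1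
    linarith

lemma atL_spec (k : ℕ) : (atL k : ℝ) ≤ 10 ^ 12 * Real.arctan ((k : ℝ) / 64) := by
  induction k with
  | zero => simp [atL]
  | succ k ih =>
    have hk : (0 : ℝ) ≤ k := Nat.cast_nonneg k
    have e : atL (k + 1) = atL k + (64000000000000 / (4096 + k * (k + 1)) -
      (87381333333333334 / (4096 + k * (k + 1)) ^ 3 + 1)) := rfl
    rw [e]
    push_cast
    rw [arctan_step]
    have hm : (0 : ℝ) < 4096 + k * (k + 1) := by positivity
    have h0 : 0 ≤ Real.arctan (64 / (4096 + (k : ℝ) * (k + 1))) :=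
      Real.arctan_nonneg.2 (by positivity)
    have h1 := arctan_lower (64 / (4096 + k * (k + 1))) (by positivity)
    have e1 : (64 : ℝ) / (4096 + k * (k + 1)) - 1 / 3 * (64 / (4096 + k * (k + 1))) ^ 3
      = (64000000000000 / (4096 + k * (k + 1)) - (262144000000000000 / 3) / (4096 + k * (k + 1)) ^ 3) / 10 ^ 12 := by
      field_simp; ring
    rw [e1, div_le_iff₀ (by norm_num)] at h1
    have h3 := natdiv_le 64000000000000 (4096 + k * (k + 1))
    have h4 := le_natdiv 87381333333333334 ((4096 + k * (k + 1)) ^ 3) (by positivity)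
    have h5 : (262144000000000000 / 3 : ℝ) / (4096 + k * (k + 1)) ^ 3 ≤
        87381333333333334 / (4096 + k * (k + 1)) ^ 3 := by
      gcongr; norm_num
    push_cast at h3 h4
    rcases Nat.le_total (87381333333333334 / (4096 + k * (k + 1)) ^ 3 + 1)
      (64000000000000 / (4096 + k * (k + 1))) with h | h
    · rw [Nat.cast_sub h]
      push_cast
      linarith
    · rw [Nat.sub_eq_zero_of_le h]
      push_cast
      linarith

end

section


/-! ### Separate concavity -/
def Mixable (lo hi : ℝ) (V : ℝ → ℝ) : Prop :=
  ∀ x t : ℝ, 0 ≤ t → t ≤ 1 → x ^ 2 = (1 - t) * lo ^ 2 + t * hi ^ 2 →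
    (1 - t) * lo + t * hi ≤ x → (1 - t) * V lo + t * V hi ≤ V x

lemma mixable_of_poly (lo hi : ℝ) (V : ℝ → ℝ) (p q u w : ℝ)
    (hV : ∀ x, V x = p * x + q * x ^ 2 - u * x ^ 4 + w) (hp : 0 ≤ p) (hu : 0 ≤ u) :
    Mixable lo hi V := by
  intro x t h0 h1 hx hm
  rw [hV, hV, hV]
  have e : x ^ 4 = ((1 - t) * lo ^ 2 + t * hi ^ 2) ^ 2 := by rw [← hx]; ring
  rw [e, hx]
  have k1 := mul_le_mul_of_nonneg_left hm hp
  have k2 : 0 ≤ u * (t * (1 - t) * (lo ^ 2 - hi ^ 2) ^ 2) :=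
    mul_nonneg hu (mul_nonneg (mul_nonneg h0 (by linarith)) (sq_nonneg _))
  nlinarith

lemma mix_param (lo hi x : ℝ) (h0 : 0 ≤ lo) (h1 : lo ≤ x) (h2 : x ≤ hi) :
    ∃ t : ℝ, 0 ≤ t ∧ t ≤ 1 ∧ x ^ 2 = (1 - t) * lo ^ 2 + t * hi ^ 2 ∧
      (1 - t) * lo + t * hi ≤ x := by
  rcases eq_or_lt_of_le (h1.trans h2) with h | h
  · have hx : x = lo := by linarith
    refine ⟨0, le_refl _, zero_le_one, ?_, ?_⟩ <;> simp [hx]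
  · have hs : 0 < hi ^ 2 - lo ^ 2 := by nlinarith
    refine ⟨(x ^ 2 - lo ^ 2) / (hi ^ 2 - lo ^ 2), ?_, ?_, ?_, ?_⟩
    · apply div_nonneg _ hs.le; nlinarith
    · rw [div_le_one hs]; nlinarith
    · field_simp; ring
    · have hs2 : 0 < hi + lo := by linarith
      have e : (x ^ 2 - lo ^ 2) / (hi ^ 2 - lo ^ 2) = (x - lo) * (x + lo) / ((hi - lo) * (hi + lo)) := by
        congr 1 <;> ring
      have hl : 0 < hi - lo := by linarith
      rw [e]
      have e2 : (1 - (x - lo) * (x + lo) / ((hi - lo) * (hi + lo))) * lo +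
          (x - lo) * (x + lo) / ((hi - lo) * (hi + lo)) * hi = lo + (x - lo) * ((x + lo) / (hi + lo)) := by
        field_simp; ring
      rw [e2]
      have h3 : (x + lo) / (hi + lo) ≤ 1 := by rw [div_le_one hs2]; linarith
      nlinarith

/-- the predicate on the values at a point -/
def GG (μ δ κ b1 b2 b3 b4 d1 d2 d3 d4 C L : ℝ) : Prop :=
  0 < d1 ∧ 0 < d2 ∧ 0 < d3 ∧ 0 < d4 ∧ 0 ≤ C ∧ 0 ≤ δ + μ * L - (b1 / d1 + b2 / d2 + b3 / d3 + b4 / d4) ∧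
    κ ≤ Real.sqrt C * (δ + μ * L - (b1 / d1 + b2 / d2 + b3 / d3 + b4 / d4))

lemma inv_mix (b d d0 d1 t : ℝ) (hb : 0 ≤ b) (h0 : 0 < d0) (h1 : 0 < d1) (t0 : 0 ≤ t) (t1 : t ≤ 1)
    (h : (1 - t) * d0 + t * d1 ≤ d) : 0 < d ∧ b / d ≤ (1 - t) * (b / d0) + t * (b / d1) := by
  have hm : 0 < (1 - t) * d0 + t * d1 := by
    rcases eq_or_lt_of_le t0 with h | h
    · rw [← h]; simpa using h0
    · have : 0 < t * d1 := mul_pos h h1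
      have : 0 ≤ (1 - t) * d0 := mul_nonneg (by linarith) h0.le
      linarith
  have hd : 0 < d := hm.trans_le h
  refine ⟨hd, ?_⟩
  have h2 : b / d ≤ b / ((1 - t) * d0 + t * d1) := by gcongr
  refine h2.trans ?_
  have e : (1 - t) * (b / d0) + t * (b / d1) = b * ((1 - t) * d1 + t * d0) / (d0 * d1) := by
    field_simp
  rw [e, div_le_div_iff₀ hm (mul_pos h0 h1), mul_assoc]
  apply mul_le_mul_of_nonneg_left _ hb
  nlinarith [mul_nonneg (mul_nonneg t0 (sub_nonneg.2 t1)) (sq_nonneg (d0 - d1))]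

lemma prod_mix (C C0 C1 H H0 H1 κ t : ℝ) (c0 : 0 ≤ C0) (c1 : 0 ≤ C1) (h0 : 0 ≤ H0) (h1 : 0 ≤ H1)
    (t0 : 0 ≤ t) (t1 : t ≤ 1) (hC : (1 - t) * C0 + t * C1 ≤ C) (hH : (1 - t) * H0 + t * H1 ≤ H)
    (k0 : κ ≤ Real.sqrt C0 * H0) (k1 : κ ≤ Real.sqrt C1 * H1) : κ ≤ Real.sqrt C * H := by
  have s1 : 0 ≤ 1 - t := by linarith
  have hHn : 0 ≤ H := le_trans (by positivity) hH
  by_cases hk : κ ≤ 0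
  · exact hk.trans (by positivity)
  push Not at hk
  set p := Real.sqrt C0
  set q := Real.sqrt C1
  have hp : 0 ≤ p := Real.sqrt_nonneg _
  have hq : 0 ≤ q := Real.sqrt_nonneg _
  have ep : C0 = p ^ 2 := (Real.sq_sqrt c0).symm
  have eq : C1 = q ^ 2 := (Real.sq_sqrt c1).symm
  have hs : (1 - t) * p + t * q ≤ Real.sqrt C := by
    apply Real.le_sqrt_of_sq_le
    refine le_trans ?_ hC
    rw [ep, eq]
    nlinarith [mul_nonneg (mul_nonneg t0 s1) (sq_nonneg (p - q))]
  have hcross : 2 * κ ≤ p * H1 + q * H0 := by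
    have ha : 0 ≤ p * H1 := by positivity
    have hb : 0 ≤ q * H0 := by positivity
    have hab : κ ^ 2 ≤ (p * H1) * (q * H0) := by
      calc κ ^ 2 = κ * κ := by ring
        _ ≤ (p * H0) * (q * H1) := mul_le_mul k0 k1 hk.le (by positivity)
        _ = _ := by ring
    by_contra hc
    push Not at hc
    nlinarith [sq_nonneg (p * H1 - q * H0)]
  calc κ = (1 - t) ^ 2 * κ + t * (1 - t) * (2 * κ) + t ^ 2 * κ := by ring
    _ ≤ (1 - t) ^ 2 * (p * H0) + t * (1 - t) * (p * H1 + q * H0) + t ^ 2 * (q * H1) := by gcongr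
    _ = ((1 - t) * p + t * q) * ((1 - t) * H0 + t * H1) := by ring
    _ ≤ Real.sqrt C * H := by
        apply mul_le_mul hs hH (by positivity) (Real.sqrt_nonneg _)

lemma GG_mix (μ δ κ b1 b2 b3 b4 : ℝ) (hμ : 0 ≤ μ) (hb1 : 0 ≤ b1) (hb2 : 0 ≤ b2) (hb3 : 0 ≤ b3)
    (hb4 : 0 ≤ b4) (lo hi x : ℝ) (h0 : 0 ≤ lo) (h1 : lo ≤ x) (h2 : x ≤ hi)
    (v1 v2 v3 v4 v5 v6 : ℝ → ℝ) (m1 : Mixable lo hi v1) (m2 : Mixable lo hi v2)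
    (m3 : Mixable lo hi v3) (m4 : Mixable lo hi v4) (m5 : Mixable lo hi v5) (m6 : Mixable lo hi v6)
    (g0 : GG μ δ κ b1 b2 b3 b4 (v1 lo) (v2 lo) (v3 lo) (v4 lo) (v5 lo) (v6 lo))
    (g1 : GG μ δ κ b1 b2 b3 b4 (v1 hi) (v2 hi) (v3 hi) (v4 hi) (v5 hi) (v6 hi)) :
    GG μ δ κ b1 b2 b3 b4 (v1 x) (v2 x) (v3 x) (v4 x) (v5 x) (v6 x) := by
  obtain ⟨t, t0, t1, hx, hm⟩ := mix_param lo hi x h0 h1 h2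
  have n1 := m1 x t t0 t1 hx hm
  have n2 := m2 x t t0 t1 hx hm
  have n3 := m3 x t t0 t1 hx hm
  have n4 := m4 x t t0 t1 hx hm
  have n5 := m5 x t t0 t1 hx hm
  have n6 := m6 x t t0 t1 hx hm
  obtain ⟨p1, p2, p3, p4, p5, p6, p7⟩ := g0
  obtain ⟨q1, q2, q3, q4, q5, q6, q7⟩ := g1
  obtain ⟨i1, j1⟩ := inv_mix b1 _ _ _ t hb1 p1 q1 t0 t1 n1
  obtain ⟨i2, j2⟩ := inv_mix b2 _ _ _ t hb2 p2 q2 t0 t1 n2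
  obtain ⟨i3, j3⟩ := inv_mix b3 _ _ _ t hb3 p3 q3 t0 t1 n3
  obtain ⟨i4, j4⟩ := inv_mix b4 _ _ _ t hb4 p4 q4 t0 t1 n4
  have s1 : 0 ≤ 1 - t := by linarith
  have hH : (1 - t) * (δ + μ * v6 lo - (b1 / v1 lo + b2 / v2 lo + b3 / v3 lo + b4 / v4 lo)) +
      t * (δ + μ * v6 hi - (b1 / v1 hi + b2 / v2 hi + b3 / v3 hi + b4 / v4 hi)) ≤
      δ + μ * v6 x - (b1 / v1 x + b2 / v2 x + b3 / v3 x + b4 / v4 x) := by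
    have := mul_le_mul_of_nonneg_left n6 hμ
    linarith
  refine ⟨i1, i2, i3, i4, ?_, ?_, ?_⟩
  · exact le_trans (by positivity) n5
  · refine le_trans ?_ hH
    exact add_nonneg (mul_nonneg s1 p6) (mul_nonneg t0 q6)
  · exact prod_mix _ _ _ _ _ _ κ t p5 q5 p6 q6 t0 t1 n5 hH p7 q7

/-! ### The concrete functions (lengths scaled by 1000) -/
def Dv (a b c x y z : ℝ) : ℝ := (a + b) * (b + c) * (c + a) - (a * x ^ 2 + b * y ^ 2 + c * z ^ 2)
def pen (a b c : ℝ) : ℝ := (a - 1500) ^ 2 + (b - 1500) ^ 2 + (c - 1500) ^ 2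
def CC (a d e f g h : ℝ) : ℝ :=
  a ^ 2 * d ^ 2 * (e ^ 2 + f ^ 2 + g ^ 2 + h ^ 2) + e ^ 2 * h ^ 2 * (a ^ 2 + d ^ 2 + f ^ 2 + g ^ 2) +
    f ^ 2 * g ^ 2 * (a ^ 2 + d ^ 2 + e ^ 2 + h ^ 2) -
  (a ^ 2 * d ^ 2 * (a ^ 2 + d ^ 2) + e ^ 2 * h ^ 2 * (e ^ 2 + h ^ 2) + f ^ 2 * g ^ 2 * (f ^ 2 + g ^ 2) +
    a ^ 2 * e ^ 2 * g ^ 2 + a ^ 2 * f ^ 2 * h ^ 2 + d ^ 2 * e ^ 2 * f ^ 2 + d ^ 2 * g ^ 2 * h ^ 2)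
def LL (l0 l1 l2 l3 K a d e f g h : ℝ) : ℝ :=
  l0 * l1 * a ^ 2 + l2 * l3 * d ^ 2 + l0 * l2 * e ^ 2 + l0 * l3 * f ^ 2 + l1 * l2 * g ^ 2 +
    l1 * l3 * h ^ 2 - K

/-- leaf parameters -/
structure LP where
  (l0 l1 l2 l3 K T1 T2 T3 T4 ν μ b1 b2 b3 b4 δ κ z pn M : ℝ)

structure LP.Nonneg (p : LP) : Prop where
  T1 : 0 ≤ p.T1
  T2 : 0 ≤ p.T2
  T3 : 0 ≤ p.T3
  T4 : 0 ≤ p.T4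
  ν : 0 ≤ p.ν
  μ : 0 ≤ p.μ
  b1 : 0 ≤ p.b1
  b2 : 0 ≤ p.b2
  b3 : 0 ≤ p.b3
  b4 : 0 ≤ p.b4
  z : 0 ≤ p.z
  pn : 0 ≤ p.pn
  M : 0 < p.M

def LP.L (p : LP) (a d e f g h : ℝ) : ℝ := LL p.l0 p.l1 p.l2 p.l3 p.K a d e f g h
def LP.v1 (p : LP) (a d e f g h : ℝ) : ℝ := p.M * Dv a e f d h g + p.T1 * p.L a d e f g h
def LP.v2 (p : LP) (a d e f g h : ℝ) : ℝ := p.M * Dv a g h d f e + p.T2 * p.L a d e f g h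
def LP.v3 (p : LP) (a d e f g h : ℝ) : ℝ :=
  p.M * (Dv e g d h f a - p.pn * pen e g d) + p.T3 * p.L a d e f g h
def LP.v4 (p : LP) (a d e f g h : ℝ) : ℝ :=
  p.M * (Dv f h d g e a - p.pn * pen f h d) + p.T4 * p.L a d e f g h
def LP.v5 (p : LP) (a d e f g h : ℝ) : ℝ := p.z * CC a d e f g h + p.ν * p.L a d e f g h

def LP.Good (p : LP) (a d e f g h : ℝ) : Prop :=
  GG p.μ p.δ p.κ p.b1 p.b2 p.b3 p.b4 (p.v1 a d e f g h) (p.v2 a d e f g h) (p.v3 a d e f g h)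
    (p.v4 a d e f g h) (p.v5 a d e f g h) (p.L a d e f g h)

structure BoxOK (pn a0 a1 d0 d1 e0 e1 f0 f1 g0 g1 h0 h1 : ℝ) : Prop where
  pa : 0 ≤ a0
  pd : 0 ≤ d0
  pe : 0 ≤ e0
  pf : 0 ≤ f0
  pg : 0 ≤ g0
  ph : 0 ≤ h0
  A1 : d1 ≤ e0 + f0
  A2 : h1 ≤ a0 + f0
  A3 : g1 ≤ a0 + e0
  B1 : d1 ≤ g0 + h0
  B2 : f1 ≤ a0 + h0
  B3 : e1 ≤ a0 + g0
  C1 : h1 ^ 2 ≤ (g0 + d0) ^ 2 + 3000 * pn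
  C2 : f1 ^ 2 ≤ (e0 + d0) ^ 2 + 3000 * pn
  C3 : a1 ^ 2 ≤ (e0 + g0) ^ 2 + 3000 * pn
  D1 : g1 ^ 2 ≤ (h0 + d0) ^ 2 + 3000 * pn
  D2 : e1 ^ 2 ≤ (f0 + d0) ^ 2 + 3000 * pn
  D3 : a1 ^ 2 ≤ (f0 + h0) ^ 2 + 3000 * pn

lemma mixable_of_poly' (lo hi : ℝ) (V : ℝ → ℝ) (p u : ℝ) (hp : 0 ≤ p) (hu : 0 ≤ u)
    (hV : ∀ x, V x = p * x + (V 1 - p + u - V 0) * x ^ 2 - u * x ^ 4 + V 0) :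
    Mixable lo hi V := mixable_of_poly lo hi V p _ u _ hV hp hu

lemma coef1 (M x y z X Y Z : ℝ) (hM : 0 < M) (hx : 0 ≤ x) (hxX : x ≤ X) (hy : 0 ≤ Y) (hz : 0 ≤ Z)
    (hyY : Y ≤ y) (hzZ : Z ≤ z) (h : X ≤ Y + Z) : 0 ≤ M * ((y + z) ^ 2 - x ^ 2) := by
  apply mul_nonneg hM.le
  nlinarith

lemma coef2 (M pn x y z X Y Z : ℝ) (hM : 0 < M) (hx : 0 ≤ x) (hxX : x ≤ X) (hy : 0 ≤ Y) (hz : 0 ≤ Z)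
    (hyY : Y ≤ y) (hzZ : Z ≤ z) (h : X ^ 2 ≤ (Y + Z) ^ 2 + 3000 * pn) :
    0 ≤ M * ((y + z) ^ 2 - x ^ 2 + 3000 * pn) := by
  apply mul_nonneg hM.le
  have : (Y + Z) ^ 2 ≤ (y + z) ^ 2 := by gcongr
  have : x ^ 2 ≤ X ^ 2 := by gcongr
  linarith

lemma box_good (p : LP) (hp : p.Nonneg) (a0 a1 d0 d1 e0 e1 f0 f1 g0 g1 h0 h1 : ℝ)
    (B : BoxOK p.pn a0 a1 d0 d1 e0 e1 f0 f1 g0 g1 h0 h1)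
    (hc : ∀ a, (a = a0 ∨ a = a1) → ∀ d, (d = d0 ∨ d = d1) → ∀ e, (e = e0 ∨ e = e1) →
      ∀ f, (f = f0 ∨ f = f1) → ∀ g, (g = g0 ∨ g = g1) → ∀ h, (h = h0 ∨ h = h1) →
      p.Good a d e f g h) :
    ∀ a, a0 ≤ a → a ≤ a1 → ∀ d, d0 ≤ d → d ≤ d1 → ∀ e, e0 ≤ e → e ≤ e1 →
      ∀ f, f0 ≤ f → f ≤ f1 → ∀ g, g0 ≤ g → g ≤ g1 → ∀ h, h0 ≤ h → h ≤ h1 →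
      p.Good a d e f g h := by
  intro a ha1 ha2 d hd1 hd2 e he1 he2 f hf1 hf2 g hg1 hg2 h hh1 hh2
  have la := ha1.trans ha2
  have ld := hd1.trans hd2
  have le := he1.trans he2
  have lf := hf1.trans hf2
  have lg := hg1.trans hg2
  have lh := hh1.trans hh2
  have pa := B.pa.trans ha1
  have pd := B.pd.trans hd1
  have pe := B.pe.trans he1
  have pf := B.pf.trans hf1
  have pg := B.pg.trans hg1
  have ph := B.ph.trans hh1
  have box : ∀ {x lo hi : ℝ}, lo ≤ hi → (x = lo ∨ x = hi) → lo ≤ x ∧ x ≤ hi := by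
    rintro x lo hi hl (rfl | rfl)
    · exact ⟨le_refl _, hl⟩
    · exact ⟨hl, le_refl _⟩
  have coordH : ∀ a d e f g, a0 ≤ a → a ≤ a1 → d0 ≤ d → d ≤ d1 → e0 ≤ e → e ≤ e1 → f0 ≤ f → f ≤ f1 →
      g0 ≤ g → g ≤ g1 → p.Good a d e f g h0 → p.Good a d e f g h1 → p.Good a d e f g h := by
    intro a d e f g ha1 ha2 hd1 hd2 he1 he2 hf1 hf2 hg1 hg2 k0 k1
    refine GG_mix _ _ _ _ _ _ _ hp.μ hp.b1 hp.b2 hp.b3 hp.b4 h0 h1 h B.ph hh1 hh2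
      (fun h => p.v1 a d e f g h) (fun h => p.v2 a d e f g h) (fun h => p.v3 a d e f g h)
      (fun h => p.v4 a d e f g h) (fun h => p.v5 a d e f g h) (fun h => p.L a d e f g h)
      ?_ ?_ ?_ ?_ ?_ ?_ k0 k1
    · exact mixable_of_poly' _ _ _ 0 0 le_rfl le_rfl (fun x => by simp only [LP.v1, LP.L, LL, Dv]; ring)
    · refine mixable_of_poly' _ _ _ (p.M * ((a + g) ^ 2 - e ^ 2)) 0 ?_ le_rfl
        (fun x => by simp only [LP.v2, LP.L, LL, Dv]; ring)
      exact coef1 _ _ _ _ e1 a0 g0 hp.M (B.pe.trans he1) he2 B.pa B.pg ha1 hg1 B.B3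
    · exact mixable_of_poly' _ _ _ 0 0 le_rfl le_rfl (fun x => by simp only [LP.v3, LP.L, LL, Dv]; ring)
    · refine mixable_of_poly' _ _ _ (p.M * ((f + d) ^ 2 - e ^ 2 + 3000 * p.pn)) 0 ?_ le_rfl
        (fun x => by simp only [LP.v4, LP.L, LL, Dv, pen]; ring)
      exact coef2 _ _ _ _ _ e1 f0 d0 hp.M (B.pe.trans he1) he2 B.pf B.pd hf1 hd1 B.D2
    · exact mixable_of_poly' _ _ _ 0 (p.z * e ^ 2) le_rfl (mul_nonneg hp.z (sq_nonneg _))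
        (fun x => by simp only [LP.v5, LP.L, LL, CC]; ring)
    · exact mixable_of_poly' _ _ _ 0 0 le_rfl le_rfl (fun x => by simp only [LP.L, LL]; ring)
  have coordG : ∀ a d e f, a0 ≤ a → a ≤ a1 → d0 ≤ d → d ≤ d1 → e0 ≤ e → e ≤ e1 → f0 ≤ f → f ≤ f1 →
      p.Good a d e f g0 h → p.Good a d e f g1 h → p.Good a d e f g h := by
    intro a d e f ha1 ha2 hd1 hd2 he1 he2 hf1 hf2 k0 k1
    refine GG_mix _ _ _ _ _ _ _ hp.μ hp.b1 hp.b2 hp.b3 hp.b4 g0 g1 g B.pg hg1 hg2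
      (fun g => p.v1 a d e f g h) (fun g => p.v2 a d e f g h) (fun g => p.v3 a d e f g h)
      (fun g => p.v4 a d e f g h) (fun g => p.v5 a d e f g h) (fun g => p.L a d e f g h)
      ?_ ?_ ?_ ?_ ?_ ?_ k0 k1
    · exact mixable_of_poly' _ _ _ 0 0 le_rfl le_rfl (fun x => by simp only [LP.v1, LP.L, LL, Dv]; ring)
    · refine mixable_of_poly' _ _ _ (p.M * ((a + h) ^ 2 - f ^ 2)) 0 ?_ le_rfl
        (fun x => by simp only [LP.v2, LP.L, LL, Dv]; ring)
      exact coef1 _ _ _ _ f1 a0 h0 hp.M (B.pf.trans hf1) hf2 B.pa B.ph ha1 hh1 B.B2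
    · refine mixable_of_poly' _ _ _ (p.M * ((e + d) ^ 2 - f ^ 2 + 3000 * p.pn)) 0 ?_ le_rfl
        (fun x => by simp only [LP.v3, LP.L, LL, Dv, pen]; ring)
      exact coef2 _ _ _ _ _ f1 e0 d0 hp.M (B.pf.trans hf1) hf2 B.pe B.pd he1 hd1 B.C2
    · exact mixable_of_poly' _ _ _ 0 0 le_rfl le_rfl (fun x => by simp only [LP.v4, LP.L, LL, Dv]; ring)
    · exact mixable_of_poly' _ _ _ 0 (p.z * f ^ 2) le_rfl (mul_nonneg hp.z (sq_nonneg _))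
        (fun x => by simp only [LP.v5, LP.L, LL, CC]; ring)
    · exact mixable_of_poly' _ _ _ 0 0 le_rfl le_rfl (fun x => by simp only [LP.L, LL]; ring)
  have coordF : ∀ a d e, a0 ≤ a → a ≤ a1 → d0 ≤ d → d ≤ d1 → e0 ≤ e → e ≤ e1 →
      p.Good a d e f0 g h → p.Good a d e f1 g h → p.Good a d e f g h := by
    intro a d e ha1 ha2 hd1 hd2 he1 he2 k0 k1
    refine GG_mix _ _ _ _ _ _ _ hp.μ hp.b1 hp.b2 hp.b3 hp.b4 f0 f1 f B.pf hf1 hf2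
      (fun f => p.v1 a d e f g h) (fun f => p.v2 a d e f g h) (fun f => p.v3 a d e f g h)
      (fun f => p.v4 a d e f g h) (fun f => p.v5 a d e f g h) (fun f => p.L a d e f g h)
      ?_ ?_ ?_ ?_ ?_ ?_ k0 k1
    · refine mixable_of_poly' _ _ _ (p.M * ((a + e) ^ 2 - g ^ 2)) 0 ?_ le_rfl
        (fun x => by simp only [LP.v1, LP.L, LL, Dv]; ring)
      exact coef1 _ _ _ _ g1 a0 e0 hp.M (B.pg.trans hg1) hg2 B.pa B.pe ha1 he1 B.A3
    · exact mixable_of_poly' _ _ _ 0 0 le_rfl le_rfl (fun x => by simp only [LP.v2, LP.L, LL, Dv]; ring)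
    · exact mixable_of_poly' _ _ _ 0 0 le_rfl le_rfl (fun x => by simp only [LP.v3, LP.L, LL, Dv]; ring)
    · refine mixable_of_poly' _ _ _ (p.M * ((h + d) ^ 2 - g ^ 2 + 3000 * p.pn)) 0 ?_ le_rfl
        (fun x => by simp only [LP.v4, LP.L, LL, Dv, pen]; ring)
      exact coef2 _ _ _ _ _ g1 h0 d0 hp.M (B.pg.trans hg1) hg2 B.ph B.pd hh1 hd1 B.D1
    · exact mixable_of_poly' _ _ _ 0 (p.z * g ^ 2) le_rfl (mul_nonneg hp.z (sq_nonneg _))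
        (fun x => by simp only [LP.v5, LP.L, LL, CC]; ring)
    · exact mixable_of_poly' _ _ _ 0 0 le_rfl le_rfl (fun x => by simp only [LP.L, LL]; ring)
  have coordE : ∀ a d, a0 ≤ a → a ≤ a1 → d0 ≤ d → d ≤ d1 →
      p.Good a d e0 f g h → p.Good a d e1 f g h → p.Good a d e f g h := by
    intro a d ha1 ha2 hd1 hd2 k0 k1
    refine GG_mix _ _ _ _ _ _ _ hp.μ hp.b1 hp.b2 hp.b3 hp.b4 e0 e1 e B.pe he1 he2
      (fun e => p.v1 a d e f g h) (fun e => p.v2 a d e f g h) (fun e => p.v3 a d e f g h)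
      (fun e => p.v4 a d e f g h) (fun e => p.v5 a d e f g h) (fun e => p.L a d e f g h)
      ?_ ?_ ?_ ?_ ?_ ?_ k0 k1
    · refine mixable_of_poly' _ _ _ (p.M * ((a + f) ^ 2 - h ^ 2)) 0 ?_ le_rfl
        (fun x => by simp only [LP.v1, LP.L, LL, Dv]; ring)
      exact coef1 _ _ _ _ h1 a0 f0 hp.M (B.ph.trans hh1) hh2 B.pa B.pf ha1 hf1 B.A2
    · exact mixable_of_poly' _ _ _ 0 0 le_rfl le_rfl (fun x => by simp only [LP.v2, LP.L, LL, Dv]; ring)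
    · refine mixable_of_poly' _ _ _ (p.M * ((g + d) ^ 2 - h ^ 2 + 3000 * p.pn)) 0 ?_ le_rfl
        (fun x => by simp only [LP.v3, LP.L, LL, Dv, pen]; ring)
      exact coef2 _ _ _ _ _ h1 g0 d0 hp.M (B.ph.trans hh1) hh2 B.pg B.pd hg1 hd1 B.C1
    · exact mixable_of_poly' _ _ _ 0 0 le_rfl le_rfl (fun x => by simp only [LP.v4, LP.L, LL, Dv]; ring)
    · exact mixable_of_poly' _ _ _ 0 (p.z * h ^ 2) le_rfl (mul_nonneg hp.z (sq_nonneg _))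
        (fun x => by simp only [LP.v5, LP.L, LL, CC]; ring)
    · exact mixable_of_poly' _ _ _ 0 0 le_rfl le_rfl (fun x => by simp only [LP.L, LL]; ring)
  have coordD : ∀ a, a0 ≤ a → a ≤ a1 →
      p.Good a d0 e f g h → p.Good a d1 e f g h → p.Good a d e f g h := by
    intro a ha1 ha2 k0 k1
    refine GG_mix _ _ _ _ _ _ _ hp.μ hp.b1 hp.b2 hp.b3 hp.b4 d0 d1 d B.pd hd1 hd2
      (fun d => p.v1 a d e f g h) (fun d => p.v2 a d e f g h) (fun d => p.v3 a d e f g h)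
      (fun d => p.v4 a d e f g h) (fun d => p.v5 a d e f g h) (fun d => p.L a d e f g h)
      ?_ ?_ ?_ ?_ ?_ ?_ k0 k1
    · exact mixable_of_poly' _ _ _ 0 0 le_rfl le_rfl (fun x => by simp only [LP.v1, LP.L, LL, Dv]; ring)
    · exact mixable_of_poly' _ _ _ 0 0 le_rfl le_rfl (fun x => by simp only [LP.v2, LP.L, LL, Dv]; ring)
    · refine mixable_of_poly' _ _ _ (p.M * ((e + g) ^ 2 - a ^ 2 + 3000 * p.pn)) 0 ?_ le_rfl
        (fun x => by simp only [LP.v3, LP.L, LL, Dv, pen]; ring)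
      exact coef2 _ _ _ _ _ a1 e0 g0 hp.M (B.pa.trans ha1) ha2 B.pe B.pg he1 hg1 B.C3
    · refine mixable_of_poly' _ _ _ (p.M * ((f + h) ^ 2 - a ^ 2 + 3000 * p.pn)) 0 ?_ le_rfl
        (fun x => by simp only [LP.v4, LP.L, LL, Dv, pen]; ring)
      exact coef2 _ _ _ _ _ a1 f0 h0 hp.M (B.pa.trans ha1) ha2 B.pf B.ph hf1 hh1 B.D3
    · exact mixable_of_poly' _ _ _ 0 (p.z * a ^ 2) le_rfl (mul_nonneg hp.z (sq_nonneg _))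
        (fun x => by simp only [LP.v5, LP.L, LL, CC]; ring)
    · exact mixable_of_poly' _ _ _ 0 0 le_rfl le_rfl (fun x => by simp only [LP.L, LL]; ring)
  have coordA : p.Good a0 d e f g h → p.Good a1 d e f g h → p.Good a d e f g h := by
    intro k0 k1
    refine GG_mix _ _ _ _ _ _ _ hp.μ hp.b1 hp.b2 hp.b3 hp.b4 a0 a1 a B.pa ha1 ha2
      (fun a => p.v1 a d e f g h) (fun a => p.v2 a d e f g h) (fun a => p.v3 a d e f g h)
      (fun a => p.v4 a d e f g h) (fun a => p.v5 a d e f g h) (fun a => p.L a d e f g h)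
      ?_ ?_ ?_ ?_ ?_ ?_ k0 k1
    · refine mixable_of_poly' _ _ _ (p.M * ((e + f) ^ 2 - d ^ 2)) 0 ?_ le_rfl
        (fun x => by simp only [LP.v1, LP.L, LL, Dv]; ring)
      exact coef1 _ _ _ _ d1 e0 f0 hp.M (B.pd.trans hd1) hd2 B.pe B.pf he1 hf1 B.A1
    · refine mixable_of_poly' _ _ _ (p.M * ((g + h) ^ 2 - d ^ 2)) 0 ?_ le_rfl
        (fun x => by simp only [LP.v2, LP.L, LL, Dv]; ring)
      exact coef1 _ _ _ _ d1 g0 h0 hp.M (B.pd.trans hd1) hd2 B.pg B.ph hg1 hh1 B.B1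
    · exact mixable_of_poly' _ _ _ 0 0 le_rfl le_rfl (fun x => by simp only [LP.v3, LP.L, LL, Dv]; ring)
    · exact mixable_of_poly' _ _ _ 0 0 le_rfl le_rfl (fun x => by simp only [LP.v4, LP.L, LL, Dv]; ring)
    · exact mixable_of_poly' _ _ _ 0 (p.z * d ^ 2) le_rfl (mul_nonneg hp.z (sq_nonneg _))
        (fun x => by simp only [LP.v5, LP.L, LL, CC]; ring)
    · exact mixable_of_poly' _ _ _ 0 0 le_rfl le_rfl (fun x => by simp only [LP.L, LL]; ring)
  have s1 : ∀ a, (a = a0 ∨ a = a1) → ∀ d, (d = d0 ∨ d = d1) → ∀ e, (e = e0 ∨ e = e1) →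
      ∀ f, (f = f0 ∨ f = f1) → ∀ g, (g = g0 ∨ g = g1) → p.Good a d e f g h :=
    fun a ka d kd e ke f kf g kg => coordH a d e f g (box la ka).1 (box la ka).2 (box ld kd).1
      (box ld kd).2 (box le ke).1 (box le ke).2 (box lf kf).1 (box lf kf).2 (box lg kg).1 (box lg kg).2
      (hc a ka d kd e ke f kf g kg _ (Or.inl rfl)) (hc a ka d kd e ke f kf g kg _ (Or.inr rfl))
  have s2 : ∀ a, (a = a0 ∨ a = a1) → ∀ d, (d = d0 ∨ d = d1) → ∀ e, (e = e0 ∨ e = e1) →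
      ∀ f, (f = f0 ∨ f = f1) → p.Good a d e f g h :=
    fun a ka d kd e ke f kf => coordG a d e f (box la ka).1 (box la ka).2 (box ld kd).1
      (box ld kd).2 (box le ke).1 (box le ke).2 (box lf kf).1 (box lf kf).2
      (s1 a ka d kd e ke f kf _ (Or.inl rfl)) (s1 a ka d kd e ke f kf _ (Or.inr rfl))
  have s3 : ∀ a, (a = a0 ∨ a = a1) → ∀ d, (d = d0 ∨ d = d1) → ∀ e, (e = e0 ∨ e = e1) →
      p.Good a d e f g h :=
    fun a ka d kd e ke => coordF a d e (box la ka).1 (box la ka).2 (box ld kd).1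
      (box ld kd).2 (box le ke).1 (box le ke).2
      (s2 a ka d kd e ke _ (Or.inl rfl)) (s2 a ka d kd e ke _ (Or.inr rfl))
  have s4 : ∀ a, (a = a0 ∨ a = a1) → ∀ d, (d = d0 ∨ d = d1) → p.Good a d e f g h :=
    fun a ka d kd => coordE a d (box la ka).1 (box la ka).2 (box ld kd).1
      (box ld kd).2 (s3 a ka d kd _ (Or.inl rfl)) (s3 a ka d kd _ (Or.inr rfl))
  have s5 : ∀ a, (a = a0 ∨ a = a1) → p.Good a d e f g h :=
    fun a ka => coordD a (box la ka).1 (box la ka).2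
      (s4 a ka _ (Or.inl rfl)) (s4 a ka _ (Or.inr rfl))
  exact coordA (s5 _ (Or.inl rfl)) (s5 _ (Or.inr rfl))

end

section


/-! ### From `Good` to the target inequality -/
lemma one_term (S D q d b c M : ℝ) (hS : 0 ≤ S) (hq : 0 ≤ q) (hd : 0 < d) (hM : 0 < M)
    (hc : 0 ≤ c) (hdD : d ≤ M * D) (hb : c * M / (1 + q ^ 2) ≤ b) :
    c * Real.arctan (S / D) ≤ c * (Real.arctan q - q / (1 + q ^ 2)) + S * (b / d) := by
  have hD : 0 < D := by
    by_contra h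
    push Not at h
    nlinarith
  have h1 := arctan_le_tangent (S / D) q (div_nonneg hS hD.le) hq
  have hq1 : 0 < 1 + q ^ 2 := by positivity
  have h2 : c * (S / D / (1 + q ^ 2)) ≤ S * (b / d) := by
    calc c * (S / D / (1 + q ^ 2)) = S * ((c * M / (1 + q ^ 2)) / (M * D)) := by
          field_simp
      _ ≤ S * (b / d) := by
          apply mul_le_mul_of_nonneg_left _ hS
          have : 0 ≤ c * M / (1 + q ^ 2) := by positivity
          exact div_le_div₀ (this.trans hb) hb hd hdD
  have h3 := mul_le_mul_of_nonneg_left h1 hc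
  have e : c * (Real.arctan q + (S / D - q) / (1 + q ^ 2)) =
    c * (Real.arctan q - q / (1 + q ^ 2)) + c * (S / D / (1 + q ^ 2)) := by ring
  linarith

/-- the target inequality -/
def Target (δ w1 w2 w3 w4 a d e f g h : ℝ) : Prop :=
  0 < Dv a e f d h g ∧ 0 < Dv a g h d f e ∧ 0 < Dv e g d h f a ∧ 0 < Dv f h d g e a ∧
  w1 * Real.arctan (Real.sqrt (CC a d e f g h) / Dv a e f d h g) +
  w2 * Real.arctan (Real.sqrt (CC a d e f g h) / Dv a g h d f e) +
  w3 * Real.arctan (Real.sqrt (CC a d e f g h) / Dv e g d h f a) +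
  w4 * Real.arctan (Real.sqrt (CC a d e f g h) / Dv f h d g e a) ≤
  Real.sqrt (CC a d e f g h) * δ

lemma target_of_good (p : LP) (hp : p.Nonneg) (a d e f g h q1 q2 q3 q4 c1 c2 c3 c4 : ℝ)
    (hG : p.Good a d e f g h) (hL : p.L a d e f g h ≤ 0) (hC : 0 ≤ CC a d e f g h) (hz : p.z ≤ 1)
    (hq1 : 0 ≤ q1) (hq2 : 0 ≤ q2) (hq3 : 0 ≤ q3) (hq4 : 0 ≤ q4)
    (hc1 : 0 ≤ c1) (hc2 : 0 ≤ c2) (hc3 : 0 ≤ c3) (hc4 : 0 ≤ c4)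
    (hb1 : c1 * p.M / (1 + q1 ^ 2) ≤ p.b1) (hb2 : c2 * p.M / (1 + q2 ^ 2) ≤ p.b2)
    (hb3 : c3 * p.M / (1 + q3 ^ 2) ≤ p.b3) (hb4 : c4 * p.M / (1 + q4 ^ 2) ≤ p.b4)
    (hκ : c1 * (Real.arctan q1 - q1 / (1 + q1 ^ 2)) + c2 * (Real.arctan q2 - q2 / (1 + q2 ^ 2)) +
      c3 * (Real.arctan q3 - q3 / (1 + q3 ^ 2)) + c4 * (Real.arctan q4 - q4 / (1 + q4 ^ 2)) ≤ p.κ) :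
    Target p.δ c1 c2 c3 c4 a d e f g h := by
  obtain ⟨g1, g2, g3, g4, g5, g6, g7⟩ := hG
  have pe1 : 0 ≤ p.pn * pen e g d := mul_nonneg hp.pn (by unfold pen; positivity)
  have pe2 : 0 ≤ p.pn * pen f h d := mul_nonneg hp.pn (by unfold pen; positivity)
  have k1 : p.v1 a d e f g h ≤ p.M * Dv a e f d h g := by
    have := mul_nonneg hp.T1 (neg_nonneg.2 hL); unfold LP.v1; linarith
  have k2 : p.v2 a d e f g h ≤ p.M * Dv a g h d f e := by
    have := mul_nonneg hp.T2 (neg_nonneg.2 hL); unfold LP.v2; linarith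
  have k3 : p.v3 a d e f g h ≤ p.M * Dv e g d h f a := by
    have := mul_nonneg hp.T3 (neg_nonneg.2 hL); unfold LP.v3; nlinarith [mul_nonneg hp.M.le pe1]
  have k4 : p.v4 a d e f g h ≤ p.M * Dv f h d g e a := by
    have := mul_nonneg hp.T4 (neg_nonneg.2 hL); unfold LP.v4; nlinarith [mul_nonneg hp.M.le pe2]
  have k5 : p.v5 a d e f g h ≤ CC a d e f g h := by
    have := mul_nonneg hp.ν (neg_nonneg.2 hL); unfold LP.v5
    nlinarith [mul_nonneg (sub_nonneg.2 hz) hC]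
  have pos : ∀ x : ℝ, ∀ v : ℝ, 0 < v → v ≤ p.M * x → 0 < x := by
    intro x v hv hx
    exact (mul_pos_iff_of_pos_left hp.M).1 (hv.trans_le hx)
  refine ⟨pos _ _ g1 k1, pos _ _ g2 k2, pos _ _ g3 k3, pos _ _ g4 k4, ?_⟩
  set S := Real.sqrt (CC a d e f g h)
  have hS : 0 ≤ S := Real.sqrt_nonneg _
  have t1 := one_term S _ q1 _ p.b1 c1 p.M hS hq1 g1 hp.M hc1 k1 hb1
  have t2 := one_term S _ q2 _ p.b2 c2 p.M hS hq2 g2 hp.M hc2 k2 hb2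
  have t3 := one_term S _ q3 _ p.b3 c3 p.M hS hq3 g3 hp.M hc3 k3 hb3
  have t4 := one_term S _ q4 _ p.b4 c4 p.M hS hq4 g4 hp.M hc4 k4 hb4
  have hs : Real.sqrt (p.v5 a d e f g h) ≤ S := Real.sqrt_le_sqrt k5
  have hμ : p.μ * p.L a d e f g h ≤ 0 := mul_nonpos_of_nonneg_of_nonpos hp.μ hL
  have m1 := mul_le_mul_of_nonneg_right hs g6
  have m2 := mul_nonpos_of_nonneg_of_nonpos hS hμ
  have m3 : S * (p.δ + p.μ * p.L a d e f g h - (p.b1 / p.v1 a d e f g h + p.b2 / p.v2 a d e f g h +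
      p.b3 / p.v3 a d e f g h + p.b4 / p.v4 a d e f g h)) = S * p.δ + S * (p.μ * p.L a d e f g h) -
      (S * (p.b1 / p.v1 a d e f g h) + S * (p.b2 / p.v2 a d e f g h) +
      S * (p.b3 / p.v3 a d e f g h) + S * (p.b4 / p.v4 a d e f g h)) := by ring
  linarith

/-! ### Support sphere cut -/
def Supp (a d e f g h : ℝ) : Prop := ∀ l0 l1 l2 l3 : ℝ, 0 ≤ l0 + l1 + l2 + l3 →
  0 ≤ (l0 + l1) + (Real.sqrt 2 - 1) * (l2 + l3) →
  l0 * l1 * a ^ 2 + l2 * l3 * d ^ 2 + l0 * l2 * e ^ 2 + l0 * l3 * f ^ 2 + l1 * l2 * g ^ 2 +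
    l1 * l3 * h ^ 2 ≤ (l0 + l1 + l2 + l3) * (2 * (l0 + l1) + 4 * (Real.sqrt 2 - 1) ^ 2 * (l2 + l3)) * 10 ^ 6

/-! ### The natural number checker -/
local notation:65 x:65 "+." y:66 => Nat.add x y
local notation:70 x:70 "*." y:71 => Nat.mul x y

def all2 (lo hi : ℕ) (f : ℕ → Bool) : Bool := and (f lo) (f hi)

/-- parameters of a leaf -/
structure NP where
  (p0 p1 p2 p3 n0 n1 n2 n3 T1 T2 T3 T4 ν μ k1 k2 k3 k4 z : ℕ)

def DP (a b c : ℕ) : ℕ := (a +. b) *. (b +. c) *. (c +. a)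
def DN (a b c x y z : ℕ) : ℕ := a *. x +. b *. y +. c *. z
def pen1 (a : ℕ) : ℕ := (Nat.sub a 1500 +. Nat.sub 1500 a) *. (Nat.sub a 1500 +. Nat.sub 1500 a)

def corner2 (M T1 T2 T3 T4 ν μ z B1 B2 B3 B4 κ2 : ℕ) (d1p d1n d2p d2n d3p d3n d4p d4n cp cn lp ln : ℕ) : Bool :=
  let e1 := Nat.sub (M *. d1p +. T1 *. lp) (M *. d1n +. T1 *. ln)
  let e2 := Nat.sub (M *. d2p +. T2 *. lp) (M *. d2n +. T2 *. ln)
  let e3 := Nat.sub (M *. d3p +. T3 *. lp) (M *. d3n +. T3 *. ln)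
  let e4 := Nat.sub (M *. d4p +. T4 *. lp) (M *. d4n +. T4 *. ln)
  let hp := 810460000000000 +. μ *. lp
  let hn := μ *. ln +. (Nat.div B1 e1 +. Nat.div B2 e2 +. Nat.div B3 e3 +. Nat.div B4 e4 +. 4)
  let h := Nat.sub hp hn
  let vp := z *. cp +. ν *. lp
  let vn := z *. cn +. ν *. ln
  and (Nat.ble 1 e1) (and (Nat.ble 1 e2) (and (Nat.ble 1 e3) (and (Nat.ble 1 e4)
    (and (Nat.ble hn hp) (and (Nat.ble vn vp) (Nat.ble κ2 (Nat.sub vp vn *. (h *. h))))))))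

def cap (p0 n0 p1 n1 : ℕ) : ℕ := p0 *. p1 +. n0 *. n1
def can (p0 n0 p1 n1 : ℕ) : ℕ := p0 *. n1 +. n0 *. p1

def corner1 (M T1 T2 T3 T4 ν μ z B1 B2 B3 B4 κ2 : ℕ)
   (qa qd qe qf qg qh ra rd re rf rg rh K a d e f g h A D E F G H : ℕ) : Bool :=
  corner2 M T1 T2 T3 T4 ν μ z B1 B2 B3 B4 κ2
    (DP a e f) (DN a e f D H G) (DP a g h) (DN a g h D F E)
    (DP e g d) (DN e g d H F A +. 2 *. (pen1 e +. pen1 g +. pen1 d))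
    (DP f h d) (DN f h d G E A +. 2 *. (pen1 f +. pen1 h +. pen1 d))
    (A *. D *. (E +. F +. G +. H) +. E *. H *. (A +. D +. F +. G) +. F *. G *. (A +. D +. E +. H))
    (A *. D *. (A +. D) +. E *. H *. (E +. H) +. F *. G *. (F +. G) +. A *. E *. G +. A *. F *. H +.
      D *. E *. F +. D *. G *. H)
    (qa *. A +. qd *. D +. qe *. E +. qf *. F +. qg *. G +. qh *. H)
    (ra *. A +. rd *. D +. re *. E +. rf *. F +. rg *. G +. rh *. H +. K)

def cBp (k : ℕ) : ℕ := Nat.div (8 * 10 ^ 30 * 4096) (4096 +. k *. k) +. 1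
def cBr (k : ℕ) : ℕ := Nat.div (8 * 710678118655 * 10 ^ 17 * 4096) (4096 +. k *. k) +. 1
/-- upper bound of `10^12 * (arctan (k/64) - (k/64)/(1+(k/64)^2))` -/
def cA (k : ℕ) : ℕ := Nat.sub (atU k) (Nat.div (64 *. k *. 10 ^ 12) (4096 +. k *. k))
def cκ (k1 k2 k3 k4 : ℕ) : ℕ := 8 * 10 ^ 12 *. (cA k1 +. cA k2) +. (710678118655 * 8 / 10 + 1) *. (cA k3 +. cA k4)

structure NB where
  (a0 a1 d0 d1 e0 e1 f0 f1 g0 g1 h0 h1 : ℕ)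

def lamOK (p0 p1 p2 p3 n0 n1 n2 n3 : ℕ) : Bool :=
  and (Nat.ble (n0 +. n1 +. n2 +. n3) (p0 +. p1 +. p2 +. p3))
    (and (Nat.ble (1000 *. (n0 +. n1) +. 415 *. (n2 +. n3)) (1000 *. (p0 +. p1) +. 414 *. (p2 +. p3)))
     (Nat.ble (2000000 *. (n0 +. n1) +. 686291 *. (n2 +. n3)) (2000000 *. (p0 +. p1) +. 686292 *. (p2 +. p3))))
def KK (p0 p1 p2 p3 n0 n1 n2 n3 : ℕ) : ℕ :=
  Nat.sub (p0 +. p1 +. p2 +. p3) (n0 +. n1 +. n2 +. n3) *.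
    Nat.sub (2000000 *. (p0 +. p1) +. 686292 *. (p2 +. p3)) (2000000 *. (n0 +. n1) +. 686291 *. (n2 +. n3))

def inRoot (a0 a1 d0 d1 e0 e1 f0 f1 g0 g1 h0 h1 : ℕ) : Bool :=
  and (Nat.ble 2000 a0) <| and (Nat.ble a1 2829) <| and (Nat.ble 828 d0) <| and (Nat.ble d1 1657) <|
  and (Nat.ble 1414 e0) <| and (Nat.ble e1 2243) <| and (Nat.ble 1414 f0) <| and (Nat.ble f1 2243) <|
  and (Nat.ble 1414 g0) <| and (Nat.ble g1 2243) <| and (Nat.ble 1414 h0) (Nat.ble h1 2243)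

def leafOK (p : NP) (a0 a1 d0 d1 e0 e1 f0 f1 g0 g1 h0 h1 : ℕ) : Bool :=
  and (inRoot a0 a1 d0 d1 e0 e1 f0 f1 g0 g1 h0 h1) <|
  and (lamOK p.p0 p.p1 p.p2 p.p3 p.n0 p.n1 p.n2 p.n3) <|
  and (Nat.ble p.z 1) <|
  and (Nat.ble (p.k1 +. p.k2 +. p.k3 +. p.k4) (1000 *. p.z)) <|
  all2 a0 a1 fun a => all2 d0 d1 fun d => all2 e0 e1 fun e => all2 f0 f1 fun f => all2 g0 g1 fun g =>
  all2 h0 h1 fun h =>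
  corner1 1000000 p.T1 p.T2 p.T3 p.T4 p.ν p.μ p.z
    (cBp (p.k1)) (cBp p.k2) (cBr p.k3) (cBr p.k4)
    (p.z *. (cκ p.k1 p.k2 p.k3 p.k4 *. cκ p.k1 p.k2 p.k3 p.k4))
    (cap p.p0 p.n0 p.p1 p.n1) (cap p.p2 p.n2 p.p3 p.n3) (cap p.p0 p.n0 p.p2 p.n2)
    (cap p.p0 p.n0 p.p3 p.n3) (cap p.p1 p.n1 p.p2 p.n2) (cap p.p1 p.n1 p.p3 p.n3)
    (can p.p0 p.n0 p.p1 p.n1) (can p.p2 p.n2 p.p3 p.n3) (can p.p0 p.n0 p.p2 p.n2)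
    (can p.p0 p.n0 p.p3 p.n3) (can p.p1 p.n1 p.p2 p.n2) (can p.p1 p.n1 p.p3 p.n3)
    (KK p.p0 p.p1 p.p2 p.p3 p.n0 p.n1 p.n2 p.n3)
    a d e f g h (a *. a) (d *. d) (e *. e) (f *. f) (g *. g) (h *. h)

/-- certificate tree -/
inductive Tr where
  | sa (c : ℕ) (l r : Tr) | sd (c : ℕ) (l r : Tr) | se (c : ℕ) (l r : Tr)
  | sf (c : ℕ) (l r : Tr) | sg (c : ℕ) (l r : Tr) | sh (c : ℕ) (l r : Tr)
  | symF | symG | symH | t0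
  | lf (p : NP)

def chk : Tr → ℕ → ℕ → ℕ → ℕ → ℕ → ℕ → ℕ → ℕ → ℕ → ℕ → ℕ → ℕ → Bool
  | .sa c l r, a0, a1, d0, d1, e0, e1, f0, f1, g0, g1, h0, h1 =>
    and (chk l a0 c d0 d1 e0 e1 f0 f1 g0 g1 h0 h1) (chk r c a1 d0 d1 e0 e1 f0 f1 g0 g1 h0 h1)
  | .sd c l r, a0, a1, d0, d1, e0, e1, f0, f1, g0, g1, h0, h1 =>
    and (chk l a0 a1 d0 c e0 e1 f0 f1 g0 g1 h0 h1) (chk r a0 a1 c d1 e0 e1 f0 f1 g0 g1 h0 h1)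
  | .se c l r, a0, a1, d0, d1, e0, e1, f0, f1, g0, g1, h0, h1 =>
    and (chk l a0 a1 d0 d1 e0 c f0 f1 g0 g1 h0 h1) (chk r a0 a1 d0 d1 c e1 f0 f1 g0 g1 h0 h1)
  | .sf c l r, a0, a1, d0, d1, e0, e1, f0, f1, g0, g1, h0, h1 =>
    and (chk l a0 a1 d0 d1 e0 e1 f0 c g0 g1 h0 h1) (chk r a0 a1 d0 d1 e0 e1 c f1 g0 g1 h0 h1)
  | .sg c l r, a0, a1, d0, d1, e0, e1, f0, f1, g0, g1, h0, h1 =>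
    and (chk l a0 a1 d0 d1 e0 e1 f0 f1 g0 c h0 h1) (chk r a0 a1 d0 d1 e0 e1 f0 f1 c g1 h0 h1)
  | .sh c l r, a0, a1, d0, d1, e0, e1, f0, f1, g0, g1, h0, h1 =>
    and (chk l a0 a1 d0 d1 e0 e1 f0 f1 g0 g1 h0 c) (chk r a0 a1 d0 d1 e0 e1 f0 f1 g0 g1 c h1)
  | .symF, _, _, _, _, _, e1, f0, _, _, _, _, _ => Nat.ble e1 f0
  | .symG, _, _, _, _, _, e1, _, _, g0, _, _, _ => Nat.ble e1 g0
  | .symH, _, _, _, _, _, e1, _, _, _, _, h0, _ => Nat.ble e1 h0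
  | .t0, _, a1, _, d1, _, e1, _, f1, _, g1, _, h1 =>
    and (Nat.ble a1 2275) <| and (Nat.ble d1 1620) <| and (Nat.ble e1 1730) <| and (Nat.ble f1 1730) <|
      and (Nat.ble g1 1730) (Nat.ble h1 1730)
  | .lf p, a0, a1, d0, d1, e0, e1, f0, f1, g0, g1, h0, h1 => leafOK p a0 a1 d0 d1 e0 e1 f0 f1 g0 g1 h0 h1

end

section

def theTree : Tr :=
 (.sa 2275
 (.sd 1620
 (.se 1828
 (.sf 1828
 (.sd 1224
 (.sg 1828
 (.sg 1703
 (.sh 1828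
 (.se 1621
 (.sf 1621
 (.sh 1621
 .t0
 .symH)
 .symF)
 (.lf ⟨0, 0, 0, 0, 0, 0, 0, 0, 0, 0, 0, 0, 0, 0, 0, 0, 30, 57, 1⟩))
 .symH)
 (.sh 1828
 (.lf ⟨0, 0, 0, 0, 0, 0, 0, 0, 0, 0, 0, 0, 0, 0, 7, 6, 26, 155, 1⟩)
 .symH))
 .symG)
 (.lf ⟨0, 0, 0, 0, 0, 0, 0, 0, 0, 0, 0, 0, 0, 0, 0, 0, 0, 0, 0⟩))
 .symF)
 (.sh 1730
 (.sf 1730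
 (.sg 1994
 (.sd 1065
 (.sh 1508
 (.sf 1572
 (.se 2035
 (.sa 2137
 (.sd 946
 (.sg 1820
 (.se 1931
 (.lf ⟨0, 0, 0, 0, 0, 0, 0, 0, 0, 0, 0, 0, 0, 0, 4, 6, 18, 166, 1⟩)
 (.sg 1617
 (.lf ⟨0, 0, 0, 0, 0, 0, 0, 0, 0, 0, 0, 0, 0, 0, 0, 0, 16, 102, 1⟩)
 (.sa 2068
 (.lf ⟨7, 3, 15, 0, 0, 0, 0, 12, 0, 0, 0, 13466667, 29137356143, 0, 5, 6, 13, 220, 1⟩)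
 (.lf ⟨7, 4, 15, 0, 0, 0, 0, 12, 0, 0, 0, 13466667, 29864519329, 0, 5, 6, 13, 216, 1⟩))))
 (.se 1931
 (.sg 1907
 (.lf ⟨5, 5, 15, 0, 0, 0, 0, 13, 0, 0, 0, 9426667, 23138355159, 66286, 5, 6, 13, 448, 1⟩)
 (.lf ⟨5, 6, 15, 0, 0, 0, 0, 12, 0, 0, 0, 18853333, 49930060537, 0, 5, 5, 12, 266, 1⟩))
 (.lf ⟨6, 5, 15, 0, 0, 0, 0, 13, 0, 0, 0, 18853333, 56743552976, 0, 5, 6, 11, 217, 1⟩)))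
 (.lf ⟨7, 4, 15, 0, 0, 0, 0, 13, 0, 0, 0, 13466667, 11646192262, 0, 6, 8, 15, 144, 1⟩))
 (.sg 1704
 (.sg 1559
 (.lf ⟨0, 0, 0, 0, 0, 0, 0, 0, 0, 0, 0, 0, 0, 0, 0, 0, 19, 142, 1⟩)
 (.lf ⟨7, 4, 15, 0, 0, 0, 0, 14, 0, 0, 0, 13466667, 29485747176, 0, 5, 6, 16, 207, 1⟩))
 (.sg 1849
 (.lf ⟨7, 5, 15, 0, 0, 0, 0, 13, 0, 0, 0, 13466667, 43523269880, 0, 5, 6, 13, 384, 1⟩)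
 (.lf ⟨7, 7, 15, 0, 0, 0, 0, 11, 0, 0, 0, 13466667, 48177184335, 0, 5, 5, 12, 334, 1⟩))))
 (.se 2097
 (.sg 1704
 (.sa 2137
 (.sd 946
 (.sf 1493
 (.sg 1559
 (.sa 2068
 (.sg 1486
 (.lf ⟨8, 0, 15, 0, 0, 1, 0, 11, 0, 0, 0, 5891667, 31118158224, 406939, 3, 4, 12, 75, 1⟩)
 (.lf ⟨8, 0, 15, 0, 0, 0, 0, 11, 0, 0, 0, 11783333, 61760496208, 0, 4, 5, 12, 90, 1⟩))
 (.lf ⟨8, 1, 15, 0, 0, 0, 0, 11, 0, 0, 0, 11783333, 60022743657, 0, 3, 5, 13, 91, 1⟩))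
 (.lf ⟨8, 2, 15, 0, 0, 0, 0, 12, 0, 0, 0, 13231459, 30626972842, 132279, 4, 5, 12, 159, 1⟩))
 (.lf ⟨0, 0, 0, 0, 0, 0, 0, 0, 0, 0, 0, 0, 0, 0, 3, 6, 15, 93, 1⟩))
 (.lf ⟨0, 0, 0, 0, 0, 0, 0, 0, 0, 0, 0, 0, 0, 0, 6, 9, 15, 69, 1⟩))
 (.sg 1559
 (.lf ⟨8, 1, 15, 0, 0, 0, 0, 12, 0, 0, 0, 11783333, 57700974282, 0, 3, 4, 14, 159, 1⟩)
 (.lf ⟨8, 3, 15, 0, 0, 0, 0, 11, 0, 0, 0, 26181232, 52373808490, 0, 5, 7, 13, 151, 1⟩)))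
 (.lf ⟨8, 4, 15, 0, 0, 0, 0, 12, 0, 0, 0, 23999463, 63380114427, 0, 5, 6, 11, 152, 1⟩))
 (.sa 2137
 (.sg 1704
 (.sg 1559
 (.lf ⟨8, 0, 15, 0, 0, 0, 0, 9, 0, 0, 0, 34381769, 144478978543, 0, 4, 7, 12, 74, 1⟩)
 (.lf ⟨8, 1, 15, 0, 0, 0, 0, 10, 0, 0, 0, 30943592, 139653253922, 0, 5, 8, 12, 92, 1⟩))
 (.lf ⟨8, 4, 15, 0, 0, 0, 0, 8, 23566667, 11783333, 0, 41174511, 81099328828, 224590, 0, 2, 10, 116, 1⟩))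
 (.lf ⟨9, 2, 15, 0, 0, 0, 0, 10, 0, 0, 0, 35617054, 118170898584, 5101, 5, 7, 12, 138, 1⟩))))
 (.sa 2082
 (.lf ⟨6, 3, 15, 0, 0, 0, 0, 9, 0, 0, 0, 15711111, 6824256632, 174158, 4, 6, 16, 111, 1⟩)
 (.lf ⟨7, 4, 15, 0, 0, 0, 0, 9, 0, 0, 0, 13466667, 25845594591, 29155, 4, 5, 16, 152, 1⟩)))
 (.sg 1820
 (.se 2035
 (.sg 1617
 (.lf ⟨0, 0, 0, 0, 0, 0, 0, 0, 0, 0, 0, 0, 0, 0, 2, 5, 23, 53, 1⟩)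
 (.lf ⟨6, 2, 15, 0, 0, 0, 0, 11, 0, 0, 0, 16755556, 0, 4412, 6, 7, 20, 188, 1⟩))
 (.sa 2137
 (.sg 1617
 (.lf ⟨8, 0, 15, 0, 0, 1, 0, 10, 0, 0, 0, 12566667, 108717482476, 0, 4, 5, 11, 55, 1⟩)
 (.lf ⟨8, 1, 15, 0, 0, 0, 0, 10, 0, 0, 0, 12566667, 103629542551, 0, 3, 0, 12, 140, 1⟩))
 (.sg 1617
 (.lf ⟨8, 0, 15, 0, 0, 0, 0, 10, 0, 0, 0, 12566667, 100787023854, 0, 0, 0, 13, 81, 1⟩)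
 (.lf ⟨8, 2, 15, 0, 0, 0, 0, 10, 0, 0, 0, 31329526, 98605158988, 0, 5, 7, 14, 91, 1⟩))))
 (.sa 2137
 (.lf ⟨6, 4, 15, 0, 0, 0, 0, 12, 0, 0, 0, 16755556, 98588160395, 0, 5, 4, 11, 116, 1⟩)
 (.lf ⟨6, 5, 15, 0, 0, 0, 0, 11, 0, 0, 0, 18853333, 101583096273, 0, 5, 5, 13, 114, 1⟩))))
 (.sg 1704
 (.lf ⟨0, 0, 0, 0, 0, 0, 0, 0, 0, 0, 0, 0, 0, 0, 0, 0, 16, 103, 1⟩)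
 (.lf ⟨6, 4, 15, 0, 0, 0, 0, 7, 0, 0, 0, 15711111, 32336342389, 0, 8, 9, 14, 85, 1⟩)))
 (.se 1952
 .symG
 (.lf ⟨6, 7, 15, 0, 0, 0, 0, 7, 0, 0, 0, 42490009, 138618838799, 83705, 7, 7, 11, 210, 1⟩)))
 (.sd 1224
 (.sg 1828
 (.lf ⟨0, 0, 0, 0, 0, 0, 0, 0, 0, 0, 0, 0, 0, 0, 0, 4, 26, 61, 1⟩)
 (.sf 1986
 (.lf ⟨4, 6, 15, 0, 0, 0, 0, 9, 0, 0, 0, 23566667, 0, 68397, 0, 0, 0, 0, 0⟩)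
 (.lf ⟨10, 6, 15, 8, 0, 0, 0, 0, 0, 9426667, 0, 9426667, 0, 142558, 0, 0, 0, 0, 0⟩)))
 (.lf ⟨0, 0, 0, 0, 0, 0, 0, 0, 0, 0, 0, 0, 0, 0, 0, 0, 0, 0, 0⟩)))
 (.sd 1224
 (.sf 1828
 (.sg 1828
 (.sg 1703
 (.sh 1986
 (.lf ⟨6, 0, 15, 0, 0, 2, 0, 8, 0, 0, 0, 19222222, 0, 1422, 0, 0, 0, 0, 0⟩)
 (.lf ⟨0, 7, 0, 15, 3, 0, 10, 0, 0, 0, 17409524, 0, 0, 182883, 0, 0, 0, 0, 0⟩))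
 (.se 2035
 (.lf ⟨0, 0, 0, 0, 0, 0, 0, 0, 0, 0, 0, 0, 0, 0, 0, 0, 0, 0, 0⟩)
 (.lf ⟨8, 0, 15, 0, 0, 0, 0, 9, 0, 0, 0, 14416667, 0, 660653, 0, 0, 0, 0, 0⟩)))
 (.sh 1986
 (.lf ⟨6, 4, 15, 0, 0, 0, 0, 9, 0, 0, 0, 23566667, 0, 68397, 0, 0, 0, 0, 0⟩)
 (.lf ⟨7, 10, 15, 9, 0, 0, 0, 0, 9426667, 14814815, 0, 9426667, 0, 47348, 0, 0, 0, 0, 0⟩)))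
 (.lf ⟨3, 4, 0, 15, 0, 0, 8, 0, 0, 0, 30466667, 0, 0, 237619, 0, 0, 0, 0, 0⟩))
 (.lf ⟨0, 0, 0, 0, 0, 0, 0, 0, 0, 0, 0, 0, 0, 0, 0, 0, 0, 0, 0⟩))))
 (.lf ⟨0, 0, 0, 0, 0, 0, 0, 0, 0, 0, 0, 0, 0, 0, 12, 12, 24, 24, 1⟩))
 (.sh 1828
 (.sd 1620
 (.sa 2662
 (.se 1828
 (.sf 1828
 (.sg 1828
 (.sd 1224
 (.sh 1621
 (.sg 1703
 (.sa 2468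
 (.se 1538
 (.lf ⟨0, 0, 0, 0, 0, 0, 0, 0, 0, 0, 0, 0, 0, 0, 4, 4, 95, 32, 1⟩)
 (.lf ⟨0, 0, 0, 0, 0, 0, 0, 0, 0, 0, 0, 0, 0, 0, 4, 4, 33, 216, 1⟩))
 (.se 1621
 (.sf 1621
 (.sd 1026
 (.se 1517
 (.sd 966
 (.sf 1517
 (.sg 1558
 (.sh 1517
 (.lf ⟨15, 15, 0, 0, 0, 0, 9, 14, 0, 0, 0, 0, 9438216384, 111016, 2, 2, 22, 24, 1⟩)
 .symH)
 .symG)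
 .symF)
 (.lf ⟨0, 0, 0, 0, 0, 0, 0, 0, 0, 0, 0, 0, 0, 0, 0, 0, 0, 0, 0⟩))
 (.sg 1558
 (.lf ⟨0, 0, 0, 0, 0, 0, 0, 0, 0, 0, 0, 0, 0, 0, 0, 0, 38, 49, 1⟩)
 (.lf ⟨0, 0, 0, 0, 0, 0, 0, 0, 0, 0, 0, 0, 0, 0, 0, 0, 29, 165, 1⟩)))
 (.lf ⟨0, 0, 0, 0, 0, 0, 0, 0, 0, 0, 0, 0, 0, 0, 0, 0, 0, 0, 0⟩))
 .symF)
 (.sf 1538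
 (.sd 1026
 (.se 1724
 (.sg 1558
 (.lf ⟨0, 0, 0, 0, 0, 0, 0, 0, 0, 0, 0, 0, 0, 0, 0, 0, 28, 110, 1⟩)
 (.lf ⟨8, 8, 10, 0, 0, 0, 0, 15, 0, 0, 0, 12937500, 4029722032, 117100, 3, 3, 25, 213, 1⟩))
 (.sg 1558
 (.lf ⟨11, 9, 12, 0, 0, 0, 0, 15, 0, 0, 0, 8363636, 0, 26158, 3, 3, 26, 171, 1⟩)
 (.lf ⟨10, 9, 12, 0, 0, 0, 0, 15, 0, 0, 0, 9200000, 13855471523, 44198, 4, 4, 21, 245, 1⟩)))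
 (.sd 1125
 (.lf ⟨0, 0, 0, 0, 0, 0, 0, 0, 0, 0, 0, 0, 0, 0, 1, 2, 24, 73, 1⟩)
 (.lf ⟨0, 0, 0, 0, 0, 0, 0, 0, 0, 0, 0, 0, 0, 0, 0, 0, 0, 0, 0⟩)))
 (.lf ⟨0, 0, 0, 0, 0, 0, 0, 0, 0, 0, 0, 0, 0, 0, 0, 0, 34, 99, 1⟩))))
 (.se 1703
 .symG
 (.sf 1621
 (.lf ⟨9, 9, 15, 0, 0, 0, 0, 14, 0, 0, 0, 10222222, 19923399841, 0, 5, 5, 18, 412, 1⟩)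
 (.lf ⟨0, 0, 0, 0, 0, 0, 0, 0, 0, 0, 0, 0, 0, 0, 3, 4, 26, 75, 1⟩))))
 (.se 1621
 .symH
 (.lf ⟨0, 0, 0, 0, 0, 0, 0, 0, 0, 0, 0, 0, 0, 0, 5, 5, 88, 87, 1⟩)))
 (.lf ⟨0, 0, 0, 0, 0, 0, 0, 0, 0, 0, 0, 0, 0, 0, 0, 0, 0, 0, 0⟩))
 .symG)
 .symF)
 (.sf 1994
 (.sd 1382
 (.sd 1105
 (.sf 1704
 (.sg 1994
 (.sh 1730
 (.sh 1572
 (.sf 1559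
 (.se 2118
 (.sa 2468
 (.sf 1486
 (.sg 1704
 (.se 1973
 (.sa 2371
 (.lf ⟨9, 5, 15, 0, 0, 0, 0, 13, 0, 0, 0, 10474074, 13685070581, 0, 5, 6, 18, 285, 1⟩)
 (.lf ⟨9, 6, 14, 0, 0, 0, 0, 15, 0, 0, 0, 11222222, 18600897716, 0, 4, 5, 18, 305, 1⟩))
 (.sg 1559
 (.lf ⟨9, 4, 15, 0, 0, 0, 0, 12, 0, 0, 0, 10598405, 24514943211, 170058, 3, 5, 15, 250, 1⟩)
 (.lf ⟨9, 5, 15, 0, 0, 0, 0, 13, 0, 0, 0, 18853333, 45892397473, 0, 4, 5, 14, 201, 1⟩)))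
 (.lf ⟨8, 7, 15, 0, 0, 0, 0, 14, 0, 0, 0, 13466667, 51819154160, 0, 4, 5, 12, 406, 1⟩))
 (.sg 1704
 (.lf ⟨8, 4, 15, 0, 0, 0, 0, 12, 0, 0, 0, 11783333, 24878403924, 0, 4, 6, 18, 171, 1⟩)
 (.lf ⟨9, 7, 15, 0, 0, 0, 0, 10, 0, 0, 0, 14152381, 42519805320, 0, 5, 5, 14, 329, 1⟩)))
 (.se 1915
 (.sg 1588
 (.lf ⟨11, 8, 12, 0, 0, 0, 0, 15, 0, 0, 0, 9409091, 11546686071, 92627, 3, 4, 21, 219, 1⟩)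
 (.lf ⟨10, 9, 14, 0, 0, 0, 0, 15, 0, 0, 0, 11222222, 34842610245, 0, 4, 4, 15, 291, 1⟩))
 (.sg 1588
 (.lf ⟨11, 7, 14, 0, 0, 0, 0, 15, 0, 0, 0, 10753247, 25517281550, 0, 3, 5, 17, 190, 1⟩)
 (.lf ⟨11, 9, 15, 0, 0, 0, 0, 14, 10474074, 0, 0, 10474074, 43921026163, 0, 4, 5, 14, 238, 1⟩))))
 (.lf ⟨10, 4, 15, 0, 0, 0, 0, 10, 23566667, 0, 20700000, 28593264, 115426989034, 0, 4, 7, 14, 88, 1⟩))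
 (.sg 1704
 (.lf ⟨9, 5, 15, 0, 0, 0, 0, 9, 0, 0, 0, 10474074, 26114412558, 0, 3, 5, 20, 126, 1⟩)
 (.lf ⟨9, 8, 15, 0, 0, 0, 0, 7, 0, 0, 0, 11500000, 44812995720, 0, 5, 6, 16, 137, 1⟩)))
 (.se 2035
 (.sg 1704
 (.lf ⟨7, 3, 15, 0, 0, 0, 0, 11, 0, 0, 0, 14971429, 4048588582, 0, 4, 5, 26, 189, 1⟩)
 (.lf ⟨9, 8, 15, 0, 0, 0, 0, 7, 0, 0, 0, 11644444, 33474452929, 0, 6, 6, 19, 108, 1⟩))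
 (.lf ⟨9, 3, 15, 0, 0, 0, 0, 10, 0, 0, 0, 31422222, 82015704088, 0, 2, 2, 13, 69, 1⟩)))
 (.se 2035
 (.lf ⟨8, 5, 15, 0, 0, 0, 0, 8, 0, 0, 0, 18853333, 0, 0, 6, 6, 27, 75, 1⟩)
 (.lf ⟨8, 2, 15, 0, 0, 0, 0, 9, 0, 0, 0, 34021107, 0, 531013, 0, 0, 0, 0, 0⟩)))
 (.lf ⟨8, 9, 15, 0, 0, 0, 0, 9, 0, 11783333, 0, 31770294, 94823710770, 80848, 6, 5, 15, 84, 1⟩))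
 (.sg 1828
 (.lf ⟨9, 5, 15, 0, 0, 0, 0, 0, 0, 0, 0, 10474074, 0, 85145, 4, 6, 32, 100, 1⟩)
 (.lf ⟨6, 7, 15, 0, 0, 0, 0, 7, 0, 0, 0, 16228571, 0, 185802, 0, 0, 0, 0, 0⟩)))
 (.sa 2545
 (.sf 1820
 (.sg 1828
 (.lf ⟨8, 3, 15, 0, 0, 0, 0, 9, 0, 0, 0, 11783333, 9230913163, 0, 6, 8, 21, 372, 1⟩)
 (.lf ⟨9, 9, 15, 1, 0, 0, 0, 0, 10474074, 10474074, 0, 10474074, 46341698587, 0, 7, 7, 16, 448, 1⟩))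
 (.lf ⟨0, 0, 0, 0, 0, 0, 0, 0, 0, 0, 0, 0, 0, 0, 4, 7, 24, 111, 1⟩))
 (.sg 1828
 (.lf ⟨14, 10, 15, 0, 0, 0, 0, 11, 0, 0, 0, 7892857, 634006921, 0, 5, 8, 25, 61, 1⟩)
 (.lf ⟨11, 11, 15, 0, 0, 0, 0, 5, 8569697, 8569697, 0, 9132231, 43912698294, 0, 7, 7, 18, 81, 1⟩))))
 (.sf 1588
 (.lf ⟨10, 9, 15, 6, 0, 0, 0, 0, 10474074, 0, 0, 10474074, 0, 15052, 0, 0, 0, 0, 0⟩)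
 (.lf ⟨9, 7, 15, 10, 0, 0, 0, 0, 15123810, 10474074, 0, 15123809, 0, 76352, 0, 0, 0, 0, 0⟩)))
 (.se 1952
 .symF
 (.lf ⟨14, 10, 15, 12, 0, 0, 0, 0, 13293333, 6733333, 5914286, 6733333, 0, 28025, 0, 0, 0, 0, 0⟩))))
 (.sd 1382
 (.sg 1828
 (.se 1828
 (.sh 1621
 (.sf 1828
 (.sd 1105
 (.se 1621
 (.sf 1621
 (.sg 1621
 (.sg 1517
 (.sd 966
 (.se 1517
 (.sa 2778
 (.sf 1517
 (.sd 924
 (.sa 2696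
 (.se 1465
 (.sh 1517
 (.lf ⟨15, 15, 0, 0, 0, 0, 10, 8, 0, 0, 0, 0, 31775540206, 193631, 2, 2, 26, 23, 1⟩)
 .symH)
 (.lf ⟨0, 0, 0, 0, 0, 0, 0, 0, 0, 0, 0, 0, 0, 0, 4, 4, 23, 21, 1⟩))
 (.sh 1517
 (.se 1465
 (.sh 1465
 (.lf ⟨15, 15, 0, 0, 0, 0, 8, 8, 0, 0, 3680000, 3680000, 44206491500, 0, 2, 2, 32, 32, 1⟩)
 .symH)
 (.lf ⟨15, 15, 0, 0, 0, 0, 7, 10, 0, 0, 3680000, 3680000, 33934705717, 0, 2, 2, 26, 37, 1⟩))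
 .symH))
 (.lf ⟨15, 15, 0, 0, 0, 0, 10, 7, 0, 0, 4106667, 4106667, 36407309935, 0, 2, 2, 28, 21, 1⟩))
 .symF)
 (.lf ⟨15, 15, 0, 0, 0, 0, 8, 4, 43406250, 43406250, 12752137, 26166049, 47609923652, 1275333, 0, 0, 75, 20, 1⟩))
 (.sf 1517
 (.sh 1517
 (.sa 2745
 (.sd 897
 (.se 1569
 (.lf ⟨15, 15, 0, 0, 0, 0, 5, 11, 0, 0, 0, 1840000, 12742147538, 371825, 3, 3, 27, 47, 1⟩)
 (.lf ⟨15, 15, 0, 0, 0, 0, 2, 13, 0, 0, 0, 1840000, 12455220391, 424881, 3, 3, 25, 61, 1⟩))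
 (.lf ⟨15, 15, 0, 0, 0, 0, 5, 11, 0, 0, 0, 3986667, 30088881202, 0, 2, 2, 22, 36, 1⟩))
 (.lf ⟨15, 15, 0, 0, 0, 0, 3, 8, 0, 0, 3680000, 25504273, 58214867448, 0, 3, 3, 31, 37, 1⟩))
 (.lf ⟨15, 15, 0, 0, 0, 0, 6, 6, 0, 0, 3680000, 3680000, 0, 37148, 0, 0, 0, 0, 0⟩))
 (.lf ⟨15, 15, 0, 0, 0, 0, 8, 4, 0, 0, 3680000, 3680000, 30594321466, 0, 3, 3, 40, 31, 1⟩)))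
 (.se 1517
 (.sf 1517
 (.lf ⟨15, 15, 0, 0, 0, 0, 9, 7, 0, 0, 4293333, 4293333, 0, 184264, 0, 0, 0, 0, 0⟩)
 .symF)
 (.lf ⟨15, 15, 0, 0, 0, 0, 7, 7, 0, 0, 4293333, 4293333, 0, 109070, 0, 0, 0, 0, 0⟩)))
 (.sd 1021
 (.se 1517
 .symG
 (.sa 2745
 (.sd 924
 (.se 1548
 (.lf ⟨15, 15, 0, 0, 0, 0, 1, 14, 0, 0, 0, 1840000, 11845125546, 479355, 3, 2, 28, 74, 1⟩)
 (.lf ⟨14, 14, 2, 0, 0, 0, 0, 15, 0, 0, 0, 4224490, 25893929596, 0, 3, 3, 23, 104, 1⟩))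
 (.lf ⟨15, 15, 0, 0, 0, 0, 2, 11, 0, 0, 0, 2053333, 16562693679, 157076, 2, 2, 27, 45, 1⟩))
 (.lf ⟨15, 15, 0, 0, 0, 0, 2, 10, 0, 0, 0, 20215976, 41686465229, 113626, 1, 1, 26, 69, 1⟩)))
 (.lf ⟨15, 15, 0, 0, 0, 0, 6, 8, 0, 0, 4537778, 4537778, 0, 57491, 0, 0, 0, 0, 0⟩)))
 .symG)
 .symF)
 (.sf 1621
 (.sd 966
 (.sd 924
 (.sa 2745
 (.sf 1517
 (.sg 1621
 (.se 1724
 (.se 1672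
 (.sg 1517
 (.lf ⟨15, 15, 0, 0, 0, 0, 0, 13, 0, 0, 0, 1840000, 12974451197, 470116, 2, 3, 25, 87, 1⟩)
 (.lf ⟨15, 14, 6, 0, 0, 0, 0, 15, 0, 0, 0, 3942857, 27521952458, 0, 2, 3, 22, 124, 1⟩))
 (.sg 1517
 (.lf ⟨14, 13, 3, 0, 0, 0, 0, 15, 0, 0, 0, 4549451, 28627516425, 0, 3, 3, 22, 106, 1⟩)
 (.lf ⟨14, 14, 8, 0, 0, 0, 0, 15, 0, 0, 0, 6312500, 14507462050, 290512, 2, 2, 24, 137, 1⟩)))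
 (.sg 1517
 (.lf ⟨13, 12, 6, 0, 0, 0, 0, 15, 0, 0, 0, 7769888, 16594692769, 252206, 3, 3, 24, 150, 1⟩)
 (.lf ⟨15, 13, 10, 0, 0, 0, 0, 15, 0, 0, 0, 5438462, 13950192622, 560931, 3, 3, 22, 216, 1⟩)))
 (.lf ⟨12, 12, 9, 0, 0, 0, 0, 15, 0, 0, 0, 13092593, 39625052082, 0, 4, 4, 20, 132, 1⟩))
 (.sa 2703
 (.lf ⟨13, 13, 12, 0, 0, 0, 0, 15, 0, 0, 0, 9724359, 0, 0, 4, 4, 31, 112, 1⟩)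
 (.lf ⟨15, 15, 10, 0, 0, 0, 0, 13, 0, 0, 0, 10113333, 0, 0, 4, 4, 31, 96, 1⟩)))
 (.sg 1538
 (.sa 2787
 (.lf ⟨15, 15, 2, 0, 0, 0, 0, 10, 0, 0, 0, 18647732, 36796556660, 0, 3, 3, 27, 69, 1⟩)
 (.lf ⟨15, 15, 1, 0, 0, 0, 0, 8, 0, 0, 0, 30381115, 0, 197437, 0, 0, 0, 0, 0⟩))
 (.lf ⟨15, 15, 8, 0, 0, 0, 0, 11, 11783333, 0, 0, 18378160, 29102449414, 0, 3, 4, 24, 72, 1⟩)))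
 (.sg 1621
 (.se 1724
 (.lf ⟨15, 15, 0, 0, 0, 0, 1, 13, 0, 0, 0, 4106667, 30555569784, 0, 3, 3, 20, 101, 1⟩)
 (.lf ⟨15, 14, 4, 0, 0, 0, 0, 15, 0, 0, 0, 14466808, 31337498068, 8474, 3, 4, 22, 107, 1⟩))
 (.lf ⟨14, 14, 8, 0, 0, 0, 0, 15, 0, 0, 0, 12625000, 34238881162, 0, 4, 4, 21, 101, 1⟩)))
 (.sg 1621
 (.sg 1517
 (.se 1724
 (.lf ⟨15, 15, 0, 0, 0, 0, 4, 12, 0, 0, 0, 4293333, 40148623734, 0, 2, 3, 20, 32, 1⟩)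
 (.lf ⟨15, 15, 2, 0, 0, 0, 0, 10, 0, 0, 0, 4293333, 39833341280, 0, 2, 3, 20, 61, 1⟩))
 (.lf ⟨15, 15, 2, 0, 0, 0, 0, 14, 0, 0, 0, 4293333, 40386857705, 0, 2, 3, 18, 100, 1⟩))
 (.lf ⟨15, 15, 7, 0, 0, 0, 0, 15, 0, 0, 0, 13466667, 40047895753, 0, 4, 4, 19, 89, 1⟩)))
 (.sg 1621
 (.lf ⟨15, 15, 0, 0, 0, 0, 1, 1, 0, 0, 1840000, 1840000, 17212424470, 34884, 0, 1, 40, 40, 1⟩)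
 (.lf ⟨15, 15, 10, 0, 0, 0, 0, 5, 0, 0, 0, 3680000, 0, 0, 4, 5, 32, 76, 1⟩))))
 (.se 1621
 (.sf 1621
 (.sg 1621
 (.lf ⟨0, 0, 0, 0, 0, 0, 0, 0, 0, 0, 0, 0, 0, 0, 0, 0, 0, 0, 0⟩)
 .symG)
 .symF)
 (.sd 1243
 (.sa 2712
 (.sg 1621
 (.lf ⟨0, 0, 0, 0, 0, 0, 0, 0, 0, 0, 0, 0, 0, 0, 0, 0, 0, 0, 0⟩)
 (.lf ⟨15, 15, 10, 0, 0, 0, 0, 7, 0, 0, 0, 9426667, 0, 0, 5, 6, 24, 71, 1⟩))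
 (.sf 1621
 (.lf ⟨15, 15, 3, 0, 0, 0, 0, 9, 0, 0, 0, 25990291, 0, 271958, 0, 0, 0, 0, 0⟩)
 (.lf ⟨0, 0, 0, 0, 0, 0, 0, 0, 0, 0, 0, 0, 0, 0, 0, 0, 0, 0, 0⟩)))
 (.sd 1312
 (.lf ⟨15, 15, 2, 0, 0, 0, 0, 6, 0, 0, 0, 5524444, 0, 21743, 0, 0, 0, 0, 0⟩)
 (.lf ⟨15, 15, 1, 0, 0, 0, 0, 6, 0, 0, 0, 5831111, 0, 536163, 0, 0, 0, 0, 0⟩)))))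
 .symF)
 (.se 1621
 .symH
 (.sd 1105
 (.sf 1828
 (.sf 1621
 (.sg 1621
 (.lf ⟨15, 15, 0, 0, 0, 0, 5, 5, 0, 0, 0, 0, 26364644857, 0, 3, 3, 56, 56, 1⟩)
 (.lf ⟨15, 15, 10, 0, 0, 0, 0, 5, 0, 0, 0, 3680000, 0, 0, 5, 4, 32, 76, 1⟩))
 (.lf ⟨15, 15, 0, 8, 0, 0, 0, 0, 0, 0, 3680000, 0, 0, 151645, 3, 4, 152, 38, 1⟩))
 .symF)
 (.lf ⟨15, 14, 4, 11, 0, 0, 0, 0, 0, 8569697, 8569697, 0, 0, 37727, 0, 0, 0, 0, 0⟩))))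
 (.sd 1215
 (.se 2035
 (.se 1972
 (.sf 1730
 (.sg 1621
 (.sh 1621
 (.sd 1021
 (.lf ⟨15, 13, 10, 0, 0, 0, 0, 15, 0, 0, 0, 10876923, 32097811872, 0, 2, 3, 22, 157, 1⟩)
 (.lf ⟨15, 14, 6, 0, 0, 0, 0, 13, 0, 0, 0, 16833333, 50795763476, 0, 1, 1, 13, 53, 1⟩))
 (.lf ⟨15, 13, 9, 0, 0, 0, 0, 2, 0, 0, 0, 4246154, 0, 63692, 2, 3, 33, 96, 1⟩))
 (.lf ⟨15, 14, 13, 0, 0, 0, 0, 13, 0, 0, 0, 15173546, 45151253898, 0, 4, 5, 22, 76, 1⟩))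
 (.lf ⟨15, 12, 6, 10, 0, 0, 0, 0, 0, 9426667, 9426667, 0, 0, 0, 2, 5, 45, 448, 1⟩))
 (.sf 1828
 (.lf ⟨15, 12, 14, 0, 0, 0, 0, 12, 0, 0, 0, 17642141, 40496026128, 0, 4, 5, 23, 63, 1⟩)
 (.lf ⟨0, 0, 0, 0, 0, 0, 0, 0, 0, 0, 0, 0, 0, 0, 3, 6, 48, 58, 1⟩)))
 (.lf ⟨14, 11, 15, 0, 0, 0, 0, 8, 8569697, 0, 0, 27291801, 42604957281, 0, 4, 7, 29, 44, 1⟩))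
 (.lf ⟨15, 13, 10, 0, 0, 0, 0, 4, 0, 0, 0, 9426667, 0, 66481, 0, 0, 0, 0, 0⟩)))
 (.se 1828
 .symG
 (.lf ⟨13, 13, 15, 0, 0, 0, 0, 6, 7251282, 7251282, 0, 34646095, 0, 545774, 0, 0, 0, 0, 0⟩)))
 (.se 1828
 (.sf 1828
 (.sg 1828
 (.lf ⟨0, 0, 0, 0, 0, 0, 0, 0, 0, 0, 0, 0, 0, 0, 0, 0, 0, 0, 0⟩)
 .symG)
 .symF)
 (.lf ⟨14, 12, 15, 4, 0, 0, 0, 0, 7855556, 6733333, 8226190, 7855556, 0, 57452, 0, 0, 0, 0, 0⟩))))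
 (.lf ⟨13, 11, 15, 12, 0, 0, 0, 0, 0, 3625641, 4532051, 4284848, 0, 19127, 0, 0, 0, 0, 0⟩))
 (.sf 1662
 (.sd 1076
 (.se 1828
 .symH
 (.se 2035
 (.sh 1952
 (.lf ⟨10, 9, 15, 0, 0, 0, 0, 2, 10474074, 0, 0, 10474074, 0, 539, 0, 0, 0, 0, 0⟩)
 (.sg 1828
 (.lf ⟨5, 10, 0, 15, 0, 0, 2, 0, 0, 0, 12186667, 0, 0, 298548, 0, 0, 0, 0, 0⟩)
 (.lf ⟨11, 14, 15, 7, 0, 0, 0, 0, 6733333, 0, 5376623, 6733333, 0, 173651, 0, 0, 0, 0, 0⟩)))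
 (.sg 1828
 (.lf ⟨11, 6, 15, 0, 0, 0, 0, 1, 0, 0, 0, 12545455, 0, 186635, 0, 0, 0, 0, 0⟩)
 (.lf ⟨9, 7, 15, 0, 0, 0, 0, 4, 13466667, 13540741, 13142857, 13540741, 0, 1378737, 0, 0, 0, 0, 0⟩))))
 (.se 1828
 .symH
 (.lf ⟨10, 12, 15, 11, 0, 0, 0, 0, 7855556, 0, 8966667, 7855556, 0, 25611, 0, 0, 0, 0, 0⟩)))
 (.sd 1620
 (.se 1828
 .symH
 (.sg 1828
 (.lf ⟨6, 8, 0, 15, 0, 0, 2, 0, 0, 0, 15711111, 0, 0, 196318, 0, 0, 0, 0, 0⟩)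
 (.lf ⟨13, 14, 15, 13, 0, 0, 0, 0, 10043956, 10816568, 10043956, 7914286, 0, 107639, 0, 0, 0, 0, 0⟩)))
 (.lf ⟨9, 10, 12, 15, 0, 0, 0, 0, 13850000, 12638889, 10474074, 16925926, 0, 172772, 0, 0, 0, 0, 0⟩)))))
lemma tree_ok : chk theTree 2000 2829 828 1657 1414 2243 1414 2243 1414 2243 1414 2243 = true := by decide +kernel

end

section


lemma sub_cast1 (x y : ℕ) (h : 1 ≤ x - y) : ((x - y : ℕ) : ℝ) = (x : ℝ) - y := by
  rw [Nat.cast_sub (by omega)]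

lemma div_bound (B e : ℕ) (x : ℝ) (he : 1 ≤ e) (hx : (e : ℝ) = x) : (B : ℝ) / x ≤ ((B / e : ℕ) : ℝ) + 1 := by
  rw [← hx]; exact le_natdiv B e he

lemma corner2_sound (M T1 T2 T3 T4 ν μ z B1 B2 B3 B4 κ2 d1p d1n d2p d2n d3p d3n d4p d4n cp cn lp ln : ℕ)
    (κ : ℝ) (hκ : κ ^ 2 = κ2) (hκ0 : 0 ≤ κ)
    (hc : corner2 M T1 T2 T3 T4 ν μ z B1 B2 B3 B4 κ2 d1p d1n d2p d2n d3p d3n d4p d4n cp cn lp ln = true) :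
    GG μ 810460000000000 κ B1 B2 B3 B4
      (M * (d1p - d1n) + T1 * (lp - ln)) (M * (d2p - d2n) + T2 * (lp - ln))
      (M * (d3p - d3n) + T3 * (lp - ln)) (M * (d4p - d4n) + T4 * (lp - ln))
      (z * (cp - cn) + ν * (lp - ln)) (lp - ln) := by
  unfold corner2 at hc
  have hdiv : ∀ a b, Nat.div a b = a / b := fun _ _ => rfl
  simp only [Bool.and_eq_true, Nat.ble_eq, Nat.add_eq, Nat.mul_eq, Nat.sub_eq, hdiv] at hc
  obtain ⟨h1, h2, h3, h4, h5, h6, h7⟩ := hc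
  have key : ∀ T x y : ℕ, 1 ≤ (M * x + T * lp) - (M * y + T * ln) →
      (((M * x + T * lp) - (M * y + T * ln) : ℕ) : ℝ) = M * (x - y) + T * (lp - ln) := by
    intro T x y h
    rw [sub_cast1 _ _ h]; push_cast; ring
  have c1 := key _ _ _ h1
  have c2 := key _ _ _ h2
  have c3 := key _ _ _ h3
  have c4 := key _ _ _ h4
  have e1 := div_bound B1 _ _ h1 c1
  have e2 := div_bound B2 _ _ h2 c2
  have e3 := div_bound B3 _ _ h3 c3
  have e4 := div_bound B4 _ _ h4 c4
  set E1 := (M * d1p + T1 * lp) - (M * d1n + T1 * ln)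
  set E2 := (M * d2p + T2 * lp) - (M * d2n + T2 * ln)
  set E3 := (M * d3p + T3 * lp) - (M * d3n + T3 * ln)
  set E4 := (M * d4p + T4 * lp) - (M * d4n + T4 * ln)
  have hv : (((z * cp + ν * lp) - (z * cn + ν * ln) : ℕ) : ℝ) = z * (cp - cn) + ν * (lp - ln) := by
    rw [Nat.cast_sub h6]; push_cast; ring
  have hh : (((810460000000000 + μ * lp) - (μ * ln + (B1 / E1 + B2 / E2 + B3 / E3 + B4 / E4 + 4)) : ℕ) : ℝ)
      = 810460000000000 + μ * (lp - ln) - (((B1 / E1 : ℕ) + 1) + ((B2 / E2 : ℕ) + 1) + ((B3 / E3 : ℕ) + 1)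
        + ((B4 / E4 : ℕ) + 1)) := by
    rw [Nat.cast_sub h5]; push_cast; ring
  set hN := (810460000000000 + μ * lp) - (μ * ln + (B1 / E1 + B2 / E2 + B3 / E3 + B4 / E4 + 4))
  set vN := (z * cp + ν * lp) - (z * cn + ν * ln)
  have hle : (hN : ℝ) ≤ 810460000000000 + μ * (lp - ln) - (B1 / (M * (d1p - d1n) + T1 * (lp - ln)) +
    B2 / (M * (d2p - d2n) + T2 * (lp - ln)) + B3 / (M * (d3p - d3n) + T3 * (lp - ln)) +
    B4 / (M * (d4p - d4n) + T4 * (lp - ln))) := by rw [hh]; linarith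
  have hN0 : (0 : ℝ) ≤ hN := Nat.cast_nonneg _
  refine ⟨?_, ?_, ?_, ?_, ?_, hN0.trans hle, ?_⟩
  · rw [← c1]; exact_mod_cast h1
  · rw [← c2]; exact_mod_cast h2
  · rw [← c3]; exact_mod_cast h3
  · rw [← c4]; exact_mod_cast h4
  · rw [← hv]; exact Nat.cast_nonneg _
  · refine le_trans ?_ (mul_le_mul_of_nonneg_left hle (Real.sqrt_nonneg _))
    rw [← hv]
    have h8 : (κ2 : ℝ) ≤ vN * (hN * hN) := by exact_mod_cast h7
    rw [← hκ] at h8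
    have : κ ^ 2 ≤ (Real.sqrt vN * hN) ^ 2 := by
      rw [mul_pow, Real.sq_sqrt (Nat.cast_nonneg _)]; linarith [sq (hN : ℝ)]
    exact le_of_sq_le_sq this (by positivity)

def NP.toLP (p : NP) : LP where
  l0 := (p.p0 : ℝ) - p.n0
  l1 := (p.p1 : ℝ) - p.n1
  l2 := (p.p2 : ℝ) - p.n2
  l3 := (p.p3 : ℝ) - p.n3
  K := KK p.p0 p.p1 p.p2 p.p3 p.n0 p.n1 p.n2 p.n3
  T1 := p.T1
  T2 := p.T2
  T3 := p.T3
  T4 := p.T4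
  ν := p.ν
  μ := p.μ
  b1 := cBp p.k1
  b2 := cBp p.k2
  b3 := cBr p.k3
  b4 := cBr p.k4
  δ := 810460000000000
  κ := p.z * cκ p.k1 p.k2 p.k3 p.k4
  z := p.z
  pn := 2
  M := 1000000

lemma NP.nonneg (p : NP) : p.toLP.Nonneg := by
  constructor <;> simp [NP.toLP]

lemma pen1_cast (a : ℕ) : ((pen1 a : ℕ) : ℝ) = ((a : ℝ) - 1500) ^ 2 := by
  unfold pen1
  simp only [Nat.add_eq, Nat.mul_eq, Nat.sub_eq]
  rcases le_total a 1500 with h | h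
  · rw [Nat.sub_eq_zero_of_le h]; push_cast [Nat.cast_sub h]; ring
  · rw [Nat.sub_eq_zero_of_le h]; push_cast [Nat.cast_sub h]; ring

lemma corner1_sound (p : NP) (hz : p.z ≤ 1) (a d e f g h : ℕ)
    (hc : corner1 1000000 p.T1 p.T2 p.T3 p.T4 p.ν p.μ p.z
    (cBp (p.k1)) (cBp p.k2) (cBr p.k3) (cBr p.k4)
    (Nat.mul p.z (Nat.mul (cκ p.k1 p.k2 p.k3 p.k4) (cκ p.k1 p.k2 p.k3 p.k4)))
    (cap p.p0 p.n0 p.p1 p.n1) (cap p.p2 p.n2 p.p3 p.n3) (cap p.p0 p.n0 p.p2 p.n2)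
    (cap p.p0 p.n0 p.p3 p.n3) (cap p.p1 p.n1 p.p2 p.n2) (cap p.p1 p.n1 p.p3 p.n3)
    (can p.p0 p.n0 p.p1 p.n1) (can p.p2 p.n2 p.p3 p.n3) (can p.p0 p.n0 p.p2 p.n2)
    (can p.p0 p.n0 p.p3 p.n3) (can p.p1 p.n1 p.p2 p.n2) (can p.p1 p.n1 p.p3 p.n3)
    (KK p.p0 p.p1 p.p2 p.p3 p.n0 p.n1 p.n2 p.n3)
    a d e f g h (Nat.mul a a) (Nat.mul d d) (Nat.mul e e) (Nat.mul f f) (Nat.mul g g) (Nat.mul h h) = true) :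
    p.toLP.Good a d e f g h := by
  have hk : ((p.z : ℝ) * cκ p.k1 p.k2 p.k3 p.k4) ^ 2 =
      ((Nat.mul p.z (Nat.mul (cκ p.k1 p.k2 p.k3 p.k4) (cκ p.k1 p.k2 p.k3 p.k4)) : ℕ) : ℝ) := by
    simp only [Nat.mul_eq]
    push_cast
    have : p.z = 0 ∨ p.z = 1 := by omega
    rcases this with h | h <;> rw [h] <;> push_cast <;> ring
  have := corner2_sound _ _ _ _ _ _ _ _ _ _ _ _ _ _ _ _ _ _ _ _ _ _ _ _ _ _ hk (by positivity) hc
  unfold LP.Good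
  simp only [cap, can, DP, DN, Nat.add_eq, Nat.mul_eq, Nat.cast_add, Nat.cast_mul, pen1_cast,
    Nat.cast_ofNat] at this
  have hl : ((↑p.p0 * ↑p.p1 + ↑p.n0 * ↑p.n1) * (↑a * ↑a) + (↑p.p2 * ↑p.p3 + ↑p.n2 * ↑p.n3) * (↑d * ↑d) +
      (↑p.p0 * ↑p.p2 + ↑p.n0 * ↑p.n2) * (↑e * ↑e) + (↑p.p0 * ↑p.p3 + ↑p.n0 * ↑p.n3) * (↑f * ↑f) +
      (↑p.p1 * ↑p.p2 + ↑p.n1 * ↑p.n2) * (↑g * ↑g) + (↑p.p1 * ↑p.p3 + ↑p.n1 * ↑p.n3) * (↑h * ↑h) -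
      ((↑p.p0 * ↑p.n1 + ↑p.n0 * ↑p.p1) * (↑a * ↑a) + (↑p.p2 * ↑p.n3 + ↑p.n2 * ↑p.p3) * (↑d * ↑d) +
      (↑p.p0 * ↑p.n2 + ↑p.n0 * ↑p.p2) * (↑e * ↑e) + (↑p.p0 * ↑p.n3 + ↑p.n0 * ↑p.p3) * (↑f * ↑f) +
      (↑p.p1 * ↑p.n2 + ↑p.n1 * ↑p.p2) * (↑g * ↑g) + (↑p.p1 * ↑p.n3 + ↑p.n1 * ↑p.p3) * (↑h * ↑h) +
      ((KK p.p0 p.p1 p.p2 p.p3 p.n0 p.n1 p.n2 p.n3 : ℕ) : ℝ)) : ℝ) = p.toLP.L a d e f g h := by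
    unfold LP.L LL NP.toLP; ring
  rw [hl] at this
  convert this using 1
  · rfl
  · rfl
  · rfl
  · rfl
  · rfl
  · rfl
  · rfl
  · unfold LP.v1 Dv; simp only [NP.toLP]; ring
  · unfold LP.v2 Dv; simp only [NP.toLP]; ring
  · unfold LP.v3 Dv pen; simp only [NP.toLP]; ring
  · unfold LP.v4 Dv pen; simp only [NP.toLP]; ring
  · unfold LP.v5 CC; simp only [NP.toLP]; ring

lemma sqrt2_bounds : (1.4142135623730 : ℝ) < Real.sqrt 2 ∧ Real.sqrt 2 < 1.4142135623731 := by
  constructor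
  · apply Real.lt_sqrt_of_sq_lt; norm_num
  · rw [Real.sqrt_lt' (by norm_num)]; norm_num

lemma r3_bounds : 0 ≤ (Real.sqrt 2 - 1) ^ 3 ∧ (Real.sqrt 2 - 1) ^ 3 ≤ 0.0710678118655 := by
  have h := sqrt2_bounds
  have e : Real.sqrt 2 ^ 2 = 2 := Real.sq_sqrt (by norm_num)
  have e3 : (Real.sqrt 2 - 1) ^ 3 = 5 * Real.sqrt 2 - 7 := by
    have : (Real.sqrt 2 - 1) ^ 3 = Real.sqrt 2 * Real.sqrt 2 ^ 2 - 3 * Real.sqrt 2 ^ 2 + 3 * Real.sqrt 2 - 1 := by ring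
    rw [this, e]; ring
  rw [e3]
  constructor <;> linarith [h.1, h.2]

lemma lam_sound (p : NP) (hl : lamOK p.p0 p.p1 p.p2 p.p3 p.n0 p.n1 p.n2 p.n3 = true)
    (a d e f g h : ℝ) (hs : Supp a d e f g h) : p.toLP.L a d e f g h ≤ 0 := by
  unfold lamOK at hl
  simp only [Bool.and_eq_true, Nat.ble_eq, Nat.add_eq, Nat.mul_eq] at hl
  obtain ⟨h1, h2, h3⟩ := hl
  have hr := sqrt2_bounds
  have e2 : Real.sqrt 2 ^ 2 = 2 := Real.sq_sqrt (by norm_num)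
  have e4 : (Real.sqrt 2 - 1) ^ 2 = 3 - 2 * Real.sqrt 2 := by nlinarith
  have K : p.toLP.K = ((p.p0 + p.p1 + p.p2 + p.p3 : ℝ) - (p.n0 + p.n1 + p.n2 + p.n3)) *
      ((2000000 * (p.p0 + p.p1) + 686292 * (p.p2 + p.p3)) - (2000000 * (p.n0 + p.n1) + 686291 * (p.n2 + p.n3))) := by
    simp only [NP.toLP, KK, Nat.add_eq, Nat.mul_eq, Nat.sub_eq]
    rw [Nat.cast_mul, Nat.cast_sub h1, Nat.cast_sub h3]; push_cast; ring
  have h1' : ((p.n0 : ℝ) + p.n1 + p.n2 + p.n3) ≤ p.p0 + p.p1 + p.p2 + p.p3 := by exact_mod_cast h1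
  have h2' : (1000 * ((p.n0 : ℝ) + p.n1) + 415 * (p.n2 + p.n3)) ≤ 1000 * (p.p0 + p.p1) + 414 * (p.p2 + p.p3) := by
    exact_mod_cast h2
  have pp : (0 : ℝ) ≤ p.p2 + p.p3 := by positivity
  have nn : (0 : ℝ) ≤ p.n2 + p.n3 := by positivity
  have := hs (p.p0 - p.n0) (p.p1 - p.n1) (p.p2 - p.n2) (p.p3 - p.n3) (by linarith) (by nlinarith)
  have t : p.toLP.L a d e f g h = ((p.p0 : ℝ) - p.n0) * (p.p1 - p.n1) * a ^ 2 + (p.p2 - p.n2) * (p.p3 - p.n3) * d ^ 2 +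
      (p.p0 - p.n0) * (p.p2 - p.n2) * e ^ 2 + (p.p0 - p.n0) * (p.p3 - p.n3) * f ^ 2 +
      (p.p1 - p.n1) * (p.p2 - p.n2) * g ^ 2 + (p.p1 - p.n1) * (p.p3 - p.n3) * h ^ 2 - p.toLP.K := rfl
  rw [t, K]
  have Lam : 0 ≤ (p.p0 + p.p1 + p.p2 + p.p3 : ℝ) - (p.n0 + p.n1 + p.n2 + p.n3) := by linarith
  have fac : (2 * ((p.p0 : ℝ) - p.n0 + (p.p1 - p.n1)) + 4 * (Real.sqrt 2 - 1) ^ 2 * (p.p2 - p.n2 + (p.p3 - p.n3))) * 10 ^ 6 ≤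
      ((2000000 * (p.p0 + p.p1) + 686292 * (p.p2 + p.p3)) - (2000000 * (p.n0 + p.n1) + 686291 * (p.n2 + p.n3))) := by
    rw [e4]; nlinarith
  have := mul_le_mul_of_nonneg_left fac Lam
  linarith

lemma cBp_sound (k : ℕ) : 8 * 10 ^ 24 * 1000000 / (1 + ((k : ℝ) / 64) ^ 2) ≤ cBp k := by
  have := le_natdiv (8 * 10 ^ 30 * 4096) (4096 + k * k) (by positivity)
  have e : 8 * 10 ^ 24 * 1000000 / (1 + ((k : ℝ) / 64) ^ 2) = ((8 * 10 ^ 30 * 4096 : ℕ) : ℝ) / ((4096 + k * k : ℕ) : ℝ) := by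
    push_cast; field_simp; ring
  rw [e]
  have e2 : cBp k = (8 * 10 ^ 30 * 4096) / (4096 + k * k) + 1 := rfl
  rw [e2]; push_cast at this ⊢; exact this

lemma cBr_sound (k : ℕ) : 8 * 10 ^ 24 * (Real.sqrt 2 - 1) ^ 3 * 1000000 / (1 + ((k : ℝ) / 64) ^ 2) ≤ cBr k := by
  have := le_natdiv (8 * 710678118655 * 10 ^ 17 * 4096) (4096 + k * k) (by positivity)
  have e : 8 * 10 ^ 24 * 0.0710678118655 * 1000000 / (1 + ((k : ℝ) / 64) ^ 2) =
      ((8 * 710678118655 * 10 ^ 17 * 4096 : ℕ) : ℝ) / ((4096 + k * k : ℕ) : ℝ) := by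
    push_cast; field_simp; ring
  have e2 : cBr k = (8 * 710678118655 * 10 ^ 17 * 4096) / (4096 + k * k) + 1 := rfl
  calc _ ≤ 8 * 10 ^ 24 * 0.0710678118655 * 1000000 / (1 + ((k : ℝ) / 64) ^ 2) := by
        have := r3_bounds.2
        gcongr
    _ ≤ _ := by rw [e, e2]; push_cast at this ⊢; exact this

lemma cA_sound (k : ℕ) : 10 ^ 12 * (Real.arctan ((k : ℝ) / 64) - (k : ℝ) / 64 / (1 + ((k : ℝ) / 64) ^ 2)) ≤ cA k := by
  have h1 := atU_spec k
  have h2 := natdiv_le (64 * k * 10 ^ 12) (4096 + k * k)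
  have h3 := natsub_ge (atU k) (64 * k * 10 ^ 12 / (4096 + k * k))
  have e2 : cA k = atU k - (64 * k * 10 ^ 12) / (4096 + k * k) := rfl
  rw [e2]
  have e : 10 ^ 12 * ((k : ℝ) / 64 / (1 + ((k : ℝ) / 64) ^ 2)) = ((64 * k * 10 ^ 12 : ℕ) : ℝ) / ((4096 + k * k : ℕ) : ℝ) := by
    push_cast; field_simp; ring
  rw [mul_sub, e]; linarith

lemma cκ_sound (k1 k2 k3 k4 : ℕ) :
    8 * 10 ^ 24 * (Real.arctan ((k1 : ℝ) / 64) - (k1 : ℝ) / 64 / (1 + ((k1 : ℝ) / 64) ^ 2)) +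
    8 * 10 ^ 24 * (Real.arctan ((k2 : ℝ) / 64) - (k2 : ℝ) / 64 / (1 + ((k2 : ℝ) / 64) ^ 2)) +
    8 * 10 ^ 24 * (Real.sqrt 2 - 1) ^ 3 * (Real.arctan ((k3 : ℝ) / 64) - (k3 : ℝ) / 64 / (1 + ((k3 : ℝ) / 64) ^ 2)) +
    8 * 10 ^ 24 * (Real.sqrt 2 - 1) ^ 3 * (Real.arctan ((k4 : ℝ) / 64) - (k4 : ℝ) / 64 / (1 + ((k4 : ℝ) / 64) ^ 2)) ≤
    cκ k1 k2 k3 k4 := by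
  have h1 := cA_sound k1
  have h2 := cA_sound k2
  have h3 := cA_sound k3
  have h4 := cA_sound k4
  have hr := r3_bounds
  have e : (cκ k1 k2 k3 k4 : ℝ) = 8 * 10 ^ 12 * (cA k1 + cA k2) + 568542494925 * (cA k3 + cA k4) := by
    have : cκ k1 k2 k3 k4 = 8 * 10 ^ 12 * (cA k1 + cA k2) + (710678118655 * 8 / 10 + 1) * (cA k3 + cA k4) := rfl
    rw [this]; norm_num
  rw [e]
  have key : ∀ (x : ℝ) (c : ℕ), 10 ^ 12 * x ≤ c → 8 * 10 ^ 24 * (Real.sqrt 2 - 1) ^ 3 * x ≤ 568542494925 * c := by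
    intro x c hx
    have c0 : (0 : ℝ) ≤ c := Nat.cast_nonneg c
    calc 8 * 10 ^ 24 * (Real.sqrt 2 - 1) ^ 3 * x = 8 * 10 ^ 12 * (Real.sqrt 2 - 1) ^ 3 * (10 ^ 12 * x) := by ring
      _ ≤ 8 * 10 ^ 12 * (Real.sqrt 2 - 1) ^ 3 * c := by
          apply mul_le_mul_of_nonneg_left hx; exact mul_nonneg (by positivity) hr.1
      _ ≤ 568542494925 * c := by
          apply mul_le_mul_of_nonneg_right _ c0; linarith [hr.2]
  have h3' := key _ _ h3
  have h4' := key _ _ h4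
  linarith

lemma all2_sound {lo hi : ℕ} {f : ℕ → Bool} (h : all2 lo hi f = true) (x : ℝ) (hx : x = lo ∨ x = hi) :
    ∃ n : ℕ, x = n ∧ f n = true := by
  unfold all2 at h
  simp only [Bool.and_eq_true] at h
  rcases hx with hx | hx
  · exact ⟨lo, hx, h.1⟩
  · exact ⟨hi, hx, h.2⟩

/-- the weights -/
noncomputable def W1 : ℝ := 8 * 10 ^ 24
noncomputable def W3 : ℝ := 8 * 10 ^ 24 * (Real.sqrt 2 - 1) ^ 3

lemma leaf_sound (p : NP) (a0 a1 d0 d1 e0 e1 f0 f1 g0 g1 h0 h1 : ℕ)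
    (hl : leafOK p a0 a1 d0 d1 e0 e1 f0 f1 g0 g1 h0 h1 = true) (a d e f g h : ℝ)
    (ha0 : a0 ≤ a) (ha1 : a ≤ a1) (hd0 : d0 ≤ d) (hd1 : d ≤ d1) (he0 : e0 ≤ e) (he1 : e ≤ e1)
    (hf0 : f0 ≤ f) (hf1 : f ≤ f1) (hg0 : g0 ≤ g) (hg1 : g ≤ g1) (hh0 : h0 ≤ h) (hh1 : h ≤ h1)
    (hs : Supp a d e f g h) (hC : 0 ≤ CC a d e f g h) :
    Target 810460000000000 W1 W1 W3 W3 a d e f g h := by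
  unfold leafOK at hl
  rw [Bool.and_eq_true, Bool.and_eq_true, Bool.and_eq_true, Bool.and_eq_true] at hl
  obtain ⟨hr, hlam, hz, hk, hall⟩ := hl
  rw [Nat.ble_eq] at hz hk
  have hB : BoxOK p.toLP.pn a0 a1 d0 d1 e0 e1 f0 f1 g0 g1 h0 h1 := by
    unfold inRoot at hr
    simp only [Bool.and_eq_true, Nat.ble_eq] at hr
    obtain ⟨r1, r2, r3, r4, r5, r6, r7, r8, r9, r10, r11, r12⟩ := hr
    have pn : p.toLP.pn = 2 := rfl
    rw [pn]
    have R1 : (2000 : ℝ) ≤ a0 := by exact_mod_cast r1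
    have R2 : (a1 : ℝ) ≤ 2829 := by exact_mod_cast r2
    have R3 : (828 : ℝ) ≤ d0 := by exact_mod_cast r3
    have R4 : (d1 : ℝ) ≤ 1657 := by exact_mod_cast r4
    have R5 : (1414 : ℝ) ≤ e0 := by exact_mod_cast r5
    have R6 : (e1 : ℝ) ≤ 2243 := by exact_mod_cast r6
    have R7 : (1414 : ℝ) ≤ f0 := by exact_mod_cast r7
    have R8 : (f1 : ℝ) ≤ 2243 := by exact_mod_cast r8
    have R9 : (1414 : ℝ) ≤ g0 := by exact_mod_cast r9
    have R10 : (g1 : ℝ) ≤ 2243 := by exact_mod_cast r10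
    have R11 : (1414 : ℝ) ≤ h0 := by exact_mod_cast r11
    have R12 : (h1 : ℝ) ≤ 2243 := by exact_mod_cast r12
    have sq : ∀ x X u v U V : ℝ, 0 ≤ x → 0 ≤ U → 0 ≤ V → x ≤ X → U ≤ u → V ≤ v → X ^ 2 ≤ (U + V) ^ 2 + 3000 * 2 →
        x ^ 2 ≤ (u + v) ^ 2 + 3000 * 2 := by
      intro x X u v U V q1 q2 q3 q4 q5 q6 q7
      have : x ^ 2 ≤ X ^ 2 := by gcongr
      have : (U + V) ^ 2 ≤ (u + v) ^ 2 := by gcongr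
      linarith
    constructor
    all_goals first
      | positivity
      | linarith
      | exact sq _ 2243 _ _ 1414 828 (by positivity) (by norm_num) (by norm_num) (by assumption) (by assumption) (by assumption) (by norm_num)
      | exact sq _ 2829 _ _ 1414 1414 (by positivity) (by norm_num) (by norm_num) (by assumption) (by assumption) (by assumption) (by norm_num)
  have hgood : p.toLP.Good a d e f g h := by
    refine box_good p.toLP p.nonneg _ _ _ _ _ _ _ _ _ _ _ _ hB ?_ a ha0 ha1 d hd0 hd1 e he0 he1 f hf0 hf1 g hg0 hg1 h hh0 hh1
    intro a ha d hd e he f hf g hg h hh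
    obtain ⟨a, rfl, hall⟩ := all2_sound hall a ha
    obtain ⟨d, rfl, hall⟩ := all2_sound hall d hd
    obtain ⟨e, rfl, hall⟩ := all2_sound hall e he
    obtain ⟨f, rfl, hall⟩ := all2_sound hall f hf
    obtain ⟨g, rfl, hall⟩ := all2_sound hall g hg
    obtain ⟨h, rfl, hall⟩ := all2_sound hall h hh
    exact corner1_sound p hz a d e f g h hall
  have hL := lam_sound p hlam a d e f g h hs
  have r0 := r3_bounds.1
  refine target_of_good p.toLP p.nonneg a d e f g h (p.k1 / 64) (p.k2 / 64) (p.k3 / 64) (p.k4 / 64) W1 W1 W3 W3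
    hgood hL hC ?_ (by positivity) (by positivity) (by positivity) (by positivity) (by unfold W1; positivity)
    (by unfold W1; positivity) (by unfold W3; positivity) (by unfold W3; positivity)
    (cBp_sound _) (cBp_sound _) (cBr_sound _) (cBr_sound _) ?_
  · show (p.z : ℝ) ≤ 1
    exact_mod_cast hz
  · show _ ≤ (p.z : ℝ) * cκ p.k1 p.k2 p.k3 p.k4
    have : p.z = 0 ∨ p.z = 1 := by omega
    rcases this with h0 | h1
    · rw [h0] at hk
      simp only [Nat.add_eq, Nat.mul_eq] at hk
      have k1 : p.k1 = 0 := by omega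
      have k2 : p.k2 = 0 := by omega
      have k3 : p.k3 = 0 := by omega
      have k4 : p.k4 = 0 := by omega
      rw [h0, k1, k2, k3, k4]; simp
    · rw [h1, Nat.cast_one, one_mul]
      exact cκ_sound _ _ _ _

end

section


lemma GG_mono (δ δ' κ κ' b1 b1' b2 b2' b3 b3' b4 b4' d1 d1' d2 d2' d3 d3' d4 d4' C C' : ℝ)
    (h : GG 0 δ κ b1 b2 b3 b4 d1 d2 d3 d4 C 0) (hδ : δ ≤ δ') (hκ : κ' ≤ κ)
    (p1 : 0 ≤ b1') (p2 : 0 ≤ b2') (p3 : 0 ≤ b3') (p4 : 0 ≤ b4')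
    (q1 : b1' ≤ b1) (q2 : b2' ≤ b2) (q3 : b3' ≤ b3) (q4 : b4' ≤ b4)
    (r1 : d1 ≤ d1') (r2 : d2 ≤ d2') (r3 : d3 ≤ d3') (r4 : d4 ≤ d4') (hC : C ≤ C') :
    GG 0 δ' κ' b1' b2' b3' b4' d1' d2' d3' d4' C' 0 := by
  obtain ⟨h1, h2, h3, h4, h5, h6, h7⟩ := h
  have key : ∀ b b' d d' : ℝ, 0 < d → d ≤ d' → 0 ≤ b' → b' ≤ b → b' / d' ≤ b / d := by
    intro b b' d d' x1 x2 x3 x4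
    exact div_le_div₀ (x3.trans x4) x4 x1 x2
  have k1 := key _ _ _ _ h1 r1 p1 q1
  have k2 := key _ _ _ _ h2 r2 p2 q2
  have k3 := key _ _ _ _ h3 r3 p3 q3
  have k4 := key _ _ _ _ h4 r4 p4 q4
  have k5 : δ + 0 * 0 - (b1 / d1 + b2 / d2 + b3 / d3 + b4 / d4) ≤
    δ' + 0 * 0 - (b1' / d1' + b2' / d2' + b3' / d3' + b4' / d4') := by linarith
  refine ⟨h1.trans_le r1, h2.trans_le r2, h3.trans_le r3, h4.trans_le r4, h5.trans hC, h6.trans k5, ?_⟩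
  refine hκ.trans (h7.trans ?_)
  exact mul_le_mul (Real.sqrt_le_sqrt hC) k5 h6 (Real.sqrt_nonneg _)

lemma GG_scale (δ κ b1 b2 b3 b4 d1 d2 d3 d4 C k : ℝ) (hk : 0 < k)
    (h : GG 0 δ (κ * k) (b1 * k) (b2 * k) (b3 * k) (b4 * k) (d1 * k) (d2 * k) (d3 * k) (d4 * k) (C * k ^ 2) 0) :
    GG 0 δ κ b1 b2 b3 b4 d1 d2 d3 d4 C 0 := by
  obtain ⟨h1, h2, h3, h4, h5, h6, h7⟩ := h
  rw [mul_div_mul_right _ _ hk.ne', mul_div_mul_right _ _ hk.ne', mul_div_mul_right _ _ hk.ne',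
    mul_div_mul_right _ _ hk.ne'] at h6 h7
  rw [Real.sqrt_mul' _ (sq_nonneg k), Real.sqrt_sq hk.le] at h7
  refine ⟨pos_of_mul_pos_left h1 hk.le, pos_of_mul_pos_left h2 hk.le, pos_of_mul_pos_left h3 hk.le,
    pos_of_mul_pos_left h4 hk.le, nonneg_of_mul_nonneg_left h5 (by positivity), h6, ?_⟩
  apply le_of_mul_le_mul_right _ hk
  linarith

local notation:65 x:65 "+." y:66 => Nat.add x y
local notation:70 x:70 "*." y:71 => Nat.mul x y

def tB1 : ℕ := 7894 * 10 ^ 33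
def tB3 : ℕ := 428 * 10 ^ 33
def tK : ℕ := 1183 * 10 ^ 32

def corner3 (a d e f g h A D E F G H : ℕ) : Bool :=
  corner2 1 0 0 0 0 0 0 1 tB1 tB1 tB3 tB3 (tK *. tK)
    (DP a e f) (DN A E F (D *. D) (H *. H) (G *. G)) (DP a g h) (DN A G H (D *. D) (F *. F) (E *. E))
    (DP e g d) (DN E G D (H *. H) (F *. F) (A *. A))
    (DP f h d) (DN F H D (G *. G) (E *. E) (A *. A))
    ((a *. a) *. (d *. d) *. ((e *. e) +. (f *. f) +. (g *. g) +. (h *. h)) +.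
      (e *. e) *. (h *. h) *. ((a *. a) +. (d *. d) +. (f *. f) +. (g *. g)) +.
      (f *. f) *. (g *. g) *. ((a *. a) +. (d *. d) +. (e *. e) +. (h *. h)))
    ((A *. A) *. (D *. D) *. ((A *. A) +. (D *. D)) +. (E *. E) *. (H *. H) *. ((E *. E) +. (H *. H)) +.
      (F *. F) *. (G *. G) *. ((F *. F) +. (G *. G)) +. (A *. A) *. (E *. E) *. (G *. G) +.
      (A *. A) *. (F *. F) *. (H *. H) +.
      (D *. D) *. (E *. E) *. (F *. F) +. (D *. D) *. (G *. G) *. (H *. H)) 0 0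

def bl (b : Bool) (x y : ℕ) : ℕ := if b then y else x

def t0c (a d e f g h : Bool) : Bool :=
  corner3 (bl a 20000000 22750000) (bl d 8284271 16200000) (bl e 14142135 17300000) (bl f 14142135 17300000)
   (bl g 14142135 17300000) (bl h 14142135 17300000)
   (bl a 20000000 22750000) (bl d 8284272 16200000) (bl e 14142136 17300000) (bl f 14142136 17300000)
   (bl g 14142136 17300000) (bl h 14142136 17300000)

lemma t0c_ok : ∀ a d e f g h : Bool, (a || d || e || f || g || h) = true → t0c a d e f g h = true := by
  decide +kernel

lemma DP_le (a e f : ℕ) (a' e' f' : ℝ) (ha : (a : ℝ) ≤ a' * 10 ^ 4) (he : (e : ℝ) ≤ e' * 10 ^ 4) (hf : (f : ℝ) ≤ f' * 10 ^ 4) :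
    (DP a e f : ℝ) ≤ ((a' + e') * (e' + f') * (f' + a')) * 10 ^ 12 := by
  have : (DP a e f : ℝ) = ((a : ℝ) + e) * (e + f) * (f + a) := by
    simp only [DP, Nat.add_eq, Nat.mul_eq]; push_cast; ring
  rw [this]
  have e2 : ((a' + e') * (e' + f') * (f' + a')) * 10 ^ 12 =
    (a' * 10 ^ 4 + e' * 10 ^ 4) * (e' * 10 ^ 4 + f' * 10 ^ 4) * (f' * 10 ^ 4 + a' * 10 ^ 4) := by ring
  rw [e2]
  have ha0 : (0 : ℝ) ≤ a := Nat.cast_nonneg a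
  have he0 : (0 : ℝ) ≤ e := Nat.cast_nonneg e
  have hf0 : (0 : ℝ) ≤ f := Nat.cast_nonneg f
  apply mul_le_mul
  · apply mul_le_mul <;> linarith
  · linarith
  · positivity
  · exact mul_nonneg (by linarith) (by linarith)

lemma le_DN (a e f x y z : ℕ) (a' e' f' x' y' z' : ℝ) (ha0 : 0 ≤ a') (he0 : 0 ≤ e') (hf0 : 0 ≤ f')
    (hx0 : 0 ≤ x') (hy0 : 0 ≤ y') (hz0 : 0 ≤ z')
    (ha : a' * 10 ^ 4 ≤ a) (he : e' * 10 ^ 4 ≤ e) (hf : f' * 10 ^ 4 ≤ f)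
    (hx : x' * 10 ^ 4 ≤ x) (hy : y' * 10 ^ 4 ≤ y) (hz : z' * 10 ^ 4 ≤ z) :
    (a' * x' ^ 2 + e' * y' ^ 2 + f' * z' ^ 2) * 10 ^ 12 ≤ (DN a e f (x *. x) (y *. y) (z *. z) : ℝ) := by
  have : (DN a e f (x *. x) (y *. y) (z *. z) : ℝ) = (a : ℝ) * (x : ℝ) ^ 2 + e * (y : ℝ) ^ 2 + f * (z : ℝ) ^ 2 := by
    simp only [DN, Nat.add_eq, Nat.mul_eq]; push_cast; ring
  rw [this]
  have e2 : (a' * x' ^ 2 + e' * y' ^ 2 + f' * z' ^ 2) * 10 ^ 12 =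
    (a' * 10 ^ 4) * (x' * 10 ^ 4) ^ 2 + (e' * 10 ^ 4) * (y' * 10 ^ 4) ^ 2 + (f' * 10 ^ 4) * (z' * 10 ^ 4) ^ 2 := by ring
  rw [e2]
  gcongr

lemma corner3_sound (a d e f g h A D E F G H : ℕ) (hc : corner3 a d e f g h A D E F G H = true)
    (a' d' e' f' g' h' δ b1 b3 κ : ℝ) (pa : 0 ≤ a') (pd : 0 ≤ d') (pe : 0 ≤ e') (pf : 0 ≤ f') (pg : 0 ≤ g')
    (ph : 0 ≤ h')
    (la : (a : ℝ) ≤ a' * 10 ^ 4) (ld : (d : ℝ) ≤ d' * 10 ^ 4) (le : (e : ℝ) ≤ e' * 10 ^ 4)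
    (lf : (f : ℝ) ≤ f' * 10 ^ 4) (lg : (g : ℝ) ≤ g' * 10 ^ 4) (lh : (h : ℝ) ≤ h' * 10 ^ 4)
    (ua : a' * 10 ^ 4 ≤ A) (ud : d' * 10 ^ 4 ≤ D) (ue : e' * 10 ^ 4 ≤ E) (uf : f' * 10 ^ 4 ≤ F)
    (ug : g' * 10 ^ 4 ≤ G) (uh : h' * 10 ^ 4 ≤ H)
    (hδ : 810460000000000 ≤ δ) (b10 : 0 ≤ b1) (b30 : 0 ≤ b3)
    (hb1 : b1 * 10 ^ 12 ≤ tB1) (hb3 : b3 * 10 ^ 12 ≤ tB3) (hκ : κ * 10 ^ 12 ≤ tK) :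
    GG 0 δ κ b1 b1 b3 b3 (Dv a' e' f' d' h' g') (Dv a' g' h' d' f' e') (Dv e' g' d' h' f' a')
      (Dv f' h' d' g' e' a') (CC a' d' e' f' g' h') 0 := by
  have hG := corner2_sound _ _ _ _ _ _ _ _ _ _ _ _ _ _ _ _ _ _ _ _ _ _ _ _ _ (tK : ℝ)
    (by simp only [Nat.mul_eq]; push_cast; ring) (by positivity) hc
  apply GG_scale _ _ _ _ _ _ _ _ _ _ _ (10 ^ 12) (by norm_num)
  simp only [Nat.cast_zero, Nat.cast_one, zero_mul, add_zero, one_mul, sub_zero] at hG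
  refine GG_mono _ _ _ _ _ _ _ _ _ _ _ _ _ _ _ _ _ _ _ _ _ _ hG hδ hκ (by positivity) (by positivity)
    (by positivity) (by positivity) hb1 hb1 hb3 hb3 ?_ ?_ ?_ ?_ ?_
  · have t1 := DP_le a e f a' e' f' la le lf
    have t2 := le_DN A E F D H G a' e' f' d' h' g' pa pe pf pd ph pg ua ue uf ud uh ug
    unfold Dv; linarith
  · have t1 := DP_le a g h a' g' h' la lg lh
    have t2 := le_DN A G H D F E a' g' h' d' f' e' pa pg ph pd pf pe ua ug uh ud uf ue
    unfold Dv; linarith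
  · have t1 := DP_le e g d e' g' d' le lg ld
    have t2 := le_DN E G D H F A e' g' d' h' f' a' pe pg pd ph pf pa ue ug ud uh uf ua
    unfold Dv; linarith
  · have t1 := DP_le f h d f' h' d' lf lh ld
    have t2 := le_DN F H D G E A f' h' d' g' e' a' pf ph pd pg pe pa uf uh ud ug ue ua
    unfold Dv; linarith
  · simp only [Nat.add_eq, Nat.mul_eq, Nat.cast_add, Nat.cast_mul]
    have eC : CC a' d' e' f' g' h' * (10 ^ 12) ^ 2 = CC (a' * 10 ^ 4) (d' * 10 ^ 4) (e' * 10 ^ 4)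
      (f' * 10 ^ 4) (g' * 10 ^ 4) (h' * 10 ^ 4) := by unfold CC; ring
    rw [eC]
    have P : ∀ x : ℝ, 0 ≤ x → 0 ≤ x * 10 ^ 4 := fun x hx => by positivity
    have qa := P _ pa
    have qd := P _ pd
    have qe := P _ pe
    have qf := P _ pf
    have qg := P _ pg
    have qh := P _ ph
    generalize a' * 10 ^ 4 = a' at *
    generalize d' * 10 ^ 4 = d' at *
    generalize e' * 10 ^ 4 = e' at *
    generalize f' * 10 ^ 4 = f' at *
    generalize g' * 10 ^ 4 = g' at *
    generalize h' * 10 ^ 4 = h' at *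
    clear hG hc eC
    unfold CC
    simp only [pow_two]
    gcongr

/-- lower left corner of the special box -/
noncomputable def d00 : ℝ := 2000 * (Real.sqrt 2 - 1)
noncomputable def e00 : ℝ := 1000 * Real.sqrt 2
noncomputable def S0 : ℝ := Real.sqrt (CC 2000 d00 e00 e00 e00 e00)
noncomputable def DA0 : ℝ := Dv 2000 e00 e00 d00 e00 e00
noncomputable def DC0 : ℝ := Dv e00 e00 d00 e00 e00 2000
noncomputable def delOne : ℝ := (2 * (W1 * Real.arctan (S0 / DA0)) + 2 * (W3 * Real.arctan (S0 / DC0))) / S0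

lemma sqrt2_sq : Real.sqrt 2 ^ 2 = 2 := Real.sq_sqrt (by norm_num)

lemma DA0_eq : DA0 = 10 ^ 9 * (24 * Real.sqrt 2 - 8) := by
  have e := sqrt2_sq
  unfold DA0 Dv d00 e00
  linear_combination (0 : ℝ) * e

lemma DC0_eq : DC0 = 10 ^ 9 * (32 * Real.sqrt 2 - 40) := by
  have e := sqrt2_sq
  unfold DC0 Dv d00 e00
  linear_combination (16000000000 * Real.sqrt 2 - 24000000000) * e

lemma CC0_eq : CC 2000 d00 e00 e00 e00 e00 = 10 ^ 18 * (640 * Real.sqrt 2 - 896) := by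
  have e := sqrt2_sq
  have e3 : Real.sqrt 2 ^ 3 = 2 * Real.sqrt 2 := by rw [pow_succ, e]
  unfold CC d00 e00
  ring_nf
  rw [e3, e]
  ring

lemma S0_bounds : 3016070000 ≤ S0 ∧ S0 ≤ 3016071000 := by
  have h := sqrt2_bounds
  unfold S0
  rw [CC0_eq]
  constructor
  · apply Real.le_sqrt_of_sq_le; linarith [h.1]
  · rw [Real.sqrt_le_left (by norm_num)]; linarith [h.2]

lemma DA0_bounds : 25941125496 ≤ DA0 ∧ DA0 ≤ 25941125498 := by
  have h := sqrt2_bounds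
  rw [DA0_eq]; constructor <;> linarith [h.1, h.2]

lemma DC0_bounds : 5254833995 ≤ DC0 ∧ DC0 ≤ 5254833997 := by
  have h := sqrt2_bounds
  rw [DC0_eq]; constructor <;> linarith [h.1, h.2]

lemma qA_bounds : 0.1162659 ≤ S0 / DA0 ∧ S0 / DA0 ≤ 0.116267 := by
  have h := S0_bounds
  have k := DA0_bounds
  have : 0 < DA0 := by linarith [k.1]
  rw [le_div_iff₀ this, div_le_iff₀ this]
  constructor <;> linarith [h.1, h.2, k.1, k.2]

lemma qC_bounds : 0.573961 ≤ S0 / DC0 ∧ S0 / DC0 ≤ 0.573962 := by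
  have h := S0_bounds
  have k := DC0_bounds
  have : 0 < DC0 := by linarith [k.1]
  rw [le_div_iff₀ this, div_le_iff₀ this]
  constructor <;> linarith [h.1, h.2, k.1, k.2]

lemma arctan_low (k : ℕ) (y q : ℝ) (hy : 0 ≤ y) (h1 : (k : ℝ) / 64 * y < 1)
    (h : ((k : ℝ) / 64 + y) / (1 - (k : ℝ) / 64 * y) ≤ q) :
    (atL k : ℝ) / 10 ^ 12 + (y - 1 / 3 * y ^ 3) ≤ Real.arctan q := by
  have e := Real.arctan_add h1
  have t1 := arctan_lower y hy
  have t2 := atL_spec k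
  have t3 := Real.arctan_mono h
  rw [← e] at t3
  have : (atL k : ℝ) / 10 ^ 12 ≤ Real.arctan ((k : ℝ) / 64) := by
    rw [div_le_iff₀ (by norm_num)]; linarith
  linarith


end

section


lemma atA : 0.1157461 ≤ Real.arctan (S0 / DA0) := by
  have h := arctan_low 7 0.0068043 (S0 / DA0) (by norm_num) (by norm_num) (le_trans (by norm_num) qA_bounds.1)
  have : (atL 7 : ℝ) = 108941955704 := by
    exact_mod_cast (by decide +kernel : atL 7 = 108941955704)
  rw [this] at h
  refine le_trans ?_ h
  norm_num

lemma atC : 0.521052 ≤ Real.arctan (S0 / DC0) := by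
  have h := arctan_low 36 0.0086638 (S0 / DC0) (by norm_num) (by norm_num) (le_trans (by norm_num) qC_bounds.1)
  have : (atL 36 : ℝ) = 512389455801 := by
    exact_mod_cast (by decide +kernel : atL 36 = 512389455801)
  rw [this] at h
  refine le_trans ?_ h
  norm_num

lemma r3_lower : 0.071067811 ≤ (Real.sqrt 2 - 1) ^ 3 := by
  have h := sqrt2_bounds
  have e := sqrt2_sq
  have e3 : (Real.sqrt 2 - 1) ^ 3 = 5 * Real.sqrt 2 - 7 := by
    have : (Real.sqrt 2 - 1) ^ 3 = Real.sqrt 2 * Real.sqrt 2 ^ 2 - 3 * Real.sqrt 2 ^ 2 + 3 * Real.sqrt 2 - 1 := by ring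
    rw [this, e]; ring
  rw [e3]
  linarith [h.1, h.2]

lemma delOne_lower : 810460000000000 ≤ delOne := by
  have h := S0_bounds
  have h0 : 0 < S0 := by linarith [h.1]
  unfold delOne W1 W3
  rw [le_div_iff₀ h0]
  have a := atA
  have c := atC
  have r := r3_lower
  have : 0.071067811 * 0.521052 ≤ (Real.sqrt 2 - 1) ^ 3 * Real.arctan (S0 / DC0) :=
    mul_le_mul r c (by norm_num) (le_trans (by norm_num) r)
  have e : 2 * (8 * 10 ^ 24 * Real.arctan (S0 / DA0)) + 2 * (8 * 10 ^ 24 * (Real.sqrt 2 - 1) ^ 3 * Real.arctan (S0 / DC0))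
    = 16 * 10 ^ 24 * (Real.arctan (S0 / DA0) + (Real.sqrt 2 - 1) ^ 3 * Real.arctan (S0 / DC0)) := by ring
  rw [e]
  linarith [h.2]

noncomputable def t0LP : LP where
  l0 := 0
  l1 := 0
  l2 := 0
  l3 := 0
  K := 0
  T1 := 0
  T2 := 0
  T3 := 0
  T4 := 0
  ν := 0
  μ := 0
  b1 := W1 / (1 + (S0 / DA0) ^ 2)
  b2 := W1 / (1 + (S0 / DA0) ^ 2)
  b3 := W3 / (1 + (S0 / DC0) ^ 2)
  b4 := W3 / (1 + (S0 / DC0) ^ 2)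
  δ := delOne
  κ := 2 * (W1 * (Real.arctan (S0 / DA0) - S0 / DA0 / (1 + (S0 / DA0) ^ 2))) +
    2 * (W3 * (Real.arctan (S0 / DC0) - S0 / DC0 / (1 + (S0 / DC0) ^ 2)))
  z := 1
  pn := 0
  M := 1

lemma W1_nonneg : 0 ≤ W1 := by unfold W1; positivity
lemma W3_nonneg : 0 ≤ W3 := by unfold W3; have := r3_bounds.1; positivity

lemma t0LP_nonneg : t0LP.Nonneg := by
  have := W1_nonneg
  have := W3_nonneg
  constructor <;> simp only [t0LP] <;> positivity

lemma t0_b1 : W1 / (1 + (S0 / DA0) ^ 2) * 10 ^ 12 ≤ tB1 := by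
  have h := qA_bounds.1
  have h2 : (0.1162659 : ℝ) ^ 2 ≤ (S0 / DA0) ^ 2 := by gcongr
  rw [div_mul_eq_mul_div, div_le_iff₀ (by positivity)]
  unfold W1 tB1
  push_cast
  linarith

lemma t0_b3 : W3 / (1 + (S0 / DC0) ^ 2) * 10 ^ 12 ≤ tB3 := by
  have h := qC_bounds.1
  have h2 : (0.573961 : ℝ) ^ 2 ≤ (S0 / DC0) ^ 2 := by gcongr
  have r := r3_bounds.2
  rw [div_mul_eq_mul_div, div_le_iff₀ (by positivity)]
  unfold W3 tB3
  push_cast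
  linarith

lemma atan_up (q lo hi : ℝ) (k : ℕ) (x y : ℝ) (hlo : 0 ≤ lo) (h1 : lo ≤ q) (h2 : q ≤ hi) 
    (hx : (atU k : ℝ) / 10 ^ 12 + (hi - (k : ℝ) / 64) / (1 + ((k : ℝ) / 64) ^ 2) ≤ x) 
    (hy : y * (1 + hi ^ 2) ≤ lo) : Real.arctan q - q / (1 + q ^ 2) ≤ x - y := by
  have t := arctan_le_tangent q ((k : ℝ) / 64) (hlo.trans h1) (by positivity)
  have t2 := atU_spec k
  have t3 : Real.arctan ((k : ℝ) / 64) ≤ (atU k : ℝ) / 10 ^ 12 := by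
    rw [le_div_iff₀ (by norm_num)]; linarith
  have t4 : (q - (k : ℝ) / 64) / (1 + ((k : ℝ) / 64) ^ 2) ≤ (hi - (k : ℝ) / 64) / (1 + ((k : ℝ) / 64) ^ 2) := by gcongr
  have hq : 0 ≤ q := hlo.trans h1
  have t5 : y ≤ q / (1 + q ^ 2) := by
    rw [le_div_iff₀ (by positivity)]
    rcases le_total 0 y with hy0 | hy0
    · have : y * (1 + q ^ 2) ≤ y * (1 + hi ^ 2) := by gcongr
      linarith
    · have : y * (1 + q ^ 2) ≤ 0 := mul_nonpos_of_nonpos_of_nonneg hy0 (by positivity)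
      linarith
  linarith

lemma t0_κ : t0LP.κ * 10 ^ 12 ≤ tK := by
  have u7 : (atU 7 : ℝ) = 108941964515 := by exact_mod_cast (by decide +kernel : atU 7 = 108941964515)
  have u37 : (atU 37 : ℝ) = 524179660131 := by exact_mod_cast (by decide +kernel : atU 37 = 524179660131)
  have A := atan_up (S0 / DA0) _ _ 7 0.115754 0.114714 (by norm_num) qA_bounds.1 qA_bounds.2
    (by rw [u7]; norm_num) (by norm_num)
  have C := atan_up (S0 / DC0) _ _ 37 0.521061 0.431733 (by norm_num) qC_bounds.1 qC_bounds.2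
    (by rw [u37]; norm_num) (by norm_num)
  have w3 : W3 ≤ 8 * 10 ^ 24 * 0.0710678118655 := by
    unfold W3; have := r3_bounds.2; gcongr
  have C' : W3 * (Real.arctan (S0 / DC0) - S0 / DC0 / (1 + (S0 / DC0) ^ 2)) ≤ 8 * 10 ^ 24 * 0.0710678118655 * (0.521061 - 0.431733) :=
    (mul_le_mul_of_nonneg_left C W3_nonneg).trans (mul_le_mul_of_nonneg_right w3 (by norm_num))
  have A' := mul_le_mul_of_nonneg_left A W1_nonneg
  have eW : W1 = 8 * 10 ^ 24 := rfl
  have : t0LP.κ ≤ 2 * (W1 * (0.115754 - 0.114714)) + 2 * (8 * 10 ^ 24 * 0.0710678118655 * (0.521061 - 0.431733)) := by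
    simp only [t0LP]; linarith
  rw [eW] at this
  unfold tK; push_cast
  linarith

lemma t0_corner0 : t0LP.Good 2000 d00 e00 e00 e00 e00 := by
  have hS := S0_bounds.1
  have hA := DA0_bounds.1
  have hC := DC0_bounds.1
  have S0p : 0 < S0 := by linarith
  have DAp : 0 < DA0 := by linarith
  have DCp : 0 < DC0 := by linarith
  have v1 : t0LP.v1 2000 d00 e00 e00 e00 e00 = DA0 := by simp [LP.v1, t0LP, DA0]
  have v2 : t0LP.v2 2000 d00 e00 e00 e00 e00 = DA0 := by simp [LP.v2, t0LP, DA0]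
  have v3 : t0LP.v3 2000 d00 e00 e00 e00 e00 = DC0 := by simp [LP.v3, t0LP, DC0]
  have v4 : t0LP.v4 2000 d00 e00 e00 e00 e00 = DC0 := by simp [LP.v4, t0LP, DC0]
  have v5 : t0LP.v5 2000 d00 e00 e00 e00 e00 = CC 2000 d00 e00 e00 e00 e00 := by simp [LP.v5, t0LP]
  have key : S0 * (delOne + 0 * LP.L t0LP 2000 d00 e00 e00 e00 e00 - (W1 / (1 + (S0 / DA0) ^ 2) / DA0 + W1 / (1 + (S0 / DA0) ^ 2) / DA0 +
      W3 / (1 + (S0 / DC0) ^ 2) / DC0 + W3 / (1 + (S0 / DC0) ^ 2) / DC0)) = t0LP.κ := by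
    have e1 : S0 * delOne = 2 * (W1 * Real.arctan (S0 / DA0)) + 2 * (W3 * Real.arctan (S0 / DC0)) := by
      unfold delOne; field_simp
    rw [zero_mul, add_zero, mul_sub, e1]
    simp only [t0LP]
    ring
  have kpos : 0 ≤ t0LP.κ := by
    have f : ∀ q : ℝ, 0 ≤ q → 0 ≤ Real.arctan q - q / (1 + q ^ 2) := by
      intro q hq
      have := arctan_le_tangent 0 q le_rfl hq
      rw [Real.arctan_zero, zero_sub, neg_div] at this
      linarith
    have a := f (S0 / DA0) (by positivity)
    have c := f (S0 / DC0) (by positivity)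
    have := W1_nonneg
    have := W3_nonneg
    simp only [t0LP]; positivity
  unfold LP.Good
  rw [v1, v2, v3, v4, v5]
  refine ⟨DAp, DAp, DCp, DCp, ?_, ?_, ?_⟩
  · have := Real.sqrt_pos.1 S0p
    exact this.le
  · show 0 ≤ (delOne + 0 * LP.L t0LP 2000 d00 e00 e00 e00 e00 - (W1 / (1 + (S0 / DA0) ^ 2) / DA0 + W1 / (1 + (S0 / DA0) ^ 2) / DA0 +
      W3 / (1 + (S0 / DC0) ^ 2) / DC0 + W3 / (1 + (S0 / DC0) ^ 2) / DC0))
    rw [← key] at kpos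
    exact nonneg_of_mul_nonneg_right kpos S0p
  · exact key.symm.le

lemma bl_bounds (x lo : ℝ) (l u : ℕ) (hi : ℕ) (h1 : (l : ℝ) ≤ lo * 10 ^ 4) (h2 : lo * 10 ^ 4 ≤ u)
    (hx : x = lo ∨ x = hi) : ∃ b : Bool, ((bl b l (hi * 10 ^ 4) : ℕ) : ℝ) ≤ x * 10 ^ 4 ∧
      x * 10 ^ 4 ≤ ((bl b u (hi * 10 ^ 4) : ℕ) : ℝ) ∧ (b = false → x = lo) := by
  rcases hx with rfl | rfl
  · exact ⟨false, by simpa [bl] using h1, by simpa [bl] using h2, fun _ => rfl⟩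
  · exact ⟨true, by simp [bl]; norm_num, by simp [bl]; norm_num, by simp⟩

lemma t0_corner (a d e f g h : ℝ) (ha : a = 2000 ∨ a = (2275 : ℕ)) (hd : d = d00 ∨ d = (1620 : ℕ))
    (he : e = e00 ∨ e = (1730 : ℕ)) (hf : f = e00 ∨ f = (1730 : ℕ)) (hg : g = e00 ∨ g = (1730 : ℕ))
    (hh : h = e00 ∨ h = (1730 : ℕ)) : t0LP.Good a d e f g h := by
  have hs := sqrt2_bounds
  have d0 : 0 ≤ d00 := by unfold d00; linarith [hs.1]
  have e0 : 0 ≤ e00 := by unfold e00; positivity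
  have E : ∀ x : ℝ, x = e00 ∨ x = (1730 : ℕ) → 0 ≤ x := by
    rintro x (rfl | rfl)
    · exact e0
    · positivity
  have pa : 0 ≤ a := by rcases ha with rfl | rfl <;> positivity
  have pd : 0 ≤ d := by rcases hd with rfl | rfl <;> [exact d0; positivity]
  obtain ⟨ba, a1, a2, a3⟩ := bl_bounds a 2000 20000000 20000000 2275 (by norm_num) (by norm_num) ha
  obtain ⟨bd, d1, d2, d3⟩ := bl_bounds d d00 8284271 8284272 1620 (by unfold d00; push_cast; linarith [hs.1])
    (by unfold d00; push_cast; linarith [hs.2]) hd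
  have EE := fun x => bl_bounds x e00 14142135 14142136 1730 (by unfold e00; push_cast; linarith [hs.1])
    (by unfold e00; push_cast; linarith [hs.2])
  obtain ⟨be, e1, e2, e3⟩ := EE e he
  obtain ⟨bf, f1, f2, f3⟩ := EE f hf
  obtain ⟨bg, g1, g2, g3⟩ := EE g hg
  obtain ⟨bh, h1, h2, h3⟩ := EE h hh
  by_cases hb : (ba || bd || be || bf || bg || bh) = true
  · have := corner3_sound _ _ _ _ _ _ _ _ _ _ _ _ (t0c_ok ba bd be bf bg bh hb) a d e f g h delOne
      t0LP.b1 t0LP.b3 t0LP.κ pa pd (E _ he) (E _ hf) (E _ hg) (E _ hh) a1 d1 e1 f1 g1 h1 a2 d2 e2 f2 g2 h2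
      delOne_lower t0LP_nonneg.b1 t0LP_nonneg.b3 t0_b1 t0_b3 t0_κ
    unfold LP.Good
    have v1 : t0LP.v1 a d e f g h = Dv a e f d h g := by simp [LP.v1, t0LP]
    have v2 : t0LP.v2 a d e f g h = Dv a g h d f e := by simp [LP.v2, t0LP]
    have v3 : t0LP.v3 a d e f g h = Dv e g d h f a := by simp [LP.v3, t0LP]
    have v4 : t0LP.v4 a d e f g h = Dv f h d g e a := by simp [LP.v4, t0LP]
    have v5 : t0LP.v5 a d e f g h = CC a d e f g h := by simp [LP.v5, t0LP]
    have v6 : t0LP.L a d e f g h = 0 := by simp [LP.L, LL, t0LP]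
    rw [v1, v2, v3, v4, v5, v6]
    exact this
  · simp only [Bool.or_eq_true, not_or, Bool.not_eq_true] at hb
    obtain ⟨⟨⟨⟨⟨b1, b2⟩, b3⟩, b4⟩, b5⟩, b6⟩ := hb
    rw [a3 b1, d3 b2, e3 b3, f3 b4, g3 b5, h3 b6]
    exact t0_corner0

lemma t0_sound (a d e f g h : ℝ) (ha0 : 2000 ≤ a) (ha1 : a ≤ 2275) (hd0 : d00 ≤ d) (hd1 : d ≤ 1620)
    (he0 : e00 ≤ e) (he1 : e ≤ 1730) (hf0 : e00 ≤ f) (hf1 : f ≤ 1730) (hg0 : e00 ≤ g) (hg1 : g ≤ 1730)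
    (hh0 : e00 ≤ h) (hh1 : h ≤ 1730) (hC : 0 ≤ CC a d e f g h) : Target delOne W1 W1 W3 W3 a d e f g h := by
  have hs := sqrt2_bounds
  have dl : (828 : ℝ) ≤ d00 := by unfold d00; linarith [hs.1]
  have el : (1414 : ℝ) ≤ e00 := by unfold e00; linarith [hs.1]
  have hB : BoxOK t0LP.pn 2000 2275 d00 1620 e00 1730 e00 1730 e00 1730 e00 1730 := by
    have pn : t0LP.pn = 0 := rfl
    rw [pn]
    constructor
    all_goals first
      | linarith
      | nlinarith
  have hG := box_good t0LP t0LP_nonneg _ _ _ _ _ _ _ _ _ _ _ _ hB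
    (fun a ha d hd e he f hf g hg h hh => t0_corner a d e f g h (by exact_mod_cast ha) (by exact_mod_cast hd)
      (by exact_mod_cast he) (by exact_mod_cast hf) (by exact_mod_cast hg) (by exact_mod_cast hh))
    a ha0 ha1 d hd0 hd1 e he0 he1 f hf0 hf1 g hg0 hg1 h hh0 hh1
  have hL : t0LP.L a d e f g h ≤ 0 := by simp [LP.L, LL, t0LP]
  have qa : 0 ≤ S0 / DA0 := le_trans (by norm_num) qA_bounds.1
  have qc : 0 ≤ S0 / DC0 := le_trans (by norm_num) qC_bounds.1
  refine target_of_good t0LP t0LP_nonneg a d e f g h (S0 / DA0) (S0 / DA0) (S0 / DC0) (S0 / DC0) W1 W1 W3 W3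
    hG hL hC le_rfl qa qa qc qc W1_nonneg W1_nonneg W3_nonneg W3_nonneg ?_ ?_ ?_ ?_ ?_
  · simp [t0LP]
  · simp [t0LP]
  · simp [t0LP]
  · simp [t0LP]
  · simp only [t0LP]; linarith

lemma Target_mono {δ δ' w1 w2 w3 w4 a d e f g h : ℝ} (hδ : δ ≤ δ') (hT : Target δ w1 w2 w3 w4 a d e f g h) :
    Target δ' w1 w2 w3 w4 a d e f g h := by
  obtain ⟨h1, h2, h3, h4, h5⟩ := hT
  exact ⟨h1, h2, h3, h4, h5.trans (mul_le_mul_of_nonneg_left hδ (Real.sqrt_nonneg _))⟩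

lemma chk_sound (t : Tr) : ∀ a0 a1 d0 d1 e0 e1 f0 f1 g0 g1 h0 h1 : ℕ,
    chk t a0 a1 d0 d1 e0 e1 f0 f1 g0 g1 h0 h1 = true → ∀ a d e f g h : ℝ,
    a0 ≤ a → a ≤ a1 → d0 ≤ d → d ≤ d1 → e0 ≤ e → e ≤ e1 → f0 < f → f ≤ f1 → g0 < g → g ≤ g1 → h0 < h → h ≤ h1 →
    2000 ≤ a → d00 ≤ d → e00 ≤ e → e00 ≤ f → e00 ≤ g → e00 ≤ h → f ≤ e → g ≤ e → h ≤ e →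
    Supp a d e f g h → 0 ≤ CC a d e f g h → Target delOne W1 W1 W3 W3 a d e f g h := by
  induction t with
  | sa c l r hl hr =>
    intro a0 a1 d0 d1 e0 e1 f0 f1 g0 g1 h0 h1 hc a d e f g h ua va ud vd ue ve uf vf ug vg uh vh
    rw [chk, Bool.and_eq_true] at hc
    rcases le_or_gt a c with hx | hx
    · exact hl _ _ _ _ _ _ _ _ _ _ _ _ hc.1 a d e f g h ua hx ud vd ue ve uf vf ug vg uh vh
    · exact hr _ _ _ _ _ _ _ _ _ _ _ _ hc.2 a d e f g h hx.le va ud vd ue ve uf vf ug vg uh vh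
  | sd c l r hl hr =>
    intro a0 a1 d0 d1 e0 e1 f0 f1 g0 g1 h0 h1 hc a d e f g h ua va ud vd ue ve uf vf ug vg uh vh
    rw [chk, Bool.and_eq_true] at hc
    rcases le_or_gt d c with hx | hx
    · exact hl _ _ _ _ _ _ _ _ _ _ _ _ hc.1 a d e f g h ua va ud hx ue ve uf vf ug vg uh vh
    · exact hr _ _ _ _ _ _ _ _ _ _ _ _ hc.2 a d e f g h ua va hx.le vd ue ve uf vf ug vg uh vh
  | se c l r hl hr =>
    intro a0 a1 d0 d1 e0 e1 f0 f1 g0 g1 h0 h1 hc a d e f g h ua va ud vd ue ve uf vf ug vg uh vh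
    rw [chk, Bool.and_eq_true] at hc
    rcases le_or_gt e c with hx | hx
    · exact hl _ _ _ _ _ _ _ _ _ _ _ _ hc.1 a d e f g h ua va ud vd ue hx uf vf ug vg uh vh
    · exact hr _ _ _ _ _ _ _ _ _ _ _ _ hc.2 a d e f g h ua va ud vd hx.le ve uf vf ug vg uh vh
  | sf c l r hl hr =>
    intro a0 a1 d0 d1 e0 e1 f0 f1 g0 g1 h0 h1 hc a d e f g h ua va ud vd ue ve uf vf ug vg uh vh
    rw [chk, Bool.and_eq_true] at hc
    rcases le_or_gt f c with hx | hx
    · exact hl _ _ _ _ _ _ _ _ _ _ _ _ hc.1 a d e f g h ua va ud vd ue ve uf hx ug vg uh vh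
    · exact hr _ _ _ _ _ _ _ _ _ _ _ _ hc.2 a d e f g h ua va ud vd ue ve hx vf ug vg uh vh
  | sg c l r hl hr =>
    intro a0 a1 d0 d1 e0 e1 f0 f1 g0 g1 h0 h1 hc a d e f g h ua va ud vd ue ve uf vf ug vg uh vh
    rw [chk, Bool.and_eq_true] at hc
    rcases le_or_gt g c with hx | hx
    · exact hl _ _ _ _ _ _ _ _ _ _ _ _ hc.1 a d e f g h ua va ud vd ue ve uf vf ug hx uh vh
    · exact hr _ _ _ _ _ _ _ _ _ _ _ _ hc.2 a d e f g h ua va ud vd ue ve uf vf hx vg uh vh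
  | sh c l r hl hr =>
    intro a0 a1 d0 d1 e0 e1 f0 f1 g0 g1 h0 h1 hc a d e f g h ua va ud vd ue ve uf vf ug vg uh vh
    rw [chk, Bool.and_eq_true] at hc
    rcases le_or_gt h c with hx | hx
    · exact hl _ _ _ _ _ _ _ _ _ _ _ _ hc.1 a d e f g h ua va ud vd ue ve uf vf ug vg uh hx
    · exact hr _ _ _ _ _ _ _ _ _ _ _ _ hc.2 a d e f g h ua va ud vd ue ve uf vf ug vg hx vh
  | symF =>
    intro a0 a1 d0 d1 e0 e1 f0 f1 g0 g1 h0 h1 hc a d e f g h ua va ud vd ue ve uf vf ug vg uh vh _ _ _ _ _ _ w1 w2 w3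
    rw [chk, Nat.ble_eq] at hc
    have : (e1 : ℝ) ≤ f0 := by exact_mod_cast hc
    linarith
  | symG =>
    intro a0 a1 d0 d1 e0 e1 f0 f1 g0 g1 h0 h1 hc a d e f g h ua va ud vd ue ve uf vf ug vg uh vh _ _ _ _ _ _ w1 w2 w3
    rw [chk, Nat.ble_eq] at hc
    have : (e1 : ℝ) ≤ g0 := by exact_mod_cast hc
    linarith
  | symH =>
    intro a0 a1 d0 d1 e0 e1 f0 f1 g0 g1 h0 h1 hc a d e f g h ua va ud vd ue ve uf vf ug vg uh vh _ _ _ _ _ _ w1 w2 w3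
    rw [chk, Nat.ble_eq] at hc
    have : (e1 : ℝ) ≤ h0 := by exact_mod_cast hc
    linarith
  | t0 =>
    intro a0 a1 d0 d1 e0 e1 f0 f1 g0 g1 h0 h1 hc a d e f g h ua va ud vd ue ve uf vf ug vg uh vh
      ta td te tf tg th w1 w2 w3 hS hC
    rw [chk] at hc
    simp only [Bool.and_eq_true, Nat.ble_eq] at hc
    obtain ⟨c1, c2, c3, c4, c5, c6⟩ := hc
    have cc : ∀ (x : ℝ) (n m : ℕ), x ≤ n → n ≤ m → x ≤ m := fun x n m p q => p.trans (by exact_mod_cast q)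
    exact t0_sound a d e f g h ta (by exact_mod_cast cc _ _ _ va c1) td (by exact_mod_cast cc _ _ _ vd c2)
      te (by exact_mod_cast cc _ _ _ ve c3) tf (by exact_mod_cast cc _ _ _ vf c4)
      tg (by exact_mod_cast cc _ _ _ vg c5) th (by exact_mod_cast cc _ _ _ vh c6) hC
  | lf p =>
    intro a0 a1 d0 d1 e0 e1 f0 f1 g0 g1 h0 h1 hc a d e f g h ua va ud vd ue ve uf vf ug vg uh vh _ _ _ _ _ _ w1 w2 w3 hS hC
    rw [chk] at hc
    exact Target_mono delOne_lower (leaf_sound p _ _ _ _ _ _ _ _ _ _ _ _ hc a d e f g h ua va ud vd ue ve uf.le vf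
      ug.le vg uh.le vh hS hC)

/-- the target inequality, `e` being the longest of the mixed edges -/
lemma main_wlog (a d e f g h : ℝ) (ta : 2000 ≤ a) (td : d00 ≤ d) (te : e00 ≤ e) (tf : e00 ≤ f) (tg : e00 ≤ g)
    (th : e00 ≤ h) (ua : a ≤ 2829) (ud : d ≤ 1657) (ue : e ≤ 2243) (uf : f ≤ 2243) (ug : g ≤ 2243) (uh : h ≤ 2243)
    (w1 : f ≤ e) (w2 : g ≤ e) (w3 : h ≤ e) (hS : Supp a d e f g h) (hC : 0 ≤ CC a d e f g h) :
    Target delOne W1 W1 W3 W3 a d e f g h := by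
  have hs := sqrt2_bounds
  have dl : (828 : ℝ) ≤ d00 := by unfold d00; linarith [hs.1]
  have el : (1414 : ℝ) < e00 := by unfold e00; linarith [hs.1]
  exact chk_sound theTree _ _ _ _ _ _ _ _ _ _ _ _ tree_ok a d e f g h (by exact_mod_cast ta) (by exact_mod_cast ua)
    (by exact_mod_cast dl.trans td) (by exact_mod_cast ud)
    (by exact_mod_cast el.le.trans te) (by exact_mod_cast ue)
    (by exact_mod_cast el.trans_le tf) (by exact_mod_cast uf)
    (by exact_mod_cast el.trans_le tg) (by exact_mod_cast ug)
    (by exact_mod_cast el.trans_le th) (by exact_mod_cast uh) ta td te tf tg th w1 w2 w3 hS hC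

lemma Supp_swapAB {a d e f g h : ℝ} (hS : Supp a d e f g h) : Supp a d g h e f := by
  intro l0 l1 l2 l3 h1 h2
  have := hS l1 l0 l2 l3 (by linarith) (by linarith)
  linarith
lemma Supp_swapCD {a d e f g h : ℝ} (hS : Supp a d e f g h) : Supp a d f e h g := by
  intro l0 l1 l2 l3 h1 h2
  have := hS l0 l1 l3 l2 (by linarith) (by linarith)
  linarith
lemma CC_swapAB (a d e f g h : ℝ) : CC a d g h e f = CC a d e f g h := by unfold CC; ring
lemma CC_swapCD (a d e f g h : ℝ) : CC a d f e h g = CC a d e f g h := by unfold CC; ring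
lemma Dv_swap (a b c x y z : ℝ) : Dv a c b x z y = Dv a b c x y z := by unfold Dv; ring
lemma Dv_swap' (a b c x y z : ℝ) : Dv b a c y x z = Dv a b c x y z := by unfold Dv; ring

lemma Target_swapAB {δ a d e f g h : ℝ} (hT : Target δ W1 W1 W3 W3 a d g h e f) :
    Target δ W1 W1 W3 W3 a d e f g h := by
  unfold Target at *
  rw [CC_swapAB, Dv_swap' e g d h f a, Dv_swap' f h d g e a] at hT
  obtain ⟨h1, h2, h3, h4, h5⟩ := hT
  exact ⟨h2, h1, h3, h4, by linarith⟩

lemma Target_swapCD {δ a d e f g h : ℝ} (hT : Target δ W1 W1 W3 W3 a d f e h g) :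
    Target δ W1 W1 W3 W3 a d e f g h := by
  unfold Target at *
  rw [CC_swapCD, Dv_swap a e f d h g, Dv_swap a g h d f e] at hT
  obtain ⟨h1, h2, h3, h4, h5⟩ := hT
  exact ⟨h1, h2, h4, h3, by linarith⟩

lemma main_ineq (a d e f g h : ℝ) (ta : 2000 ≤ a) (td : d00 ≤ d) (te : e00 ≤ e) (tf : e00 ≤ f) (tg : e00 ≤ g)
    (th : e00 ≤ h) (ua : a ≤ 2829) (ud : d ≤ 1657) (ue : e ≤ 2243) (uf : f ≤ 2243) (ug : g ≤ 2243) (uh : h ≤ 2243)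
    (hS : Supp a d e f g h) (hC : 0 ≤ CC a d e f g h) :
    Target delOne W1 W1 W3 W3 a d e f g h := by
  have half : ∀ e f g h : ℝ, e00 ≤ e → e00 ≤ f → e00 ≤ g → e00 ≤ h → e ≤ 2243 → f ≤ 2243 → g ≤ 2243 → h ≤ 2243 →
      Supp a d e f g h → 0 ≤ CC a d e f g h → (g ≤ e ∨ g ≤ f) → (h ≤ e ∨ h ≤ f) → Target delOne W1 W1 W3 W3 a d e f g h := by
    intro e f g h te tf tg th ue uf ug uh hS hC w1 w2
    rcases le_total f e with w | w
    · exact main_wlog a d e f g h ta td te tf tg th ua ud ue uf ug uh w (by rcases w1 with w1 | w1 <;> linarith)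
        (by rcases w2 with w2 | w2 <;> linarith) hS hC
    · exact Target_swapCD (main_wlog a d f e h g ta td tf te th tg ua ud uf ue uh ug w
        (by rcases w2 with w2 | w2 <;> linarith) (by rcases w1 with w1 | w1 <;> linarith)
        (Supp_swapCD hS) (by rw [CC_swapCD]; exact hC))
  rcases le_total (max g h) (max e f) with w | w
  · apply half e f g h te tf tg th ue uf ug uh hS hC
    · exact le_max_iff.1 ((le_max_left _ _).trans w)
    · exact le_max_iff.1 ((le_max_right _ _).trans w)
  · apply Target_swapAB
    apply half g h e f tg th te tf ug uh ue uf (Supp_swapAB hS) (by rw [CC_swapAB]; exact hC)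
    · exact le_max_iff.1 ((le_max_left _ _).trans w)
    · exact le_max_iff.1 ((le_max_right _ _).trans w)

end

section



theorem mp_split3 : MeasurePreserving
    (fun x : EuclideanSpace ℝ (Fin 3) => ((x 0, (x 1, x 2)) : ℝ × (ℝ × ℝ))) := by
  have h1 := PiLp.volume_preserving_ofLp (Fin 3)
  have h2 := volume_preserving_piFinSuccAbove (fun _ : Fin 3 => ℝ) 0
  have h3 := volume_preserving_finTwoArrow ℝ
  have h4 := ((MeasurePreserving.id (volume : Measure ℝ)).prod h3)
  have := (h4.comp h2).comp h1
  exact this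

/-- Radial factor appearing in sectors of a ball. -/
noncomputable def radI (ρ : ℝ) : ENNReal :=
  ∫⁻ s in Set.Ioi (0:ℝ), ENNReal.ofReal s * volume {t : ℝ | t ^ 2 + s ^ 2 ≤ ρ ^ 2}

theorem vol_sector (ρ : ℝ) (P : Set (ℝ × ℝ)) (hP : MeasurableSet P) (Φ : Set ℝ)
    (hΦ : MeasurableSet Φ)
    (h : ∀ s φ : ℝ, 0 < s → -Real.pi < φ → φ < Real.pi →
      ((s * Real.cos φ, s * Real.sin φ) ∈ P ↔ φ ∈ Φ)) :
    volume {x : EuclideanSpace ℝ (Fin 3) | x 0 ^ 2 + (x 1 ^ 2 + x 2 ^ 2) ≤ ρ ^ 2 ∧ (x 1, x 2) ∈ P}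
      = radI ρ * volume (Φ ∩ Set.Ioo (-Real.pi) Real.pi) := by
  have hm0 : MeasurableSet {p : ℝ × (ℝ × ℝ) | p.1 ^ 2 + (p.2.1 ^ 2 + p.2.2 ^ 2) ≤ ρ ^ 2} := by
    apply measurableSet_le <;> fun_prop
  have hm : MeasurableSet {p : ℝ × (ℝ × ℝ) | p.1 ^ 2 + (p.2.1 ^ 2 + p.2.2 ^ 2) ≤ ρ ^ 2 ∧ p.2 ∈ P} :=
    hm0.inter (measurable_snd hP)
  have e1 := mp_split3.measure_preimage hm.nullMeasurableSet
  have e0 : {x : EuclideanSpace ℝ (Fin 3) | x 0 ^ 2 + (x 1 ^ 2 + x 2 ^ 2) ≤ ρ ^ 2 ∧ (x 1, x 2) ∈ P}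
     = (fun x : EuclideanSpace ℝ (Fin 3) => ((x 0, (x 1, x 2)) : ℝ × (ℝ × ℝ))) ⁻¹'
      {p : ℝ × (ℝ × ℝ) | p.1 ^ 2 + (p.2.1 ^ 2 + p.2.2 ^ 2) ≤ ρ ^ 2 ∧ p.2 ∈ P} := rfl
  rw [e0, e1, Measure.volume_eq_prod, Measure.prod_apply_symm hm, ← lintegral_comp_polarCoord_symm]
  have hg : Measurable fun s : ℝ => volume {t : ℝ | t ^ 2 + s ^ 2 ≤ ρ ^ 2} := by
    have : MeasurableSet {p : ℝ × ℝ | p.2 ^ 2 + p.1 ^ 2 ≤ ρ ^ 2} := by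
      apply measurableSet_le <;> fun_prop
    exact measurable_measure_prodMk_left this
  have ht : polarCoord.target = Set.Ioi (0:ℝ) ×ˢ Set.Ioo (-Real.pi) Real.pi := rfl
  have e2 : ∀ p ∈ polarCoord.target, ENNReal.ofReal p.1 •
      volume ((fun x : ℝ => (x, polarCoord.symm p)) ⁻¹'
        {p : ℝ × (ℝ × ℝ) | p.1 ^ 2 + (p.2.1 ^ 2 + p.2.2 ^ 2) ≤ ρ ^ 2 ∧ p.2 ∈ P})
      = (ENNReal.ofReal p.1 * volume {t : ℝ | t ^ 2 + p.1 ^ 2 ≤ ρ ^ 2}) * Φ.indicator 1 p.2 := by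
    rintro ⟨s, φ⟩ hp
    rw [ht] at hp
    obtain ⟨h1, h2, h3⟩ := hp
    simp only [Set.mem_Ioi] at h1 h2 h3
    have hh := h s φ h1 h2 h3
    have e3 : (s * Real.cos φ) ^ 2 + (s * Real.sin φ) ^ 2 = s ^ 2 := by
      have := Real.sin_sq_add_cos_sq φ
      linear_combination s ^ 2 * this
    simp only [polarCoord_symm_apply, Set.preimage_setOf_eq, hh, smul_eq_mul, e3]
    by_cases hc : φ ∈ Φ <;> simp [hc]
  rw [setLIntegral_congr_fun (polarCoord.open_target.measurableSet) e2, ht,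
    Measure.volume_eq_prod, ← Measure.prod_restrict]
  rw [lintegral_prod_mul (f := fun s => ENNReal.ofReal s * volume {t : ℝ | t ^ 2 + s ^ 2 ≤ ρ ^ 2})
    (g := Φ.indicator 1)]
  · rw [lintegral_indicator_one hΦ, Measure.restrict_apply hΦ, radI]
  · exact (Measurable.mul (by fun_prop) hg).aemeasurable
  · exact (measurable_one.indicator hΦ).aemeasurable

theorem ball_coord (ρ : ℝ) (hρ : 0 ≤ ρ) (x : EuclideanSpace ℝ (Fin 3)) :
    x ∈ closedBall 0 ρ ↔ x 0 ^ 2 + (x 1 ^ 2 + x 2 ^ 2) ≤ ρ ^ 2 := by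
  have := EuclideanSpace.real_norm_sq_eq x
  rw [Fin.sum_univ_three] at this
  rw [mem_closedBall_zero_iff, ← sq_le_sq₀ (norm_nonneg x) hρ, this, add_assoc]

theorem radI_eq (ρ : ℝ) (hρ : 0 ≤ ρ) : radI ρ = ENNReal.ofReal (2 / 3 * ρ ^ 3) := by
  have h := vol_sector ρ Set.univ MeasurableSet.univ Set.univ MeasurableSet.univ (by simp)
  have h2 : {x : EuclideanSpace ℝ (Fin 3) | x 0 ^ 2 + (x 1 ^ 2 + x 2 ^ 2) ≤ ρ ^ 2 ∧
      (x 1, x 2) ∈ (Set.univ : Set (ℝ × ℝ))} = closedBall 0 ρ := by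
    ext x; rw [ball_coord ρ hρ x]; simp
  rw [h2, EuclideanSpace.volume_closedBall_fin_three, Set.univ_inter, Real.volume_Ioo,
    ← ENNReal.ofReal_pow hρ, ← ENNReal.ofReal_mul (by positivity)] at h
  have hp := Real.pi_pos
  have h3 : ENNReal.ofReal (ρ ^ 3 * (Real.pi * 4 / 3)) =
      ENNReal.ofReal (2 / 3 * ρ ^ 3) * ENNReal.ofReal (Real.pi - -Real.pi) := by
    rw [← ENNReal.ofReal_mul (by positivity)]; congr 1; ring
  rw [h3] at h
  exact ((ENNReal.mul_left_inj (by simp; linarith) (by simp)).1 h).symm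

theorem vol_wedge (ρ θ : ℝ) (hρ : 0 ≤ ρ) (h0 : 0 < θ) (h1 : θ < Real.pi) :
    volume {x : EuclideanSpace ℝ (Fin 3) | x ∈ closedBall 0 ρ ∧ 0 ≤ x 2 ∧
      0 ≤ Real.sin θ * x 1 - Real.cos θ * x 2} = ENNReal.ofReal (2 / 3 * ρ ^ 3 * θ) := by
  have hP : MeasurableSet {p : ℝ × ℝ | 0 ≤ p.2 ∧ 0 ≤ Real.sin θ * p.1 - Real.cos θ * p.2} := by
    exact (measurableSet_le (f := fun _ : ℝ × ℝ => (0:ℝ)) (by fun_prop) (by fun_prop)).inter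
      (measurableSet_le (f := fun _ : ℝ × ℝ => (0:ℝ)) (by fun_prop) (by fun_prop))
  have := vol_sector ρ _ hP (Set.Icc 0 θ) measurableSet_Icc (by
    intro s φ hs hφ1 hφ2
    have e : Real.sin θ * (s * Real.cos φ) - Real.cos θ * (s * Real.sin φ) =
      s * Real.sin (θ - φ) := by rw [Real.sin_sub]; ring
    simp only [Set.mem_setOf_eq, e, Set.mem_Icc, mul_nonneg_iff_of_pos_left hs]
    constructor
    · rintro ⟨a, b⟩
      have a1 : 0 ≤ φ := by
        by_contra hc
        exact absurd (Real.sin_neg_of_neg_of_neg_pi_lt (by linarith) hφ1) (by linarith)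
      refine ⟨a1, ?_⟩
      by_contra hc
      exact absurd (Real.sin_neg_of_neg_of_neg_pi_lt (x := θ - φ) (by linarith) (by linarith)) (by linarith)
    · rintro ⟨a, b⟩
      exact ⟨Real.sin_nonneg_of_nonneg_of_le_pi a hφ2.le,
        Real.sin_nonneg_of_nonneg_of_le_pi (by linarith) (by linarith)⟩)
  have e1 : Set.Icc 0 θ ∩ Set.Ioo (-Real.pi) Real.pi = Set.Icc 0 θ := by
    apply Set.inter_eq_left.2; intro φ hφ; exact ⟨by linarith [hφ.1, Real.pi_pos], by linarith [hφ.2]⟩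
  rw [e1, Real.volume_Icc, sub_zero, radI_eq ρ hρ, ← ENNReal.ofReal_mul (by positivity)] at this
  rw [← this]
  congr 1; ext x
  simp only [Set.mem_setOf_eq, ball_coord ρ hρ]

end

section



/-- Three vectors with their dual functionals. -/
structure Fr (a b c : EuclideanSpace ℝ (Fin 3)) (f g h : EuclideanSpace ℝ (Fin 3) →ₗ[ℝ] ℝ) :
    Prop where
  sp : ∀ x, x = f x • a + g x • b + h x • c
  fa : f a = 1
  fb : f b = 0
  fc : f c = 0
  ga : g a = 0
  gb : g b = 1
  gc : g c = 0
  ha : h a = 0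
  hb : h b = 0
  hc : h c = 1

variable {a b c : EuclideanSpace ℝ (Fin 3)} {f g h : EuclideanSpace ℝ (Fin 3) →ₗ[ℝ] ℝ}

theorem Fr.rot (F : Fr a b c f g h) : Fr b c a g h f :=
  ⟨fun x => by conv_lhs => rw [F.sp x]
               abel, F.gb, F.gc, F.ga, F.hb, F.hc, F.ha, F.fb, F.fc, F.fa⟩

theorem Fr.swap (F : Fr a b c f g h) : Fr b a c g f h :=
  ⟨fun x => by conv_lhs => rw [F.sp x]
               abel, F.gb, F.ga, F.gc, F.fb, F.fa, F.fc, F.hb, F.ha, F.hc⟩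

/-- change of origin -/
theorem Fr.reroot (F : Fr a b c f g h) : Fr (-a) (b - a) (c - a) (-(f + g + h)) g h := by
  refine ⟨fun x => ?_, ?_, ?_, ?_, ?_, ?_, ?_, ?_, ?_, ?_⟩
  · conv_lhs => rw [F.sp x]
    simp only [LinearMap.neg_apply, LinearMap.add_apply]
    module
  all_goals simp [F.fa, F.fb, F.fc, F.ga, F.gb, F.gc, F.ha, F.hb, F.hc]

theorem Fr.li (F : Fr a b c f g h) : LinearIndependent ℝ ![c, a, b] := by
  rw [Fintype.linearIndependent_iff]
  intro k hk
  simp only [Fin.sum_univ_three, Matrix.cons_val_zero, Matrix.cons_val_one, Matrix.cons_val] at hk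
  have h1 := congrArg f hk
  have h2 := congrArg g hk
  have h3 := congrArg h hk
  simp [F.fa, F.fb, F.fc, F.ga, F.gb, F.gc, F.ha, F.hb, F.hc] at h1 h2 h3
  intro i; fin_cases i <;> simp [h1, h2, h3]

open InnerProductSpace in
theorem tri (F : Fr a b c f g h) : ∃ φ : EuclideanSpace ℝ (Fin 3) ≃ₗᵢ[ℝ] EuclideanSpace ℝ (Fin 3),
    φ c 1 = 0 ∧ φ c 2 = 0 ∧ φ a 2 = 0 ∧ 0 < φ c 0 ∧ 0 < φ a 1 ∧ 0 < φ b 2 := by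
  have li := F.li
  have hr : Module.finrank ℝ (EuclideanSpace ℝ (Fin 3)) = Fintype.card (Fin 3) := by simp
  have hpos : ∀ i, 0 < (gramSchmidtOrthonormalBasis hr ![c, a, b]).repr (![c, a, b] i) i := by
    intro i
    have h0 := gramSchmidt_ne_zero (𝕜 := ℝ) i li
    have hn : gramSchmidtNormed ℝ ![c, a, b] i ≠ 0 := by
      intro h; have := gramSchmidtNormed_unit_length (𝕜 := ℝ) i li
      rw [h] at this; simp at this
    rw [OrthonormalBasis.repr_apply_apply, gramSchmidtOrthonormalBasis_apply hr hn,
      gramSchmidtNormed, inner_smul_left]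
    have e : inner ℝ (gramSchmidt ℝ ![c, a, b] i) (![c, a, b] i) =
      ‖gramSchmidt ℝ ![c, a, b] i‖ ^ 2 := by
      conv_lhs => rw [gramSchmidt_def'' ℝ ![c,a,b] i]
      rw [inner_add_right, inner_sum, Finset.sum_eq_zero, add_zero, real_inner_self_eq_norm_sq]
      intro j hj
      rw [inner_smul_right, gramSchmidt_orthogonal ℝ _ (ne_of_gt (Finset.mem_Iio.1 hj)), mul_zero]
    rw [e]
    have : 0 < ‖gramSchmidt ℝ ![c, a, b] i‖ := norm_pos_iff.2 h0
    simp; positivity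
  refine ⟨(gramSchmidtOrthonormalBasis hr ![c, a, b]).repr, ?_, ?_, ?_, hpos 0, hpos 1, hpos 2⟩
  · exact gramSchmidtOrthonormalBasis_inv_triangular' hr ![c, a, b] (i := 0) (j := 1) (by decide)
  · exact gramSchmidtOrthonormalBasis_inv_triangular' hr ![c, a, b] (i := 0) (j := 2) (by decide)
  · exact gramSchmidtOrthonormalBasis_inv_triangular' hr ![c, a, b] (i := 1) (j := 2) (by decide)

/-- Gram determinant -/
noncomputable def gr (a b c : EuclideanSpace ℝ (Fin 3)) : ℝ :=
  ‖a‖ ^ 2 * ‖b‖ ^ 2 * ‖c‖ ^ 2 + 2 * inner ℝ b c * inner ℝ c a * inner ℝ a b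
   - ‖a‖ ^ 2 * inner ℝ b c ^ 2 - ‖b‖ ^ 2 * inner ℝ c a ^ 2 - ‖c‖ ^ 2 * inner ℝ a b ^ 2

theorem inner_coord (x y : EuclideanSpace ℝ (Fin 3)) :
    inner ℝ x y = x 0 * y 0 + x 1 * y 1 + x 2 * y 2 := by
  rw [PiLp.inner_apply, Fin.sum_univ_three]; simp; ring

theorem normsq_coord (x : EuclideanSpace ℝ (Fin 3)) :
    ‖x‖ ^ 2 = x 0 * x 0 + x 1 * x 1 + x 2 * x 2 := by
  rw [← inner_coord, real_inner_self_eq_norm_sq]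

theorem vol_dihedral (F : Fr a b c f g h) (ρ : ℝ) (hρ : 0 ≤ ρ) :
    0 < gr a b c ∧ 
    volume {x : EuclideanSpace ℝ (Fin 3) | x ∈ closedBall 0 ρ ∧ 0 ≤ f x ∧ 0 ≤ g x} =
      ENNReal.ofReal (2 / 3 * ρ ^ 3 * Complex.arg
        ⟨‖c‖ ^ 2 * inner ℝ a b - inner ℝ b c * inner ℝ c a, ‖c‖ * √(gr a b c)⟩) := by
  obtain ⟨φ, c1, c2, a2, c0, a1, b2⟩ := tri F
  have hgr : gr a b c = (φ c 0 * φ a 1 * φ b 2) ^ 2 := by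
    unfold gr
    rw [← φ.norm_map a, ← φ.norm_map b, ← φ.norm_map c, ← φ.inner_map_map a b,
      ← φ.inner_map_map b c, ← φ.inner_map_map c a]
    simp only [normsq_coord, inner_coord, c1, c2, a2]
    ring
  have hs : √(gr a b c) = φ c 0 * φ a 1 * φ b 2 := by
    rw [hgr, Real.sqrt_sq (by positivity)]
  have hc : ‖c‖ = φ c 0 := by
    rw [← φ.norm_map c, ← abs_of_pos c0, ← sq_eq_sq₀ (by positivity) (by positivity), normsq_coord,
      c1, c2, sq_abs]; ring
  refine ⟨by rw [hgr]; positivity, ?_⟩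
  have hz : (⟨‖c‖ ^ 2 * inner ℝ a b - inner ℝ b c * inner ℝ c a, ‖c‖ * √(gr a b c)⟩ : ℂ) =
     ((φ c 0 ^ 2 * φ a 1 : ℝ) : ℂ) * ⟨φ b 1, φ b 2⟩ := by
    rw [hs, hc, ← φ.inner_map_map a b,
      ← φ.inner_map_map b c, ← φ.inner_map_map c a]
    simp only [inner_coord, c1, c2, a2]
    apply Complex.ext
    · rw [Complex.re_ofReal_mul]; ring
    · rw [Complex.im_ofReal_mul]; ring
  rw [hz, Complex.arg_real_mul _ (by positivity)]
  set w : ℂ := ⟨φ b 1, φ b 2⟩ with hw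
  have w0 : w ≠ 0 := by
    intro h; have := congrArg Complex.im h; simp [hw] at this; linarith
  have t0 : 0 < Complex.arg w := by
    rcases (Complex.arg_nonneg_iff (z := w)).2 b2.le |>.lt_or_eq with h | h
    · exact h
    · have := (Complex.arg_eq_zero_iff (z := w)).1 h.symm
      simp [hw] at this; linarith
  have t1 : Complex.arg w < Real.pi := by
    rw [Complex.arg_lt_pi_iff]; right; exact b2.ne'
  rw [← vol_wedge ρ _ hρ t0 t1]
  have hn : 0 < ‖w‖ := norm_pos_iff.2 w0
  have hcos := Complex.cos_arg w0
  have hsin := Complex.sin_arg w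
  rw [hcos, hsin]
  have mp := φ.measurePreserving
  have key : {x : EuclideanSpace ℝ (Fin 3) | x ∈ closedBall 0 ρ ∧ 0 ≤ f x ∧ 0 ≤ g x} = φ ⁻¹' 
    {x : EuclideanSpace ℝ (Fin 3) | x ∈ closedBall 0 ρ ∧ 0 ≤ x 2 ∧
      0 ≤ w.im / ‖w‖ * x 1 - w.re / ‖w‖ * x 2} := by
    ext x
    have hx : φ x = f x • φ a + g x • φ b + h x • φ c := by
      conv_lhs => rw [F.sp x]
      simp
    have x1 : φ x 1 = f x * φ a 1 + g x * φ b 1 := by rw [hx]; simp [c1]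
    have x2 : φ x 2 = g x * φ b 2 := by rw [hx]; simp [c2, a2]
    simp only [Set.mem_setOf_eq, Set.mem_preimage, mem_closedBall_zero_iff, φ.norm_map]
    have e1 : w.im / ‖w‖ * φ x 1 - w.re / ‖w‖ * φ x 2 = (φ b 2 * φ a 1 / ‖w‖) * f x := by
      rw [x1, x2]; simp only [hw]; ring
    have k : 0 < φ b 2 * φ a 1 / ‖w‖ := by positivity
    rw [e1, x2, mul_nonneg_iff_of_pos_left k, mul_nonneg_iff_of_pos_right b2]
    tauto
  rw [key, mp.measure_preimage_emb φ.toHomeomorph.measurableEmbedding]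

end

section



theorem split_real (S : Set (EuclideanSpace ℝ (Fin 3))) (hS : volume S ≠ ⊤)
    (l : EuclideanSpace ℝ (Fin 3) →ₗ[ℝ] ℝ) (y : EuclideanSpace ℝ (Fin 3)) (hy : l y ≠ 0) :
    (volume S).toReal = (volume (S ∩ {x | 0 ≤ l x})).toReal + (volume (S ∩ {x | l x ≤ 0})).toReal := by
  have hl : Continuous l := l.continuous_of_finiteDimensional
  have hm : MeasurableSet {x | 0 ≤ l x} := measurableSet_le measurable_const hl.measurable
  have h0 : volume {x | l x = 0} = 0 := by
    have := Measure.addHaar_submodule (volume : Measure (EuclideanSpace ℝ (Fin 3))) (LinearMap.ker l) (by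
      intro h; exact hy (by rw [← LinearMap.mem_ker, h]; trivial))
    exact this
  have e : volume (S ∩ {x | l x ≤ 0}) = volume (S \ {x | 0 ≤ l x}) := by
    apply le_antisymm
    · calc volume (S ∩ {x | l x ≤ 0}) ≤ volume ((S \ {x | 0 ≤ l x}) ∪ {x | l x = 0}) := by
            apply measure_mono
            rintro x ⟨h1, h2⟩
            rcases lt_or_eq_of_le (show l x ≤ 0 from h2) with h | h
            · left; exact ⟨h1, by simpa using h⟩
            · right; exact h
        _ ≤ _ := by
            refine (measure_union_le _ _).trans ?_
            rw [h0, add_zero]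
    · apply measure_mono
      rintro x ⟨h1, h2⟩
      exact ⟨h1, by simp at h2; exact h2.le⟩
  rw [e, ← ENNReal.toReal_add, measure_inter_add_diff S hm]
  · exact measure_ne_top_of_subset Set.inter_subset_left hS
  · exact measure_ne_top_of_subset Set.diff_subset hS

theorem arg_eq_arctan_of_pos (D d : ℝ) (hD : 0 < D) : Complex.arg ⟨D, d⟩ = Real.arctan (d / D) := by
  have h := Complex.tan_arg ⟨D, d⟩
  have h2 : |Complex.arg ⟨D, d⟩| < Real.pi / 2 := Complex.abs_arg_lt_pi_div_two_iff.2 (Or.inl hD)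
  rw [abs_lt] at h2
  rw [← h, Real.arctan_tan h2.1 h2.2]

theorem angle_sum (A B C p q s d : ℝ) (hA : 0 < A) (hB : 0 < B) (hC : 0 < C) (hd : 0 < d)
    (hs : s < A * B) (hp : p < B * C) (hq : q < C * A)
    (hg : d ^ 2 = A ^ 2 * B ^ 2 * C ^ 2 + 2 * p * q * s - A ^ 2 * p ^ 2 - B ^ 2 * q ^ 2
      - C ^ 2 * s ^ 2)
    (hD : 0 < A * B * C + A * p + B * q + C * s) :
    Complex.arg ⟨A ^ 2 * p - q * s, A * d⟩ + Complex.arg ⟨B ^ 2 * q - s * p, B * d⟩ +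
      Complex.arg ⟨C ^ 2 * s - p * q, C * d⟩ - Real.pi
      = 2 * Real.arctan (d / (A * B * C + A * p + B * q + C * s)) := by
  set D := A * B * C + A * p + B * q + C * s with hDe
  have key : (⟨A ^ 2 * p - q * s, A * d⟩ : ℂ) * ⟨B ^ 2 * q - s * p, B * d⟩ *
      ⟨C ^ 2 * s - p * q, C * d⟩ =
      ((((A * B - s) * (B * C - p) * (C * A - q) / 2 : ℝ) : ℂ)) * ((-1) * ((⟨D, d⟩ : ℂ) * ⟨D, d⟩)) := by
    apply Complex.ext
    · simp only [Complex.mul_re, Complex.mul_im, Complex.ofReal_re, Complex.ofReal_im, Complex.neg_re,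
        Complex.neg_im, Complex.one_re, Complex.one_im, hDe]
      linear_combination (-((A ^ 2 * p - q * s) * (B * C) + (B ^ 2 * q - s * p) * (C * A) +
        (C ^ 2 * s - p * q) * (A * B)) - (A * B - s) * (B * C - p) * (C * A - q) / 2) * hg
    · simp only [Complex.mul_re, Complex.mul_im, Complex.ofReal_re, Complex.ofReal_im, Complex.neg_re,
        Complex.neg_im, Complex.one_re, Complex.one_im, hDe]
      linear_combination (-(A * B * C * d)) * hg
  have k0 : 0 < (A * B - s) * (B * C - p) * (C * A - q) / 2 := by
    have := sub_pos.2 hs; have := sub_pos.2 hp; have := sub_pos.2 hq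
    positivity
  have nz : ∀ u v : ℝ, 0 < v → (⟨u, v⟩ : ℂ) ≠ 0 := by
    intro u v hv h; have := congrArg Complex.im h; simp at this; linarith
  have pos : ∀ u v : ℝ, 0 < v → 0 < Complex.arg (⟨u, v⟩ : ℂ) ∧ Complex.arg (⟨u, v⟩ : ℂ) < Real.pi := by
    intro u v hv
    constructor
    · rcases (Complex.arg_nonneg_iff (z := ⟨u, v⟩)).2 hv.le |>.lt_or_eq with h | h
      · exact h
      · have := (Complex.arg_eq_zero_iff (z := ⟨u, v⟩)).1 h.symm
        simp at this; linarith
    · rw [Complex.arg_lt_pi_iff]; right; exact hv.ne'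
  have n1 := nz (A ^ 2 * p - q * s) (A * d) (by positivity)
  have n2 := nz (B ^ 2 * q - s * p) (B * d) (by positivity)
  have n3 := nz (C ^ 2 * s - p * q) (C * d) (by positivity)
  have n4 := nz D d hd
  have p1 := pos (A ^ 2 * p - q * s) (A * d) (by positivity)
  have p2 := pos (B ^ 2 * q - s * p) (B * d) (by positivity)
  have p3 := pos (C ^ 2 * s - p * q) (C * d) (by positivity)
  have ka := congrArg (fun z : ℂ => (Complex.arg z : Real.Angle)) key
  rw [Complex.arg_real_mul _ k0, Complex.arg_mul_coe_angle (mul_ne_zero n1 n2) n3,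
    Complex.arg_mul_coe_angle n1 n2, Complex.arg_mul_coe_angle (by norm_num) (mul_ne_zero n4 n4),
    Complex.arg_mul_coe_angle n4 n4, Complex.arg_neg_one, arg_eq_arctan_of_pos D d hD] at ka
  rw [← Real.Angle.coe_add, ← Real.Angle.coe_add, ← Real.Angle.coe_add, ← Real.Angle.coe_add,
    Real.Angle.angle_eq_iff_two_pi_dvd_sub] at ka
  obtain ⟨k, hk⟩ := ka
  have a0 : 0 < Real.arctan (d / D) := Real.arctan_pos.2 (by positivity)
  have a1 := Real.arctan_lt_pi_div_two (d / D)
  have hpi := Real.pi_pos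
  have hk1 : (k : ℝ) < 1 := by
    by_contra hc; push Not at hc
    nlinarith
  have hk2 : (-1 : ℝ) < k := by
    by_contra hc; push Not at hc
    nlinarith
  have hk0 : k = 0 := by
    have h1 : k < 1 := by exact_mod_cast hk1
    have h2 : -1 < k := by exact_mod_cast hk2
    omega
  rw [hk0] at hk
  push_cast at hk
  linarith

variable {a b c : EuclideanSpace ℝ (Fin 3)} {f g h : EuclideanSpace ℝ (Fin 3) →ₗ[ℝ] ℝ}

theorem gr_rot (a b c : EuclideanSpace ℝ (Fin 3)) : gr b c a = gr a b c := by
  unfold gr; ring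

theorem girard (F : Fr a b c f g h) (ρ : ℝ) (hρ : 0 ≤ ρ)
    (hD : 0 < ‖a‖ * ‖b‖ * ‖c‖ + ‖a‖ * inner ℝ b c + ‖b‖ * inner ℝ c a + ‖c‖ * inner ℝ a b) :
    (volume {x : EuclideanSpace ℝ (Fin 3) | x ∈ closedBall 0 ρ ∧ 0 ≤ f x ∧ 0 ≤ g x ∧ 0 ≤ h x}).toReal
      = 2 / 3 * ρ ^ 3 * Real.arctan (√(gr a b c) /
        (‖a‖ * ‖b‖ * ‖c‖ + ‖a‖ * inner ℝ b c + ‖b‖ * inner ℝ c a + ‖c‖ * inner ℝ a b)) := by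
  obtain ⟨g0, L1⟩ := vol_dihedral F ρ hρ
  obtain ⟨-, L2⟩ := vol_dihedral F.rot ρ hρ
  obtain ⟨-, L3⟩ := vol_dihedral F.rot.rot ρ hρ
  rw [gr_rot] at L2
  rw [gr_rot, gr_rot] at L3
  have hfin : ∀ S ⊆ closedBall (0 : EuclideanSpace ℝ (Fin 3)) ρ, volume S ≠ ⊤ := fun S hS =>
    measure_ne_top_of_subset hS measure_closedBall_lt_top.ne
  have T1 := congrArg ENNReal.toReal L1
  have T2 := congrArg ENNReal.toReal L2
  have T3 := congrArg ENNReal.toReal L3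
  have an : ∀ u v : ℝ, 0 ≤ v → 0 ≤ 2 / 3 * ρ ^ 3 * Complex.arg ⟨u, v⟩ := by
    intro u v hv
    have := (Complex.arg_nonneg_iff (z := ⟨u, v⟩)).2 hv
    positivity
  rw [ENNReal.toReal_ofReal (an _ _ (by positivity))] at T1 T2 T3
  have s1 := split_real {x | x ∈ closedBall 0 ρ ∧ 0 ≤ f x ∧ 0 ≤ g x}
    (hfin _ fun x hx => hx.1) h c (by simp [F.hc])
  have s2 := split_real {x | x ∈ closedBall 0 ρ ∧ 0 ≤ g x ∧ 0 ≤ h x}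
    (hfin _ fun x hx => hx.1) f a (by simp [F.fa])
  have s3 := split_real {x | x ∈ closedBall 0 ρ ∧ 0 ≤ h x ∧ 0 ≤ f x}
    (hfin _ fun x hx => hx.1) g b (by simp [F.gb])
  have q1 := split_real (closedBall 0 ρ) (hfin _ fun x hx => hx) h c (by simp [F.hc])
  have q2 := split_real (closedBall 0 ρ ∩ {x | 0 ≤ h x}) (hfin _ fun x hx => hx.1) f a (by simp [F.fa])
  have q3 := split_real (closedBall 0 ρ ∩ {x | 0 ≤ h x} ∩ {x | f x ≤ 0})
    (hfin _ fun x hx => hx.1.1) g b (by simp [F.gb])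
  -- set identities
  have negv : ∀ S S' : Set (EuclideanSpace ℝ (Fin 3)), (∀ x, x ∈ S ↔ -x ∈ S') →
      volume S = volume S' := by
    intro S S' h
    rw [← Measure.measure_preimage_neg volume S']
    congr 1
    ext x; exact h x
  have n1 : volume (closedBall 0 ρ ∩ {x | h x ≤ 0}) = volume (closedBall 0 ρ ∩ {x | 0 ≤ h x}) :=
    negv _ _ (by intro x; simp)
  have n2 : volume (closedBall 0 ρ ∩ {x | 0 ≤ h x} ∩ {x | f x ≤ 0} ∩ {x | g x ≤ 0}) =
     volume ({x | x ∈ closedBall 0 ρ ∧ 0 ≤ f x ∧ 0 ≤ g x} ∩ {x | h x ≤ 0}) :=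
    negv _ _ (by intro x; simp; tauto)
  have i1 : closedBall 0 ρ ∩ {x | 0 ≤ h x} ∩ {x | 0 ≤ f x} =
    {x | x ∈ closedBall 0 ρ ∧ 0 ≤ h x ∧ 0 ≤ f x} := by ext x; simp; tauto
  have i2 : closedBall 0 ρ ∩ {x | 0 ≤ h x} ∩ {x | f x ≤ 0} ∩ {x | 0 ≤ g x} =
    {x | x ∈ closedBall 0 ρ ∧ 0 ≤ g x ∧ 0 ≤ h x} ∩ {x | f x ≤ 0} := by ext x; simp; tauto
  have j1 : {x | x ∈ closedBall 0 ρ ∧ 0 ≤ f x ∧ 0 ≤ g x} ∩ {x | 0 ≤ h x} =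
    {x | x ∈ closedBall 0 ρ ∧ 0 ≤ f x ∧ 0 ≤ g x ∧ 0 ≤ h x} := by ext x; simp; tauto
  have j2 : {x | x ∈ closedBall 0 ρ ∧ 0 ≤ g x ∧ 0 ≤ h x} ∩ {x | 0 ≤ f x} =
    {x | x ∈ closedBall 0 ρ ∧ 0 ≤ f x ∧ 0 ≤ g x ∧ 0 ≤ h x} := by ext x; simp; tauto
  have j3 : {x | x ∈ closedBall 0 ρ ∧ 0 ≤ h x ∧ 0 ≤ f x} ∩ {x | 0 ≤ g x} =
    {x | x ∈ closedBall 0 ρ ∧ 0 ≤ f x ∧ 0 ≤ g x ∧ 0 ≤ h x} := by ext x; simp; tauto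
  rw [n1] at q1
  rw [i1] at q2
  rw [i2, n2] at q3
  rw [j1] at s1
  rw [j2] at s2
  rw [j3] at s3
  have hV : (volume (closedBall (0 : EuclideanSpace ℝ (Fin 3)) ρ)).toReal = 4 / 3 * Real.pi * ρ ^ 3 := by
    rw [EuclideanSpace.volume_closedBall_fin_three, ENNReal.toReal_mul, ENNReal.toReal_pow,
      ENNReal.toReal_ofReal hρ, ENNReal.toReal_ofReal (by positivity)]; ring
  have na : ∀ {u v w : EuclideanSpace ℝ (Fin 3)} {f g h}, Fr u v w f g h → 0 < ‖u‖ := by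
    intro u v w f g h F; rw [norm_pos_iff]; intro h0; have := F.fa; rw [h0] at this; simp at this
  have cs : ∀ {u v w : EuclideanSpace ℝ (Fin 3)} {f g h}, Fr u v w f g h →
      inner ℝ u v < ‖u‖ * ‖v‖ := by
    intro u v w f g h F
    rcases (real_inner_le_norm u v).lt_or_eq with h1 | h1
    · exact h1
    · have := inner_eq_norm_mul_iff_real.1 h1
      have h2 := congrArg f this
      simp [F.fa, F.fb] at h2
      exact absurd (norm_eq_zero.2 h2) (na F.rot).ne'
  have := angle_sum ‖a‖ ‖b‖ ‖c‖ (inner ℝ b c) (inner ℝ c a) (inner ℝ a b) (√(gr a b c))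
    (na F) (na F.rot) (na F.rot.rot) (Real.sqrt_pos.2 g0) (cs F) (cs F.rot) (cs F.rot.rot)
    (by rw [Real.sq_sqrt g0.le]; rfl) hD
  have e2 : (2 / 3 * ρ ^ 3 * Real.arctan (√(gr a b c) /
        (‖a‖ * ‖b‖ * ‖c‖ + ‖a‖ * inner ℝ b c + ‖b‖ * inner ℝ c a + ‖c‖ * inner ℝ a b))) =
      1 / 3 * ρ ^ 3 * (2 * Real.arctan (√(gr a b c) /
        (‖a‖ * ‖b‖ * ‖c‖ + ‖a‖ * inner ℝ b c + ‖b‖ * inner ℝ c a + ‖c‖ * inner ℝ a b))) := by ring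
  rw [e2, ← this]
  linarith

end

section



theorem vol_std : volume {x : EuclideanSpace ℝ (Fin 3) | 0 ≤ x 0 ∧ 0 ≤ x 1 ∧ 0 ≤ x 2 ∧
    x 0 + x 1 + x 2 ≤ 1} = ENNReal.ofReal (1 / 6) := by
  have hm : MeasurableSet {p : ℝ × (ℝ × ℝ) | 0 ≤ p.1 ∧ 0 ≤ p.2.1 ∧ 0 ≤ p.2.2 ∧
      p.1 + p.2.1 + p.2.2 ≤ 1} := by
    apply IsClosed.measurableSet
    simp only [Set.setOf_and]
    exact IsClosed.inter (isClosed_le (by fun_prop) (by fun_prop)) (IsClosed.inter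
      (isClosed_le (by fun_prop) (by fun_prop)) (IsClosed.inter
      (isClosed_le (by fun_prop) (by fun_prop)) (isClosed_le (by fun_prop) (by fun_prop))))
  have e1 := mp_split3.measure_preimage hm.nullMeasurableSet
  have e2 : ∀ t : ℝ, volume {p : ℝ × ℝ | 0 ≤ p.1 ∧ 0 ≤ p.2 ∧ p.1 + p.2 ≤ t} =
      ENNReal.ofReal (if 0 ≤ t then t ^ 2 / 2 else 0) := by
    intro t
    have hm : MeasurableSet {p : ℝ × ℝ | 0 ≤ p.1 ∧ 0 ≤ p.2 ∧ p.1 + p.2 ≤ t} := by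
      apply IsClosed.measurableSet
      simp only [Set.setOf_and]
      exact IsClosed.inter (isClosed_le (by fun_prop) (by fun_prop)) (IsClosed.inter
        (isClosed_le (by fun_prop) (by fun_prop)) (isClosed_le (by fun_prop) (by fun_prop)))
    rw [Measure.volume_eq_prod, Measure.prod_apply hm]
    have e3 : ∀ x : ℝ, volume (Prod.mk x ⁻¹' {p : ℝ × ℝ | 0 ≤ p.1 ∧ 0 ≤ p.2 ∧ p.1 + p.2 ≤ t}) =
        (Set.Icc 0 t).indicator (fun x => ENNReal.ofReal (t - x)) x := by
      intro x
      by_cases hx : x ∈ Set.Icc 0 t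
      · rw [Set.indicator_of_mem hx]
        have : (Prod.mk x ⁻¹' {p : ℝ × ℝ | 0 ≤ p.1 ∧ 0 ≤ p.2 ∧ p.1 + p.2 ≤ t}) = Set.Icc 0 (t - x) := by
          ext y; simp [hx.1]; intro; constructor <;> intro <;> linarith
        rw [this, Real.volume_Icc, sub_zero]
      · rw [Set.indicator_of_notMem hx]
        have : (Prod.mk x ⁻¹' {p : ℝ × ℝ | 0 ≤ p.1 ∧ 0 ≤ p.2 ∧ p.1 + p.2 ≤ t}) = ∅ := by
          ext y; simp; intro h1 h2; by_contra h3
          exact hx ⟨h1, by linarith⟩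
        rw [this]; simp
    simp_rw [e3]
    rw [lintegral_indicator measurableSet_Icc]
    split_ifs with h
    · rw [← ofReal_integral_eq_lintegral_ofReal, integral_Icc_eq_integral_Ioc,
        ← intervalIntegral.integral_of_le h]
      · congr 1
        rw [intervalIntegral.integral_comp_sub_left (fun x => x) t, integral_id]; ring
      · exact (by fun_prop : Continuous fun x : ℝ => t - x).integrableOn_Icc
      · filter_upwards [ae_restrict_mem measurableSet_Icc] with x hx
        simpa using hx.2
    · rw [Set.Icc_eq_empty h]; simp
  have e0 : {x : EuclideanSpace ℝ (Fin 3) | 0 ≤ x 0 ∧ 0 ≤ x 1 ∧ 0 ≤ x 2 ∧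
    x 0 + x 1 + x 2 ≤ 1} = (fun x : EuclideanSpace ℝ (Fin 3) => ((x 0, (x 1, x 2)) : ℝ × (ℝ × ℝ))) ⁻¹'
      {p : ℝ × (ℝ × ℝ) | 0 ≤ p.1 ∧ 0 ≤ p.2.1 ∧ 0 ≤ p.2.2 ∧ p.1 + p.2.1 + p.2.2 ≤ 1} := rfl
  rw [e0, e1, Measure.volume_eq_prod, Measure.prod_apply hm]
  have e3 : ∀ x : ℝ, volume (Prod.mk x ⁻¹' {p : ℝ × (ℝ × ℝ) | 0 ≤ p.1 ∧ 0 ≤ p.2.1 ∧ 0 ≤ p.2.2 ∧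
      p.1 + p.2.1 + p.2.2 ≤ 1}) =
        (Set.Icc 0 1).indicator (fun x => ENNReal.ofReal ((1 - x) ^ 2 / 2)) x := by
    intro x
    by_cases hx : x ∈ Set.Icc (0:ℝ) 1
    · rw [Set.indicator_of_mem hx]
      have : (Prod.mk x ⁻¹' {p : ℝ × (ℝ × ℝ) | 0 ≤ p.1 ∧ 0 ≤ p.2.1 ∧ 0 ≤ p.2.2 ∧
          p.1 + p.2.1 + p.2.2 ≤ 1}) = {p : ℝ × ℝ | 0 ≤ p.1 ∧ 0 ≤ p.2 ∧ p.1 + p.2 ≤ 1 - x} := by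
        ext y; simp [hx.1]; intro _ _; constructor <;> intro <;> linarith
      rw [this, e2, if_pos (by linarith [hx.2])]
    · rw [Set.indicator_of_notMem hx]
      have : (Prod.mk x ⁻¹' {p : ℝ × (ℝ × ℝ) | 0 ≤ p.1 ∧ 0 ≤ p.2.1 ∧ 0 ≤ p.2.2 ∧
          p.1 + p.2.1 + p.2.2 ≤ 1}) = ∅ := by
        ext y; simp; intro h1 h2 h3; by_contra h4
        exact hx ⟨h1, by linarith⟩
      rw [this]; simp
  simp_rw [e3]
  rw [lintegral_indicator measurableSet_Icc, ← ofReal_integral_eq_lintegral_ofReal,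
    integral_Icc_eq_integral_Ioc, ← intervalIntegral.integral_of_le zero_le_one]
  · congr 1
    rw [intervalIntegral.integral_div, intervalIntegral.integral_comp_sub_left (fun x => x ^ 2) 1]
    simp [integral_pow]; norm_num
  · exact (by fun_prop : Continuous fun x : ℝ => (1 - x) ^ 2 / 2).integrableOn_Icc
  · filter_upwards with x
    positivity

variable {a b c : EuclideanSpace ℝ (Fin 3)} {f g h : EuclideanSpace ℝ (Fin 3) →ₗ[ℝ] ℝ}

theorem vol_simplex (F : Fr a b c f g h) :
    volume {x | 0 ≤ f x ∧ 0 ≤ g x ∧ 0 ≤ h x ∧ f x + g x + h x ≤ 1} =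
      ENNReal.ofReal (√(gr a b c) / 6) := by
  let B := (EuclideanSpace.basisFun (Fin 3) ℝ).toBasis
  let M : Matrix (Fin 3) (Fin 3) ℝ := !![a 0, b 0, c 0; a 1, b 1, c 1; a 2, b 2, c 2]
  let Lm := Matrix.toLin B B M
  have hL : ∀ x, Lm x = x 0 • a + x 1 • b + x 2 • c := by
    intro x
    apply B.repr.injective
    ext i
    rw [Matrix.repr_toLin]
    fin_cases i <;> simp [B, M, Matrix.mulVec, dotProduct, Fin.sum_univ_three] <;> ring
  have hdet : LinearMap.det Lm = M.det := LinearMap.det_toLin B M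
  have hsq : (M.det) ^ 2 = gr a b c := by
    unfold gr
    rw [Matrix.det_fin_three]
    simp only [normsq_coord, inner_coord, M]
    simp
    ring
  have im := Measure.addHaar_image_linearMap (volume : Measure (EuclideanSpace ℝ (Fin 3))) Lm
    {x : EuclideanSpace ℝ (Fin 3) | 0 ≤ x 0 ∧ 0 ≤ x 1 ∧ 0 ≤ x 2 ∧ x 0 + x 1 + x 2 ≤ 1}
  have hset : Lm '' {x : EuclideanSpace ℝ (Fin 3) | 0 ≤ x 0 ∧ 0 ≤ x 1 ∧ 0 ≤ x 2 ∧ x 0 + x 1 + x 2 ≤ 1}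
     = {x | 0 ≤ f x ∧ 0 ≤ g x ∧ 0 ≤ h x ∧ f x + g x + h x ≤ 1} := by
    ext y
    constructor
    · rintro ⟨x, hx, rfl⟩
      simp only [Set.mem_setOf_eq] at hx ⊢
      rw [hL]
      simpa [F.fa, F.fb, F.fc, F.ga, F.gb, F.gc, F.ha, F.hb, F.hc] using hx
    · intro hy
      refine ⟨!₂[f y, g y, h y], by simpa using hy, ?_⟩
      rw [hL]
      conv_rhs => rw [F.sp y]
      simp
  rw [← hset, im, vol_std, hdet, ← ENNReal.ofReal_mul (abs_nonneg _), ← hsq, Real.sqrt_sq_eq_abs]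
  congr 1; ring

theorem exists_Fr (A B C D : EuclideanSpace ℝ (Fin 3)) (haff : AffineIndependent ℝ ![A, B, C, D]) :
    ∃ f g h, Fr (B - A) (C - A) (D - A) f g h := by
  have hli := (affineIndependent_iff_linearIndependent_vsub ℝ _ (0 : Fin 4)).1 haff
  have hli2 : LinearIndependent ℝ ![B - A, C - A, D - A] := by
    have := hli.comp (fun i : Fin 3 => (⟨i.succ, Fin.succ_ne_zero i⟩ : {x : Fin 4 // x ≠ 0}))
      (by intro i j hij; simpa using hij)
    have e : ![B - A, C - A, D - A] = (fun i : {x : Fin 4 // x ≠ 0} => ![A, B, C, D] i -ᵥ ![A, B, C, D] 0) ∘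
      (fun i : Fin 3 => (⟨i.succ, Fin.succ_ne_zero i⟩ : {x : Fin 4 // x ≠ 0})) := by
      funext i; fin_cases i <;> simp
    rw [e]; exact this
  let b := basisOfLinearIndependentOfCardEqFinrank hli2 (by simp)
  have hb : ⇑b = ![B - A, C - A, D - A] := coe_basisOfLinearIndependentOfCardEqFinrank hli2 (by simp)
  have b0 : b 0 = B - A := by rw [hb]; rfl
  have b1 : b 1 = C - A := by rw [hb]; rfl
  have b2 : b 2 = D - A := by rw [hb]; rfl
  refine ⟨b.coord 0, b.coord 1, b.coord 2, ?_⟩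
  rw [← b0, ← b1, ← b2]
  refine ⟨fun x => ?_, ?_, ?_, ?_, ?_, ?_, ?_, ?_, ?_, ?_⟩
  · conv_lhs => rw [← b.sum_repr x, Fin.sum_univ_three]
    rfl
  all_goals simp [Module.Basis.coord_apply]

theorem mem_hull4 (A B C D x : EuclideanSpace ℝ (Fin 3))
    (F : Fr (B - A) (C - A) (D - A) f g h) :
    x ∈ convexHull ℝ {A, B, C, D} ↔
      0 ≤ f (x - A) ∧ 0 ≤ g (x - A) ∧ 0 ≤ h (x - A) ∧ f (x - A) + g (x - A) + h (x - A) ≤ 1 := by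
  constructor
  · intro hx
    have hconv : Convex ℝ {x : EuclideanSpace ℝ (Fin 3) | 0 ≤ f (x - A) ∧ 0 ≤ g (x - A) ∧
        0 ≤ h (x - A) ∧ f (x - A) + g (x - A) + h (x - A) ≤ 1} := by
      intro x hx y hy u v hu hv huv
      simp only [Set.mem_setOf_eq] at *
      have e : u • x + v • y - A = u • (x - A) + v • (y - A) := by
        have : A = (u + v) • A := by rw [huv, one_smul]
        conv_lhs => rw [this]
        module
      rw [e]
      simp only [map_add, map_smul, smul_eq_mul]
      obtain ⟨x1, x2, x3, x4⟩ := hx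
      obtain ⟨y1, y2, y3, y4⟩ := hy
      refine ⟨by positivity, by positivity, by positivity, ?_⟩
      nlinarith
    refine convexHull_min ?_ hconv hx
    rintro y (rfl | rfl | rfl | rfl)
    · simp
    · simp only [Set.mem_setOf_eq, F.fa, F.ga, F.ha]; norm_num
    · simp only [Set.mem_setOf_eq, F.fb, F.gb, F.hb]; norm_num
    · simp only [Set.mem_setOf_eq, F.fc, F.gc, F.hc]; norm_num
  · rintro ⟨h1, h2, h3, h4⟩
    have hx : x = (1 - f (x - A) - g (x - A) - h (x - A)) • A + f (x - A) • B + g (x - A) • C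
        + h (x - A) • D := by
      have := F.sp (x - A)
      have e : x = A + (x - A) := by abel
      conv_lhs => rw [e, this]
      module
    rw [hx]
    generalize f (x - A) = u at *
    generalize g (x - A) = v at *
    generalize h (x - A) = w at *
    have hc := convex_convexHull ℝ ({A, B, C, D} : Set (EuclideanSpace ℝ (Fin 3)))
    have := hc.sum_mem (t := Finset.univ) (w := ![1 - u - v - w, u,
      v, w]) (z := ![A, B, C, D]) (by
        intro i _; fin_cases i <;> simp <;> linarith) (by simp [Fin.sum_univ_four]; ring) (by
        intro i _; apply subset_convexHull; fin_cases i <;> simp)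
    simpa [Fin.sum_univ_four] using this

end

section

/-- nondegenerate tetrahedron, through frames -/
def TF (A B C D : EuclideanSpace ℝ (Fin 3)) : Prop := ∃ f g h, Fr (B - A) (C - A) (D - A) f g h

theorem TF.rot {A B C D : EuclideanSpace ℝ (Fin 3)} (T : TF A B C D) : TF A C D B := by
  obtain ⟨f, g, h, F⟩ := T
  exact ⟨_, _, _, F.rot⟩

theorem TF.swap {A B C D : EuclideanSpace ℝ (Fin 3)} (T : TF A B C D) : TF B A C D := by
  obtain ⟨f, g, h, F⟩ := T
  have := F.reroot
  rw [neg_sub, sub_sub_sub_cancel_right, sub_sub_sub_cancel_right] at this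
  exact ⟨_, _, _, this⟩

theorem TF.vC {A B C D : EuclideanSpace ℝ (Fin 3)} (T : TF A B C D) : TF C A B D := by
  have h : TF A C B D := by
    obtain ⟨f, g, h, F⟩ := T
    exact ⟨_, _, _, F.swap⟩
  exact h.swap

theorem TF.vD {A B C D : EuclideanSpace ℝ (Fin 3)} (T : TF A B C D) : TF D A B C :=
  T.rot.rot.swap

/-- the cone of a tetrahedron at its first vertex -/
def coneAt (A B C D : EuclideanSpace ℝ (Fin 3)) : Set (EuclideanSpace ℝ (Fin 3)) :=
  {x | ∃ u v w : ℝ, 0 ≤ u ∧ 0 ≤ v ∧ 0 ≤ w ∧ x = A + (u • (B - A) + v • (C - A) + w • (D - A))}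

theorem mem_coneAt {A B C D x : EuclideanSpace ℝ (Fin 3)}
    {f g h : EuclideanSpace ℝ (Fin 3) →ₗ[ℝ] ℝ} (F : Fr (B - A) (C - A) (D - A) f g h) :
    x ∈ coneAt A B C D ↔ 0 ≤ f (x - A) ∧ 0 ≤ g (x - A) ∧ 0 ≤ h (x - A) := by
  constructor
  · rintro ⟨u, v, w, hu, hv, hw, rfl⟩
    rw [add_sub_cancel_left]
    have e1 : f (u • (B - A) + v • (C - A) + w • (D - A)) = u := by
      rw [map_add, map_add, map_smul, map_smul, map_smul, F.fa, F.fb, F.fc]; simp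
    have e2 : g (u • (B - A) + v • (C - A) + w • (D - A)) = v := by
      rw [map_add, map_add, map_smul, map_smul, map_smul, F.ga, F.gb, F.gc]; simp
    have e3 : h (u • (B - A) + v • (C - A) + w • (D - A)) = w := by
      rw [map_add, map_add, map_smul, map_smul, map_smul, F.ha, F.hb, F.hc]; simp
    rw [e1, e2, e3]; exact ⟨hu, hv, hw⟩
  · rintro ⟨h1, h2, h3⟩
    refine ⟨_, _, _, h1, h2, h3, ?_⟩
    rw [← F.sp (x - A)]; abel

theorem norm_dist (X Y : EuclideanSpace ℝ (Fin 3)) : ‖Y - X‖ = dist X Y := by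
  rw [dist_comm, dist_eq_norm]

theorem inner_dist (X Y Z : EuclideanSpace ℝ (Fin 3)) :
    inner ℝ (Y - X) (Z - X) = (dist X Y ^ 2 + dist X Z ^ 2 - dist Y Z ^ 2) / 2 := by
  have h := norm_sub_sq_real (Y - X) (Z - X)
  rw [sub_sub_sub_cancel_right, ← dist_eq_norm, norm_dist, norm_dist] at h
  linarith

theorem quad_dist (A B C D : EuclideanSpace ℝ (Fin 3)) (u v w : ℝ) :
    ‖u • (B - A) + v • (C - A) + w • (D - A)‖ ^ 2 =
      u ^ 2 * dist A B ^ 2 + v ^ 2 * dist A C ^ 2 + w ^ 2 * dist A D ^ 2 +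
      u * v * (dist A B ^ 2 + dist A C ^ 2 - dist B C ^ 2) +
      u * w * (dist A B ^ 2 + dist A D ^ 2 - dist B D ^ 2) +
      v * w * (dist A C ^ 2 + dist A D ^ 2 - dist C D ^ 2) := by
  rw [norm_add_sq_real, norm_add_sq_real, inner_add_left]
  simp only [inner_smul_left, inner_smul_right, norm_smul, mul_pow, inner_dist, norm_dist,
    Real.norm_eq_abs, sq_abs]
  simp; ring

theorem CC_gr (A B C D : EuclideanSpace ℝ (Fin 3)) :
    CC (dist A B) (dist C D) (dist A C) (dist A D) (dist B C) (dist B D) =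
      4 * gr (B - A) (C - A) (D - A) := by
  unfold CC gr
  rw [inner_dist, inner_dist, inner_dist, norm_dist, norm_dist, norm_dist, dist_comm D B]
  ring

theorem Dv_gr (A B C D : EuclideanSpace ℝ (Fin 3)) :
    Dv (dist A B) (dist A C) (dist A D) (dist C D) (dist B D) (dist B C) =
      2 * (‖B - A‖ * ‖C - A‖ * ‖D - A‖ + ‖B - A‖ * inner ℝ (C - A) (D - A) +
        ‖C - A‖ * inner ℝ (D - A) (B - A) + ‖D - A‖ * inner ℝ (B - A) (C - A)) := by
  unfold Dv
  rw [inner_dist, inner_dist, inner_dist, norm_dist, norm_dist, norm_dist, dist_comm D B]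
  ring

theorem sqrt_CC (A B C D : EuclideanSpace ℝ (Fin 3)) :
    √(CC (dist A B) (dist C D) (dist A C) (dist A D) (dist B C) (dist B D)) =
      2 * √(gr (B - A) (C - A) (D - A)) := by
  rw [CC_gr, Real.sqrt_mul (by norm_num), show (4:ℝ) = 2 ^ 2 by norm_num, Real.sqrt_sq (by norm_num)]

theorem TF.CC_pos {A B C D : EuclideanSpace ℝ (Fin 3)} (T : TF A B C D) :
    0 < CC (dist A B) (dist C D) (dist A C) (dist A D) (dist B C) (dist B D) := by
  obtain ⟨f, g, h, F⟩ := T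
  rw [CC_gr]
  have := (vol_dihedral F 1 zero_le_one).1
  linarith

theorem vol_sub (A : EuclideanSpace ℝ (Fin 3)) (S : Set (EuclideanSpace ℝ (Fin 3))) :
    volume ((fun x => x - A) ⁻¹' S) = volume S := by
  have := measure_preimage_add_right volume (-A) S
  simpa only [← sub_eq_add_neg] using this

theorem vol_cone {A B C D : EuclideanSpace ℝ (Fin 3)} (T : TF A B C D) (ρ : ℝ) (hρ : 0 ≤ ρ)
    (hD : 0 < Dv (dist A B) (dist A C) (dist A D) (dist C D) (dist B D) (dist B C)) :
    (volume (coneAt A B C D ∩ closedBall A ρ)).toReal = 2 / 3 * ρ ^ 3 * Real.arctan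
      (√(CC (dist A B) (dist C D) (dist A C) (dist A D) (dist B C) (dist B D)) /
        Dv (dist A B) (dist A C) (dist A D) (dist C D) (dist B D) (dist B C)) := by
  obtain ⟨f, g, h, F⟩ := T
  rw [Dv_gr] at hD
  rw [Dv_gr, sqrt_CC, mul_div_mul_left _ _ two_ne_zero, ← girard F ρ hρ (by linarith)]
  congr 1
  rw [← vol_sub A {x | x ∈ closedBall 0 ρ ∧ 0 ≤ f x ∧ 0 ≤ g x ∧ 0 ≤ h x}]
  congr 1
  ext x
  simp only [Set.mem_inter_iff, mem_coneAt F, Set.mem_preimage, Set.mem_setOf_eq,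
    mem_closedBall, dist_eq_norm, sub_zero]
  tauto

theorem vol_tetra {A B C D : EuclideanSpace ℝ (Fin 3)} (T : TF A B C D) :
    (volume (tetra A B C D)).toReal =
      √(CC (dist A B) (dist C D) (dist A C) (dist A D) (dist B C) (dist B D)) / 12 := by
  obtain ⟨f, g, h, F⟩ := T
  have := vol_simplex F
  rw [← vol_sub A] at this
  have e : tetra A B C D = (fun x => x - A) ⁻¹'
      {x | 0 ≤ f x ∧ 0 ≤ g x ∧ 0 ≤ h x ∧ f x + g x + h x ≤ 1} := by
    ext x
    exact mem_hull4 A B C D x F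
  rw [e, this, sqrt_CC, ENNReal.toReal_ofReal (by positivity)]
  ring

theorem tetra_swap (A B C D : EuclideanSpace ℝ (Fin 3)) : tetra A B C D = tetra B A C D := by
  unfold tetra; congr 1; ext x; simp; tauto
theorem tetra_vC (A B C D : EuclideanSpace ℝ (Fin 3)) : tetra A B C D = tetra C A B D := by
  unfold tetra; congr 1; ext x; simp; tauto
theorem tetra_vD (A B C D : EuclideanSpace ℝ (Fin 3)) : tetra A B C D = tetra D A B C := by
  unfold tetra; congr 1; ext x; simp; tauto

theorem tetra_sub {A B C D : EuclideanSpace ℝ (Fin 3)} (T : TF A B C D) :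
    tetra A B C D ⊆ coneAt A B C D := by
  obtain ⟨f, g, h, F⟩ := T
  intro x hx
  rw [mem_coneAt F]
  obtain ⟨h1, h2, h3, -⟩ := (mem_hull4 A B C D x F).1 hx
  exact ⟨h1, h2, h3⟩

theorem cone_sub {A B C D : EuclideanSpace ℝ (Fin 3)} (T : TF A B C D) (ρ : ℝ) (hρ : 0 < ρ)
    (hq : ∀ u v w : ℝ, 0 ≤ u → 0 ≤ v → 0 ≤ w → ρ ^ 2 * (u + v + w) ^ 2 ≤
      ‖u • (B - A) + v • (C - A) + w • (D - A)‖ ^ 2) :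
    coneAt A B C D ∩ closedBall A ρ ⊆ tetra A B C D := by
  obtain ⟨f, g, h, F⟩ := T
  rintro x ⟨hx, hb⟩
  rw [mem_coneAt F] at hx
  obtain ⟨h1, h2, h3⟩ := hx
  refine (mem_hull4 A B C D x F).2 ⟨h1, h2, h3, ?_⟩
  have h4 := hq _ _ _ h1 h2 h3
  rw [← F.sp (x - A)] at h4
  rw [mem_closedBall, dist_eq_norm] at hb
  have h5 : ‖x - A‖ ^ 2 ≤ ρ ^ 2 := by gcongr
  have h6 : (f (x - A) + g (x - A) + h (x - A)) ^ 2 ≤ 1 := by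
    have : 0 < ρ ^ 2 := by positivity
    nlinarith
  nlinarith

theorem meas_cone {A B C D : EuclideanSpace ℝ (Fin 3)} (T : TF A B C D) :
    MeasurableSet (coneAt A B C D) := by
  obtain ⟨f, g, h, F⟩ := T
  have e : coneAt A B C D = {x | 0 ≤ f (x - A) ∧ 0 ≤ g (x - A) ∧ 0 ≤ h (x - A)} := by
    ext x; exact mem_coneAt F
  rw [e]
  have c1 : Continuous f := f.continuous_of_finiteDimensional
  have c2 : Continuous g := g.continuous_of_finiteDimensional
  have c3 : Continuous h := h.continuous_of_finiteDimensional
  apply IsClosed.measurableSet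
  simp only [Set.setOf_and]
  exact IsClosed.inter (isClosed_le (by fun_prop) (by fun_prop)) (IsClosed.inter
    (isClosed_le (by fun_prop) (by fun_prop)) (isClosed_le (by fun_prop) (by fun_prop)))

theorem ball_null (X Y : EuclideanSpace ℝ (Fin 3)) (s t : ℝ) (h : s + t ≤ dist X Y) (hs : 0 < s) :
    volume (closedBall X s ∩ closedBall Y t) = 0 := by
  refine measure_mono_null ?_ (Measure.addHaar_sphere_of_ne_zero volume X hs.ne')
  rintro x ⟨h1, h2⟩
  rw [mem_closedBall] at h1 h2
  rw [mem_sphere]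
  have := dist_triangle_left X Y x
  linarith

end

section



theorem dens_upper {A B C D : EuclideanSpace ℝ (Fin 3)} (T : TF A B C D) (ρA ρB ρC ρD M : ℝ)
    (hM : (volume (coneAt A B C D ∩ closedBall A ρA)).toReal +
      (volume (coneAt B A C D ∩ closedBall B ρB)).toReal +
      (volume (coneAt C A B D ∩ closedBall C ρC)).toReal +
      (volume (coneAt D A B C ∩ closedBall D ρD)).toReal ≤ M * (volume (tetra A B C D)).toReal) :
    density A B C D ρA ρB ρC ρD ≤ M := by
  unfold density
  have hv : 0 < (volume (tetra A B C D)).toReal := by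
    rw [vol_tetra T]; have := Real.sqrt_pos.2 T.CC_pos; positivity
  rw [div_le_iff₀ hv]
  refine le_trans ?_ hM
  have fin : ∀ (S : Set (EuclideanSpace ℝ (Fin 3))) X ρ, volume (S ∩ closedBall X ρ) ≠ ⊤ :=
    fun S X ρ => measure_ne_top_of_subset Set.inter_subset_right measure_closedBall_lt_top.ne
  rw [← ENNReal.toReal_add (fin _ _ _) (fin _ _ _),
    ← ENNReal.toReal_add (ENNReal.add_ne_top.2 ⟨fin _ _ _, fin _ _ _⟩) (fin _ _ _),
    ← ENNReal.toReal_add (ENNReal.add_ne_top.2 ⟨ENNReal.add_ne_top.2 ⟨fin _ _ _, fin _ _ _⟩,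
      fin _ _ _⟩) (fin _ _ _)]
  apply ENNReal.toReal_mono
  · simp only [ne_eq, ENNReal.add_eq_top, fin, or_self, not_false_eq_true]
  · rw [Set.inter_union_distrib_left, Set.inter_union_distrib_left, Set.inter_union_distrib_left]
    refine (measure_union_le _ _).trans (add_le_add ((measure_union_le _ _).trans
      (add_le_add ((measure_union_le _ _).trans (add_le_add ?_ ?_)) ?_)) ?_)
    · exact measure_mono (Set.inter_subset_inter_left _ (tetra_sub T))
    · rw [tetra_swap]
      exact measure_mono (Set.inter_subset_inter_left _ (tetra_sub T.swap))
    · rw [tetra_vC]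
      exact measure_mono (Set.inter_subset_inter_left _ (tetra_sub T.vC))
    · rw [tetra_vD]
      exact measure_mono (Set.inter_subset_inter_left _ (tetra_sub T.vD))

theorem dens_lower {A B C D : EuclideanSpace ℝ (Fin 3)} (T : TF A B C D) (ρA ρB ρC ρD M : ℝ)
    (pA : 0 < ρA) (pB : 0 < ρB) (pC : 0 < ρC)
    (hAB : ρA + ρB ≤ dist A B) (hAC : ρA + ρC ≤ dist A C) (hAD : ρA + ρD ≤ dist A D)
    (hBC : ρB + ρC ≤ dist B C) (hBD : ρB + ρD ≤ dist B D) (hCD : ρC + ρD ≤ dist C D)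
    (sA : coneAt A B C D ∩ closedBall A ρA ⊆ tetra A B C D)
    (sB : coneAt B A C D ∩ closedBall B ρB ⊆ tetra B A C D)
    (sC : coneAt C A B D ∩ closedBall C ρC ⊆ tetra C A B D)
    (sD : coneAt D A B C ∩ closedBall D ρD ⊆ tetra D A B C)
    (hM : M * (volume (tetra A B C D)).toReal ≤ (volume (coneAt A B C D ∩ closedBall A ρA)).toReal +
      (volume (coneAt B A C D ∩ closedBall B ρB)).toReal +
      (volume (coneAt C A B D ∩ closedBall C ρC)).toReal +
      (volume (coneAt D A B C ∩ closedBall D ρD)).toReal) :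
    M ≤ density A B C D ρA ρB ρC ρD := by
  unfold density
  have hv : 0 < (volume (tetra A B C D)).toReal := by
    rw [vol_tetra T]; have := Real.sqrt_pos.2 T.CC_pos; positivity
  rw [le_div_iff₀ hv]
  refine hM.trans ?_
  have fin : ∀ (S : Set (EuclideanSpace ℝ (Fin 3))) X ρ, volume (S ∩ closedBall X ρ) ≠ ⊤ :=
    fun S X ρ => measure_ne_top_of_subset Set.inter_subset_right measure_closedBall_lt_top.ne
  rw [← ENNReal.toReal_add (fin _ _ _) (fin _ _ _),
    ← ENNReal.toReal_add (ENNReal.add_ne_top.2 ⟨fin _ _ _, fin _ _ _⟩) (fin _ _ _),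
    ← ENNReal.toReal_add (ENNReal.add_ne_top.2 ⟨ENNReal.add_ne_top.2 ⟨fin _ _ _, fin _ _ _⟩,
      fin _ _ _⟩) (fin _ _ _)]
  rw [← tetra_swap] at sB
  rw [← tetra_vC] at sC
  rw [← tetra_vD] at sD
  have mB : MeasurableSet (coneAt B A C D ∩ closedBall B ρB) :=
    (meas_cone T.swap).inter measurableSet_closedBall
  have mC : MeasurableSet (coneAt C A B D ∩ closedBall C ρC) :=
    (meas_cone T.vC).inter measurableSet_closedBall
  have mD : MeasurableSet (coneAt D A B C ∩ closedBall D ρD) :=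
    (meas_cone T.vD).inter measurableSet_closedBall
  have nul : ∀ (S S' : Set (EuclideanSpace ℝ (Fin 3))) (X Y : EuclideanSpace ℝ (Fin 3)) (s t : ℝ),
      s + t ≤ dist X Y → 0 < s → AEDisjoint volume (S ∩ closedBall X s) (S' ∩ closedBall Y t) := by
    intro S S' X Y s t h hs
    refine measure_mono_null ?_ (ball_null X Y s t h hs)
    rintro x ⟨h1, h2⟩
    exact ⟨h1.2, h2.2⟩
  rw [← measure_union₀ mB.nullMeasurableSet (nul _ _ _ _ _ _ hAB pA),
    ← measure_union₀ mC.nullMeasurableSet (AEDisjoint.union_left (nul _ _ _ _ _ _ hAC pA)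
      (nul _ _ _ _ _ _ hBC pB)),
    ← measure_union₀ mD.nullMeasurableSet (AEDisjoint.union_left (AEDisjoint.union_left
      (nul _ _ _ _ _ _ hAD pA) (nul _ _ _ _ _ _ hBD pB)) (nul _ _ _ _ _ _ hCD pC))]
  apply ENNReal.toReal_mono
  · refine measure_ne_top_of_subset Set.inter_subset_right ?_
    exact measure_union_ne_top (measure_union_ne_top (measure_union_ne_top
      measure_closedBall_lt_top.ne measure_closedBall_lt_top.ne)
      measure_closedBall_lt_top.ne) measure_closedBall_lt_top.ne
  · apply measure_mono
    rintro x (((h | h) | h) | h)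
    · exact ⟨sA h, Or.inl (Or.inl (Or.inl h.2))⟩
    · exact ⟨sB h, Or.inl (Or.inl (Or.inr h.2))⟩
    · exact ⟨sC h, Or.inl (Or.inr h.2)⟩
    · exact ⟨sD h, Or.inr h.2⟩

theorem CC_scale (a d e f g h : ℝ) : √(CC (1000 * a) (1000 * d) (1000 * e) (1000 * f) (1000 * g)
    (1000 * h)) = 10 ^ 9 * √(CC a d e f g h) := by
  have : CC (1000 * a) (1000 * d) (1000 * e) (1000 * f) (1000 * g) (1000 * h) =
      (10 ^ 9) ^ 2 * CC a d e f g h := by unfold CC; ring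
  rw [this, Real.sqrt_mul (by positivity), Real.sqrt_sq (by positivity)]

theorem Dv_scale (a b c x y z : ℝ) : Dv (1000 * a) (1000 * b) (1000 * c) (1000 * x) (1000 * y)
    (1000 * z) = 10 ^ 9 * Dv a b c x y z := by
  unfold Dv; ring

theorem supp_of_sphere (A B C D O : EuclideanSpace ℝ (Fin 3)) (R : ℝ) (R0 : 0 < R)
    (R1 : R ≤ √2 - 1) (oA : dist O A = 1 + R) (oB : dist O B = 1 + R)
    (oC : dist O C = (√2 - 1) + R) (oD : dist O D = (√2 - 1) + R) :
    Supp (1000 * dist A B) (1000 * dist C D) (1000 * dist A C) (1000 * dist A D) (1000 * dist B C)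
      (1000 * dist B D) := by
  intro l0 l1 l2 l3 h1 h2
  have key : l0 * l1 * dist A B ^ 2 + l2 * l3 * dist C D ^ 2 + l0 * l2 * dist A C ^ 2 +
      l0 * l3 * dist A D ^ 2 + l1 * l2 * dist B C ^ 2 + l1 * l3 * dist B D ^ 2 +
      ‖l0 • (A - O) + (l1 • (B - O) + l2 • (C - O) + l3 • (D - O))‖ ^ 2 =
      (l0 + l1 + l2 + l3) * (l0 * dist O A ^ 2 + l1 * dist O B ^ 2 + l2 * dist O C ^ 2 +
        l3 * dist O D ^ 2) := by
    rw [norm_add_sq_real, quad_dist, inner_add_right, inner_add_right]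
    simp only [inner_smul_left, inner_smul_right, norm_smul, mul_pow, inner_dist, norm_dist,
      Real.norm_eq_abs, sq_abs]
    simp; ring
  have h3 := sq_nonneg ‖l0 • (A - O) + (l1 • (B - O) + l2 • (C - O) + l3 • (D - O))‖
  rw [oA, oB, oC, oD] at key
  have r2 := sqrt2_sq
  have e1 : l0 * (1 + R) ^ 2 + l1 * (1 + R) ^ 2 + l2 * ((√2 - 1) + R) ^ 2 + l3 * ((√2 - 1) + R) ^ 2
      ≤ 2 * (l0 + l1) + 4 * (√2 - 1) ^ 2 * (l2 + l3) := by
    have p1 := mul_nonneg (sub_nonneg.2 R1) h2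
    have p2 : 0 ≤ ((√2 - 1) ^ 2 - R ^ 2) * (l0 + l1 + l2 + l3) :=
      mul_nonneg (by nlinarith) h1
    have e : 2 * (l0 + l1) + 4 * (√2 - 1) ^ 2 * (l2 + l3) - (l0 * (1 + R) ^ 2 + l1 * (1 + R) ^ 2 +
      l2 * ((√2 - 1) + R) ^ 2 + l3 * ((√2 - 1) + R) ^ 2) = 2 * ((√2 - 1 - R) *
       (l0 + l1 + (√2 - 1) * (l2 + l3))) + ((√2 - 1) ^ 2 - R ^ 2) * (l0 + l1 + l2 + l3) := by
      linear_combination (-(l0 + l1)) * r2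
    linarith
  have e2 := mul_le_mul_of_nonneg_left e1 h1
  calc _ = (l0 * l1 * dist A B ^ 2 + l2 * l3 * dist C D ^ 2 + l0 * l2 * dist A C ^ 2 +
      l0 * l3 * dist A D ^ 2 + l1 * l2 * dist B C ^ 2 + l1 * l3 * dist B D ^ 2) * 10 ^ 6 := by ring
    _ ≤ _ := by
      apply mul_le_mul_of_nonneg_right _ (by norm_num)
      linarith

end



theorem cone_B {A B C D : EuclideanSpace ℝ (Fin 3)} (T : TF A B C D) (ρ : ℝ) (hρ : 0 ≤ ρ)
    (hD : 0 < Dv (dist A B) (dist B C) (dist B D) (dist C D) (dist A D) (dist A C)) :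
    (volume (coneAt B A C D ∩ closedBall B ρ)).toReal = 2 / 3 * ρ ^ 3 * Real.arctan
      (√(CC (dist A B) (dist C D) (dist A C) (dist A D) (dist B C) (dist B D)) /
        Dv (dist A B) (dist B C) (dist B D) (dist C D) (dist A D) (dist A C)) := by
  have := vol_cone T.swap ρ hρ (by rwa [dist_comm B A])
  rw [dist_comm B A] at this
  rw [this]
  congr 4
  unfold CC; ring

theorem cone_C {A B C D : EuclideanSpace ℝ (Fin 3)} (T : TF A B C D) (ρ : ℝ) (hρ : 0 ≤ ρ)
    (hD : 0 < Dv (dist A C) (dist B C) (dist C D) (dist B D) (dist A D) (dist A B)) :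
    (volume (coneAt C A B D ∩ closedBall C ρ)).toReal = 2 / 3 * ρ ^ 3 * Real.arctan
      (√(CC (dist A B) (dist C D) (dist A C) (dist A D) (dist B C) (dist B D)) /
        Dv (dist A C) (dist B C) (dist C D) (dist B D) (dist A D) (dist A B)) := by
  have := vol_cone T.vC ρ hρ (by rwa [dist_comm C A, dist_comm C B])
  rw [dist_comm C A, dist_comm C B] at this
  rw [this]
  congr 4
  unfold CC; ring

theorem cone_D {A B C D : EuclideanSpace ℝ (Fin 3)} (T : TF A B C D) (ρ : ℝ) (hρ : 0 ≤ ρ)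
    (hD : 0 < Dv (dist A D) (dist B D) (dist C D) (dist B C) (dist A C) (dist A B)) :
    (volume (coneAt D A B C ∩ closedBall D ρ)).toReal = 2 / 3 * ρ ^ 3 * Real.arctan
      (√(CC (dist A B) (dist C D) (dist A C) (dist A D) (dist B C) (dist B D)) /
        Dv (dist A D) (dist B D) (dist C D) (dist B C) (dist A C) (dist A B)) := by
  have := vol_cone T.vD ρ hρ (by rwa [dist_comm D A, dist_comm D B, dist_comm D C])
  rw [dist_comm D A, dist_comm D B, dist_comm D C] at this
  rw [this]
  congr 4
  unfold CC; ring

theorem upper_part (A B C D : EuclideanSpace ℝ (Fin 3))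
    (haff : AffineIndependent ℝ ![A, B, C, D])
    (hAB : 2 ≤ dist A B)
    (hAC : 1 + (Real.sqrt 2 - 1) ≤ dist A C) (hAD : 1 + (Real.sqrt 2 - 1) ≤ dist A D)
    (hBC : 1 + (Real.sqrt 2 - 1) ≤ dist B C) (hBD : 1 + (Real.sqrt 2 - 1) ≤ dist B D)
    (hCD : 2 * (Real.sqrt 2 - 1) ≤ dist C D)
    (hsupp : ∃ O : EuclideanSpace ℝ (Fin 3), ∃ R : ℝ, 0 < R ∧ R ≤ Real.sqrt 2 - 1 ∧
      dist O A = 1 + R ∧ dist O B = 1 + R ∧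
      dist O C = (Real.sqrt 2 - 1) + R ∧ dist O D = (Real.sqrt 2 - 1) + R) :
    density A B C D 1 1 (Real.sqrt 2 - 1) (Real.sqrt 2 - 1) ≤ delOne / 10 ^ 15 := by
  have T : TF A B C D := exists_Fr A B C D haff
  obtain ⟨O, R, R0, R1, oA, oB, oC, oD⟩ := hsupp
  obtain ⟨b1, b2⟩ := sqrt2_bounds
  have hs := supp_of_sphere A B C D O R R0 R1 oA oB oC oD
  have tAB := dist_triangle_left A B O
  have tAC := dist_triangle_left A C O
  have tAD := dist_triangle_left A D O
  have tBC := dist_triangle_left B C O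
  have tBD := dist_triangle_left B D O
  have tCD := dist_triangle_left C D O
  have hCC : 0 ≤ CC (1000 * dist A B) (1000 * dist C D) (1000 * dist A C) (1000 * dist A D)
      (1000 * dist B C) (1000 * dist B D) := by
    have := T.CC_pos
    have e : CC (1000 * dist A B) (1000 * dist C D) (1000 * dist A C) (1000 * dist A D)
      (1000 * dist B C) (1000 * dist B D) = 10 ^ 18 * CC (dist A B) (dist C D) (dist A C)
      (dist A D) (dist B C) (dist B D) := by unfold CC; ring
    rw [e]; positivity
  have m := main_ineq (1000 * dist A B) (1000 * dist C D) (1000 * dist A C) (1000 * dist A D)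
      (1000 * dist B C) (1000 * dist B D) (by linarith) (by unfold d00; linarith)
      (by unfold e00; linarith) (by unfold e00; linarith) (by unfold e00; linarith)
      (by unfold e00; linarith) (by linarith) (by linarith) (by linarith) (by linarith)
      (by linarith) (by linarith) hs hCC
  obtain ⟨m1, m2, m3, m4, m5⟩ := m
  have p9 : (0:ℝ) < 10 ^ 9 := by norm_num
  rw [Dv_scale, mul_pos_iff_of_pos_left p9] at m1 m2 m3 m4
  rw [Dv_scale, Dv_scale, Dv_scale, Dv_scale, CC_scale, mul_div_mul_left _ _ p9.ne',
    mul_div_mul_left _ _ p9.ne', mul_div_mul_left _ _ p9.ne', mul_div_mul_left _ _ p9.ne'] at m5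
  apply dens_upper T
  rw [vol_cone T 1 (by norm_num) m1, cone_B T 1 (by norm_num) m2, cone_C T _ (by linarith) m3,
    cone_D T _ (by linarith) m4, vol_tetra T]
  simp only [W1, W3] at m5
  linarith

theorem lower_part (A B C D : EuclideanSpace ℝ (Fin 3))
    (haff : AffineIndependent ℝ ![A, B, C, D])
    (hAB : dist A B = 2) (hCD : dist C D = 2 * (Real.sqrt 2 - 1))
    (hAC : dist A C = 1 + (Real.sqrt 2 - 1)) (hAD : dist A D = 1 + (Real.sqrt 2 - 1))
    (hBC : dist B C = 1 + (Real.sqrt 2 - 1)) (hBD : dist B D = 1 + (Real.sqrt 2 - 1)) :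
    delOne / 10 ^ 15 ≤ density A B C D 1 1 (Real.sqrt 2 - 1) (Real.sqrt 2 - 1) := by
  have T : TF A B C D := exists_Fr A B C D haff
  obtain ⟨b1, b2⟩ := sqrt2_bounds
  have r2 := sqrt2_sq
  have a1 : dist A B ^ 2 = 4 := by rw [hAB]; norm_num
  have a2 : dist C D ^ 2 = 4 * (√2 - 1) ^ 2 := by rw [hCD]; ring
  have a3 : dist A C ^ 2 = 2 := by rw [hAC, add_sub_cancel, r2]
  have a4 : dist A D ^ 2 = 2 := by rw [hAD, add_sub_cancel, r2]
  have a5 : dist B C ^ 2 = 2 := by rw [hBC, add_sub_cancel, r2]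
  have a6 : dist B D ^ 2 = 2 := by rw [hBD, add_sub_cancel, r2]
  have rb : (√2 - 1) ^ 2 ≤ 1 / 2 := by nlinarith
  have rb0 := sq_nonneg (√2 - 1)
  have qA : ∀ u v w : ℝ, 0 ≤ u → 0 ≤ v → 0 ≤ w → (1:ℝ) ^ 2 * (u + v + w) ^ 2 ≤
      u ^ 2 * 4 + v ^ 2 * 2 + w ^ 2 * 2 + u * v * (4 + 2 - 2) + u * w * (4 + 2 - 2) +
        v * w * (2 + 2 - 4 * (√2 - 1) ^ 2) := by
    intro u v w hu hv hw
    have h1 := mul_nonneg (mul_nonneg hv hw) (sub_nonneg.2 rb)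
    have := mul_nonneg hu hv
    have := mul_nonneg hu hw
    nlinarith [sq_nonneg u, sq_nonneg v, sq_nonneg w]
  have qC : ∀ u v w : ℝ, 0 ≤ u → 0 ≤ v → 0 ≤ w → (√2 - 1) ^ 2 * (u + v + w) ^ 2 ≤
      u ^ 2 * 2 + v ^ 2 * 2 + w ^ 2 * (4 * (√2 - 1) ^ 2) + u * v * (2 + 2 - 4) +
        u * w * (2 + 4 * (√2 - 1) ^ 2 - 2) + v * w * (2 + 4 * (√2 - 1) ^ 2 - 2) := by
    intro u v w hu hv hw
    generalize (√2 - 1) ^ 2 = k at rb rb0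
    have h1 := mul_nonneg rb0 (sq_nonneg (u - v))
    have h2 := mul_nonneg (sub_nonneg.2 rb) (add_nonneg (sq_nonneg u) (sq_nonneg v))
    have h3 := mul_nonneg rb0 (sq_nonneg w)
    have h4 := mul_nonneg rb0 (mul_nonneg hu hw)
    have h5 := mul_nonneg rb0 (mul_nonneg hv hw)
    nlinarith [sq_nonneg u, sq_nonneg v]
  have DA : Dv (dist A B) (dist A C) (dist A D) (dist C D) (dist B D) (dist B C) = DA0 / 10 ^ 9 := by
    rw [hAB, hAC, hAD, hCD, hBD, hBC]; unfold DA0 Dv d00 e00; ring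
  have DB : Dv (dist A B) (dist B C) (dist B D) (dist C D) (dist A D) (dist A C) = DA0 / 10 ^ 9 := by
    rw [hAB, hAC, hAD, hCD, hBD, hBC]; unfold DA0 Dv d00 e00; ring
  have DC : Dv (dist A C) (dist B C) (dist C D) (dist B D) (dist A D) (dist A B) = DC0 / 10 ^ 9 := by
    rw [hAB, hAC, hAD, hCD, hBD, hBC]; unfold DC0 Dv d00 e00; ring
  have DD : Dv (dist A D) (dist B D) (dist C D) (dist B C) (dist A C) (dist A B) = DC0 / 10 ^ 9 := by
    rw [hAB, hAC, hAD, hCD, hBD, hBC]; unfold DC0 Dv d00 e00; ring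
  have SS : √(CC (dist A B) (dist C D) (dist A C) (dist A D) (dist B C) (dist B D)) = S0 / 10 ^ 9 := by
    have := CC_scale (dist A B) (dist C D) (dist A C) (dist A D) (dist B C) (dist B D)
    rw [eq_div_iff (by norm_num), mul_comm, ← this]
    unfold S0 d00 e00
    rw [hAB, hAC, hAD, hCD, hBD, hBC]
    congr 2 <;> ring
  have dA : 0 < DA0 := by rw [DA0_eq]; linarith
  have dC : 0 < DC0 := by rw [DC0_eq]; linarith
  have s0 : 0 < S0 := by linarith [S0_bounds.1]
  have p9 : (10:ℝ) ^ 9 ≠ 0 := by norm_num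
  apply dens_lower T
  · norm_num
  · norm_num
  · linarith
  · rw [hAB]; norm_num
  · rw [hAC]
  · rw [hAD]
  · rw [hBC]
  · rw [hBD]
  · rw [hCD]; linarith
  · apply cone_sub T _ (by norm_num)
    intro u v w hu hv hw
    rw [quad_dist, a1, a2, a3, a4, a5, a6]
    exact qA u v w hu hv hw
  · apply cone_sub T.swap _ (by norm_num)
    intro u v w hu hv hw
    rw [quad_dist, dist_comm B A, a1, a2, a3, a4, a5, a6]
    exact qA u v w hu hv hw
  · apply cone_sub T.vC _ (by linarith)
    intro u v w hu hv hw
    rw [quad_dist, dist_comm C A, dist_comm C B, a1, a2, a3, a4, a5, a6]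
    exact qC u v w hu hv hw
  · apply cone_sub T.vD _ (by linarith)
    intro u v w hu hv hw
    rw [quad_dist, dist_comm D A, dist_comm D B, dist_comm D C, a1, a2, a3, a4, a5, a6]
    exact qC u v w hu hv hw
  · rw [vol_cone T 1 (by norm_num) (by rw [DA]; positivity),
      cone_B T 1 (by norm_num) (by rw [DB]; positivity),
      cone_C T _ (by linarith) (by rw [DC]; positivity),
      cone_D T _ (by linarith) (by rw [DD]; positivity), vol_tetra T, DA, DB, DC, DD, SS,
      div_div_div_cancel_right₀ p9, div_div_div_cancel_right₀ p9]
    have e : delOne * S0 = 2 * (W1 * Real.arctan (S0 / DA0)) + 2 * (W3 * Real.arctan (S0 / DC0)) := by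
      unfold delOne; rw [div_mul_cancel₀ _ s0.ne']
    simp only [W1, W3] at e
    linarith

/-- The densest FM-tetrahedron of type 11rr is the tight one. -/
theorem densest_11rr
    (A B C D A₀ B₀ C₀ D₀ : EuclideanSpace ℝ (Fin 3))
    (haff : AffineIndependent ℝ ![A, B, C, D])
    (hAB : 2 ≤ dist A B)
    (hAC : 1 + (Real.sqrt 2 - 1) ≤ dist A C) (hAD : 1 + (Real.sqrt 2 - 1) ≤ dist A D)
    (hBC : 1 + (Real.sqrt 2 - 1) ≤ dist B C) (hBD : 1 + (Real.sqrt 2 - 1) ≤ dist B D)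
    (hCD : 2 * (Real.sqrt 2 - 1) ≤ dist C D)
    (hsupp : ∃ O : EuclideanSpace ℝ (Fin 3), ∃ R : ℝ, 0 < R ∧ R ≤ Real.sqrt 2 - 1 ∧
      dist O A = 1 + R ∧ dist O B = 1 + R ∧
      dist O C = (Real.sqrt 2 - 1) + R ∧ dist O D = (Real.sqrt 2 - 1) + R)
    (haff₀ : AffineIndependent ℝ ![A₀, B₀, C₀, D₀])
    (hAB₀ : dist A₀ B₀ = 2) (hCD₀ : dist C₀ D₀ = 2 * (Real.sqrt 2 - 1))
    (hAC₀ : dist A₀ C₀ = 1 + (Real.sqrt 2 - 1)) (hAD₀ : dist A₀ D₀ = 1 + (Real.sqrt 2 - 1))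
    (hBC₀ : dist B₀ C₀ = 1 + (Real.sqrt 2 - 1)) (hBD₀ : dist B₀ D₀ = 1 + (Real.sqrt 2 - 1)) :
    density A B C D 1 1 (Real.sqrt 2 - 1) (Real.sqrt 2 - 1) ≤
      density A₀ B₀ C₀ D₀ 1 1 (Real.sqrt 2 - 1) (Real.sqrt 2 - 1) := by
  exact (upper_part A B C D haff hAB hAC hAD hBC hBD hCD hsupp).trans
    (lower_part A₀ B₀ C₀ D₀ haff₀ hAB₀ hCD₀ hAC₀ hAD₀ hBC₀ hBD₀)
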